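/- Fix real numbers a < b, D ∈ (0, 1/2), W > 0 and Θ̄₀ ∈ [a, b], and let κ = 3^{2/3}/2^{1/3}. There exist μ₀ > 0 and C > 0 such that for every μ ∈ (0, μ₀), setting Θ̂₀ = μΘ̄₀, there are C^∞ functions R^s_∞, Θ^s_∞ defined on the domain D⁺_{W,D} = {(w,θ) : w ∈ [W, +∞), θ ∈ I_D⁺(w)} with the following properties. (i) For every (w,θ) ∈ D⁺_{W,D}, the solution of the planar circular restricted three-body problem in rotating polar coordinates centered at the first primary with initial condition (r, θ, R, Θ)(0) = (κ w^{2/3}, θ, R^s_∞(w,θ), Θ^s_∞(w,θ)) is defined for all t ≥ 0 and is forward-parabolic with asymptotic angular momentum Θ̂₀: r(t) → +∞, R(t) → 0 and Θ(t) → Θ̂₀ as t → +∞. (ii) |R^s_∞(w,θ) − √(2/κ) w^{−1/3}| ≤ Cμ and |Θ^s_∞(w,θ) − Θ̂₀ + μκ ∫_{+∞}^{w} s^{2/3} sin(θ+w−s)(1+κ²s^{4/3}−2κ s^{2/3}cos(θ+w−s))^{−3/2} ds + μ√(2/κ) ∫_{+∞}^{w} cos(θ+w−s) s^{−1/3} ds|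 ≤ Cμ², where the second integral is understood as an improper (oscillatory) integral. -/

import Mathlib

open Real Filter MeasureTheory intervalIntegral
open scoped Topology

/-- The constant `κ = 3^{2/3}/2^{1/3}`. -/
noncomputable def kap : ℝ := (3 : ℝ) ^ ((2 : ℝ) / 3) / (2 : ℝ) ^ ((1 : ℝ) / 3)

/-- `(r,θ,R,Θ)` is a solution of the PCRTBP with mass ratio `μ`, in rotating polar
coordinates centered at the first primary, on the set `I` of times. -/
def IsPolarSol (μ : ℝ) (I : Set ℝ) (r θ R Θ : ℝ → ℝ) : Prop :=
  ∀ t ∈ I,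
    HasDerivAt r (R t + μ * Real.sin (θ t)) t ∧
    HasDerivAt θ (Θ t / (r t) ^ 2 - 1 + μ * Real.cos (θ t) / r t) t ∧
    HasDerivAt R ((Θ t) ^ 2 / (r t) ^ 3 - 1 / (r t) ^ 2
      + μ * (1 / (r t) ^ 2 + Θ t * Real.cos (θ t) / (r t) ^ 2
          - (r t - Real.cos (θ t)) *
            (1 + (r t) ^ 2 - 2 * r t * Real.cos (θ t)) ^ (-(3 / 2) : ℝ))) t ∧
    HasDerivAt Θ (-μ * (R t * Real.cos (θ t) - Θ t * Real.sin (θ t) / r t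
      + r t * Real.sin (θ t) *
          (1 + (r t) ^ 2 - 2 * r t * Real.cos (θ t)) ^ (-(3 / 2) : ℝ))) t

/-- The angular domain `I_D⁺(w)`: all of `𝕋` when `w > √2/3 + D`, and the complement in
`𝕋` of the open arc of radius `D` around `√2/3 − w` otherwise (angles viewed mod `2π`). -/
def InIDplus (D w θ : ℝ) : Prop :=
  Real.sqrt 2 / 3 + D < w ∨ ∀ k : ℤ, D ≤ |θ - (Real.sqrt 2 / 3 - w) - 2 * π * k|

/-- The parameter domain `D⁺_{W,D}`. -/
def DomPlus (D W : ℝ) : Set (ℝ × ℝ) := {p : ℝ × ℝ | W ≤ p.1 ∧ InIDplus D p.1 p.2}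

/-- First (absolutely convergent) Melnikov integrand for the stable manifold of infinity. -/
noncomputable def melInfA (θ w s : ℝ) : ℝ :=
  s ^ ((2 : ℝ) / 3) * Real.sin (θ + w - s) *
    (1 + kap ^ 2 * s ^ ((4 : ℝ) / 3)
      - 2 * kap * s ^ ((2 : ℝ) / 3) * Real.cos (θ + w - s)) ^ (-(3 / 2) : ℝ)

/-- Second (oscillatory) Melnikov integrand for the stable manifold of infinity. -/
noncomputable def melInfB (θ w s : ℝ) : ℝ := Real.cos (θ + w - s) * s ^ (-(1 / 3) : ℝ)

open scoped BoundedContinuousFunction ContDiff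

section Superposition

variable {X ι : Type*} [TopologicalSpace X] [Fintype ι]

/-- The superposition (Nemytskii) operator `v ↦ f ∘ v` on bounded continuous functions. -/
noncomputable def superpose (f : (ι → ℝ) → ℝ) (hf : Continuous f) (v : ι → X →ᵇ ℝ) : X →ᵇ ℝ where
  toFun x := f fun i => v i x
  continuous_toFun := by fun_prop
  map_bounded' := by
    obtain ⟨C, hC⟩ := (isCompact_closedBall (0 : ι → ℝ) ‖v‖).exists_bound_of_continuousOn
      hf.continuousOn
    refine ⟨C + C, fun x y => ?_⟩
    have key : ∀ x, ‖f fun i => v i x‖ ≤ C := fun x => hC _ <| by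
      rw [mem_closedBall_zero_iff, pi_norm_le_iff_of_nonneg (norm_nonneg _)]
      exact fun i => ((v i).norm_coe_le_norm x).trans (norm_le_pi_norm v i)
    exact (dist_le_norm_add_norm _ _).trans (add_le_add (key x) (key y))

@[simp] lemma superpose_apply (f : (ι → ℝ) → ℝ) (hf : Continuous f) (v : ι → X →ᵇ ℝ) (x : X) :
    superpose f hf v x = f fun i => v i x := rfl

lemma norm_eval_le (v : ι → X →ᵇ ℝ) (x : X) : ‖fun i => v i x‖ ≤ ‖v‖ := by
  rw [pi_norm_le_iff_of_nonneg (norm_nonneg _)]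
  exact fun i => ((v i).norm_coe_le_norm x).trans (norm_le_pi_norm v i)

lemma continuous_superpose (f : (ι → ℝ) → ℝ) (hf : Continuous f) :
    Continuous (superpose (X := X) f hf) := by
  rw [continuous_iff_continuousAt]
  intro v
  rw [Metric.continuousAt_iff]
  intro ε hε
  have huc := (isCompact_closedBall (0 : ι → ℝ) (‖v‖ + 1)).uniformContinuousOn_of_continuous
    hf.continuousOn
  rw [Metric.uniformContinuousOn_iff] at huc
  obtain ⟨δ, hδ, h⟩ := huc (ε / 2) (by positivity)
  refine ⟨min δ 1, by positivity, fun {u} hu => ?_⟩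
  have hu1 : ‖u - v‖ < δ := by rw [← dist_eq_norm]; exact hu.trans_le (min_le_left _ _)
  have hu2 : ‖u - v‖ < 1 := by rw [← dist_eq_norm]; exact hu.trans_le (min_le_right _ _)
  have hu3 : ‖u‖ ≤ ‖v‖ + 1 := by
    have := norm_add_le v (u - v); rw [add_sub_cancel] at this; linarith
  refine lt_of_le_of_lt ((BoundedContinuousFunction.dist_le (by positivity)).2 fun x => ?_)
    (half_lt_self hε)
  refine (h _ ?_ _ ?_ ?_).le
  · simpa using (norm_eval_le u x).trans hu3
  · simpa using (norm_eval_le v x).trans (by linarith)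
  · rw [dist_eq_norm]
    exact (norm_eval_le (u - v) x).trans_lt hu1

/-- The partial derivative of `f` in the direction `i`. -/
noncomputable def partialD [DecidableEq ι] (f : (ι → ℝ) → ℝ) (i : ι) (x : ι → ℝ) : ℝ :=
  fderiv ℝ f x (Pi.single i 1)

lemma contDiff_partialD [DecidableEq ι] {f : (ι → ℝ) → ℝ} (hf : ContDiff ℝ ∞ f) (i : ι) :
    ContDiff ℝ ∞ (partialD f i) :=
  (hf.fderiv_right (m := ∞) (by simp)).clm_apply contDiff_const

lemma hasFDerivAt_superpose [DecidableEq ι] {f : (ι → ℝ) → ℝ} (hf : ContDiff ℝ ∞ f)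
    (v : ι → X →ᵇ ℝ) :
    HasFDerivAt (superpose (X := X) f hf.continuous)
      (∑ i, (ContinuousLinearMap.mul ℝ (X →ᵇ ℝ)
        (superpose (partialD f i) (contDiff_partialD hf i).continuous v)).comp
          (ContinuousLinearMap.proj i)) v := by
  rw [hasFDerivAt_iff_isLittleO_nhds_zero, Asymptotics.isLittleO_iff]
  intro ε hε
  have hdf : Continuous (fderiv ℝ f) := hf.continuous_fderiv (by simp)
  have huc := (isCompact_closedBall (0 : ι → ℝ) (‖v‖ + 1)).uniformContinuousOn_of_continuous
    hdf.continuousOn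
  rw [Metric.uniformContinuousOn_iff] at huc
  obtain ⟨δ, hδ, h⟩ := huc ε hε
  filter_upwards [Metric.ball_mem_nhds (0 : ι → X →ᵇ ℝ) (lt_min hδ one_pos)] with u hu
  rw [mem_ball_zero_iff, lt_min_iff] at hu
  rw [BoundedContinuousFunction.norm_le (by positivity)]
  intro x
  set a : ι → ℝ := fun i => v i x
  set k : ι → ℝ := fun i => u i x
  have hk : ‖k‖ ≤ ‖u‖ := norm_eval_le u x
  have ha : ‖a‖ ≤ ‖v‖ := norm_eval_le v x
  have key : ‖f (a + k) - f a - fderiv ℝ f a (a + k - a)‖ ≤ ε * ‖a + k - a‖ := by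
    refine (convex_closedBall a ‖k‖).norm_image_sub_le_of_norm_fderiv_le' (𝕜 := ℝ)
      (fun y _ => hf.differentiable (by simp) y) (fun y hy => ?_) (by simp) (by simp)
    rw [← dist_eq_norm]
    rw [mem_closedBall_iff_norm] at hy
    refine (h _ ?_ _ ?_ ?_).le
    · have := norm_add_le a (y - a)
      rw [add_sub_cancel] at this
      rw [mem_closedBall_zero_iff]; linarith
    · rw [mem_closedBall_zero_iff]; linarith
    · rw [dist_eq_norm]; linarith
  rw [add_sub_cancel_left] at key
  have e : fderiv ℝ f a k = ∑ i, partialD f i a * k i := by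
    conv_lhs => rw [← Finset.univ_sum_single k]
    rw [map_sum]
    refine Finset.sum_congr rfl fun i _ => ?_
    have : Pi.single i (k i) = k i • (Pi.single i 1 : ι → ℝ) := by
      rw [← Pi.single_smul]; simp
    rw [this, map_smul, smul_eq_mul, mul_comm, partialD]
  have e2 : (superpose f hf.continuous (v + u) - superpose f hf.continuous v -
      (∑ i, (ContinuousLinearMap.mul ℝ (X →ᵇ ℝ)
        (superpose (partialD f i) (contDiff_partialD hf i).continuous v)).comp
          (ContinuousLinearMap.proj i)) u) x = f (a + k) - f a - fderiv ℝ f a k := by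
    rw [e]
    simp only [sum_apply, BoundedContinuousFunction.coe_sub, Pi.sub_apply,
      BoundedContinuousFunction.coe_sum, Finset.sum_apply]
    rfl
  rw [e2]
  exact key.trans (by gcongr)

lemma contDiff_superpose_nat [DecidableEq ι] (n : ℕ) :
    ∀ (f : (ι → ℝ) → ℝ) (hf : ContDiff ℝ ∞ f),
      ContDiff ℝ n (superpose (X := X) f hf.continuous) := by
  induction n with
  | zero => exact fun f hf => contDiff_zero.2 (continuous_superpose f hf.continuous)
  | succ n ih =>
    intro f hf
    push_cast
    rw [contDiff_succ_iff_hasFDerivAt]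
    refine ⟨_, ?_, fun v => hasFDerivAt_superpose hf v⟩
    refine ContDiff.sum fun i _ => ContDiff.clm_comp ?_ contDiff_const
    exact (ContinuousLinearMap.contDiff (F := (X →ᵇ ℝ) →L[ℝ] X →ᵇ ℝ)
      (ContinuousLinearMap.mul ℝ (X →ᵇ ℝ))).comp (ih _ (contDiff_partialD hf i))

/-- Superposition by a smooth function is a smooth operator. -/
theorem contDiff_superpose {f : (ι → ℝ) → ℝ} (hf : ContDiff ℝ ∞ f) :
    ContDiff ℝ ∞ (superpose (X := X) f hf.continuous) := by
  classical
  exact contDiff_infty.2 fun n => contDiff_superpose_nat n f hf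

end Superposition

/-- A function which is smooth on an open neighbourhood of a compact set agrees near that set with
a globally smooth, compactly supported function. -/
theorem exists_contDiff_hasCompactSupport_eq {E : Type*} [NormedAddCommGroup E] [NormedSpace ℝ E]
    [FiniteDimensional ℝ E] {f : E → ℝ} {K Ω : Set E} (hK : IsCompact K) (hΩ : IsOpen Ω)
    (hKΩ : K ⊆ Ω) (hf : ContDiffOn ℝ ∞ f Ω) :
    ∃ g : E → ℝ, ContDiff ℝ ∞ g ∧ HasCompactSupport g ∧
      ∃ V, IsOpen V ∧ K ⊆ V ∧ V ⊆ Ω ∧ ∀ x ∈ V, g x = f x := by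
  obtain ⟨L, hL, hKL, hLΩ⟩ := exists_compact_between hK hΩ hKΩ
  obtain ⟨M, hM, hLM, hMΩ⟩ := exists_compact_between hL hΩ hLΩ
  obtain ⟨χ, h1, h0, -⟩ := exists_contMDiffMap_one_nhds_of_subset_interior
    (modelWithCornersSelf ℝ E) (n := (⊤ : ℕ∞)) hL.isClosed (t := interior M)
    (by rwa [interior_interior])
  have hχ : ContDiff ℝ ∞ χ := χ.contMDiff.contDiff
  refine ⟨fun x => χ x * f x, ?_, ?_, interior L, isOpen_interior, hKL,
    interior_subset.trans hLΩ, ?_⟩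
  · rw [contDiff_iff_contDiffAt]
    intro x
    by_cases hx : x ∈ M
    · exact hχ.contDiffAt.mul (hf.contDiffAt (hΩ.mem_nhds (hMΩ hx)))
    · have : (fun x => χ x * f x) =ᶠ[𝓝 x] fun _ => 0 := by
        filter_upwards [hM.isClosed.isOpen_compl.mem_nhds hx] with y hy
        rw [h0 y fun h => hy (interior_subset h), zero_mul]
      exact contDiffAt_const.congr_of_eventuallyEq this
  · refine HasCompactSupport.intro hM fun x hx => ?_
    rw [h0 x fun h => hx (interior_subset h), zero_mul]
  · intro x hx
    simp only [(Filter.Eventually.self_of_nhdsSet h1) x (interior_subset hx), one_mul]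

/-- Smooth dependence of the fixed point of a contraction on parameters. -/
theorem contDiffWithinAt_fixedPoint {P Y : Type*}
    [NormedAddCommGroup P] [NormedSpace ℝ P] [CompleteSpace P]
    [NormedAddCommGroup Y] [NormedSpace ℝ Y] [CompleteSpace Y]
    {F : P × Y → Y} {U : P → Y} {S : Set P} {B : Set Y} {p₀ : P} {K : NNReal} (hK : K < 1)
    (hF : ContDiffAt ℝ ∞ F (p₀, U p₀)) (hfix : F (p₀, U p₀) = U p₀)
    (hB : B ∈ 𝓝 (U p₀)) (hlip : LipschitzOnWith K (fun y => F (p₀, y)) B)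
    (huniq : ∀ p ∈ S, ∀ y ∈ B, F (p, y) = y → U p = y) :
    ContDiffWithinAt ℝ ∞ U S p₀ := by
  set G : P × Y → Y := fun z => z.2 - F z with hG
  have hGc : ContDiffAt ℝ ∞ G (p₀, U p₀) := contDiffAt_snd.sub hF
  have hFd : HasFDerivAt F (fderiv ℝ F (p₀, U p₀)) (p₀, U p₀) :=
    (hF.differentiableAt (by simp)).hasFDerivAt
  set A : Y →L[ℝ] Y := fderiv ℝ F (p₀, U p₀) ∘L .inr ℝ P Y with hA
  have hAd : HasFDerivAt (fun y => F (p₀, y)) A (U p₀) :=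
    hFd.comp (U p₀) (hasFDerivAt_prodMk_right p₀ (U p₀))
  have hAn : ‖A‖ < 1 := by
    refine (hAd.le_of_lipschitzOn hB hlip).trans_lt ?_
    exact_mod_cast hK
  have hGA : fderiv ℝ G (p₀, U p₀) ∘L .inr ℝ P Y = 1 - A := by
    rw [hG, fderiv_fun_sub differentiableAt_snd (hF.differentiableAt (by simp)), fderiv_snd]
    ext y
    simp [hA]
  have hinv : (fderiv ℝ G (p₀, U p₀) ∘L .inr ℝ P Y).IsInvertible := by
    rw [hGA]
    exact ⟨ContinuousLinearEquiv.ofUnit (Units.oneSub A hAn), rfl⟩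
  have hn : (∞ : ℕ∞ω) ≠ 0 := by simp
  set φ := hGc.implicitFunction hn hinv
  have hφ : ContDiffAt ℝ ∞ φ p₀ := hGc.contDiffAt_implicitFunction hn hinv
  have hφ0 : φ p₀ = U p₀ := hGc.implicitFunction_apply_self hn hinv
  have hev := hGc.eventually_apply_implicitFunction hn hinv
  have hφB : ∀ᶠ p in 𝓝 p₀, φ p ∈ B := hφ.continuousAt (by rw [hφ0]; exact hB)
  refine hφ.contDiffWithinAt.congr_of_eventuallyEq ?_ hφ0.symm
  filter_upwards [mem_nhdsWithin_of_mem_nhds hev, mem_nhdsWithin_of_mem_nhds hφB,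
    self_mem_nhdsWithin] with p h1 h2 h3
  refine huniq p h3 _ h2 ?_
  have : G (p₀, U p₀) = 0 := by simp [hG, hfix]
  have h1' : φ p - F (p, φ p) = 0 := h1.trans this
  exact (sub_eq_zero.1 h1').symm

section Averages

/-- The weighted tail integral `∫_t^∞ (τ + w)^{-α-1} v(τ) dτ`. -/
noncomputable def tailInt (w α : ℝ) (v : ℝ → ℝ) (t : ℝ) : ℝ :=
  ∫ τ in Set.Ioi t, (τ + w) ^ (-α - 1) * v τ

/-- The weighted integral `∫_0^t (τ + w)^{α-1} v(τ) dτ`. -/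
noncomputable def headInt (w α : ℝ) (v : ℝ → ℝ) (t : ℝ) : ℝ :=
  ∫ τ in (0 : ℝ)..t, (τ + w) ^ (α - 1) * v τ

/-- The scale invariant tail average `(t + w)^α ∫_t^∞ (τ + w)^{-α-1} v(τ) dτ`. -/
noncomputable def tailAvg (w α : ℝ) (v : ℝ → ℝ) (t : ℝ) : ℝ := (t + w) ^ α * tailInt w α v t

/-- The scale invariant average `(t + w)^{-α} ∫_0^t (τ + w)^{α-1} v(τ) dτ`. -/
noncomputable def headAvg (w α : ℝ) (v : ℝ → ℝ) (t : ℝ) : ℝ := (t + w) ^ (-α) * headInt w α v t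

variable {w α t M : ℝ} {v v' : ℝ → ℝ}

lemma hasDerivAt_rpow_add (γ : ℝ) (ht : -w < t) :
    HasDerivAt (fun t => (t + w) ^ γ) (γ * (t + w) ^ (γ - 1)) t := by
  have h0 : t + w ≠ 0 := by linarith
  simpa using ((hasDerivAt_id t).add_const w).rpow_const (p := γ) (Or.inl h0)

lemma continuousAt_rpow_add (γ : ℝ) (ht : -w < t) : ContinuousAt (fun τ => (τ + w) ^ γ) t :=
  (hasDerivAt_rpow_add γ ht).continuousAt

lemma integrableOn_rpow_mul (hα : 0 < α) (hv : Continuous v) (hM : ∀ t, |v t| ≤ M)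
    (ht : -w < t) : IntegrableOn (fun τ => (τ + w) ^ (-α - 1) * v τ) (Set.Ioi t) := by
  have h := integrableOn_add_rpow_Ioi_of_lt (a := -α - 1) (by linarith) ht
  exact h.mul_bdd hv.aestronglyMeasurable (Eventually.of_forall hM)

lemma integral_rpow_tail (hα : 0 < α) (ht : -w < t) :
    ∫ τ in Set.Ioi t, (τ + w) ^ (-α - 1) = (t + w) ^ (-α) / α := by
  have hd : ∀ x ∈ Set.Ici t,
      HasDerivAt (fun t => -((t + w) ^ (-α) / α)) ((x + w) ^ (-α - 1)) x := by
    intro x hx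
    have hx' : 0 < x + w := by have := Set.mem_Ici.1 hx; linarith
    convert! ((((hasDerivAt_id x).add_const w).rpow_const (p := -α)
      (Or.inl hx'.ne')).div_const α).neg using 1
    simp; field_simp
  have hlim : Tendsto (fun t => -((t + w) ^ (-α) / α)) atTop (𝓝 (-(0 / α))) :=
    (((tendsto_rpow_neg_atTop hα).comp (tendsto_atTop_add_const_right _ w tendsto_id)).div_const
      α).neg
  rw [integral_Ioi_of_hasDerivAt_of_tendsto' hd
    (integrableOn_add_rpow_Ioi_of_lt (by linarith) ht) hlim]
  simp

lemma abs_tailInt_le (hα : 0 < α) (hM : ∀ t, |v t| ≤ M) (ht : -w < t) :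
    |tailInt w α v t| ≤ M * ((t + w) ^ (-α) / α) := by
  rw [← integral_rpow_tail hα ht, mul_comm, ← MeasureTheory.integral_mul_const, tailInt,
    ← Real.norm_eq_abs]
  refine MeasureTheory.norm_integral_le_of_norm_le
    ((integrableOn_add_rpow_Ioi_of_lt (a := -α - 1) (by linarith) ht).mul_const M) ?_
  filter_upwards [ae_restrict_mem measurableSet_Ioi] with x hx
  have hx' : 0 < x + w := by have := Set.mem_Ioi.1 hx; linarith
  rw [norm_mul, Real.norm_eq_abs, Real.norm_eq_abs, abs_of_nonneg (by positivity)]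
  gcongr
  exact hM x

lemma abs_tailAvg_le (hα : 0 < α) (hM : ∀ t, |v t| ≤ M) (ht : -w < t) :
    |tailAvg w α v t| ≤ M / α := by
  have ht' : 0 < t + w := by linarith
  rw [tailAvg, abs_mul, abs_of_nonneg (by positivity)]
  calc (t + w) ^ α * |tailInt w α v t| ≤ (t + w) ^ α * (M * ((t + w) ^ (-α) / α)) := by
        gcongr; exact abs_tailInt_le hα hM ht
    _ = M / α := by rw [rpow_neg ht'.le]; field_simp

lemma hasDerivAt_tailInt (hα : 0 < α) (hv : Continuous v) (hM : ∀ t, |v t| ≤ M) (ht : -w < t) :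
    HasDerivAt (tailInt w α v) (-((t + w) ^ (-α - 1) * v t)) t := by
  obtain ⟨a, ha, hat⟩ := exists_between ht
  have hc : ∀ x, -w < x → ContinuousAt (fun τ => (τ + w) ^ (-α - 1) * v τ) x := fun x hx =>
    (continuousAt_rpow_add _ hx).mul hv.continuousAt
  have hcon : ContinuousOn (fun τ => (τ + w) ^ (-α - 1) * v τ) (Set.uIcc a t) := fun x hx => by
    rw [Set.uIcc_of_le hat.le] at hx
    exact (hc x (ha.trans_le hx.1)).continuousWithinAt
  have h1 : HasDerivAt (fun u => ∫ τ in a..u, (τ + w) ^ (-α - 1) * v τ)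
      ((t + w) ^ (-α - 1) * v t) t := by
    refine integral_hasDerivAt_right hcon.intervalIntegrable ?_ (hc t ht)
    refine ContinuousOn.stronglyMeasurableAtFilter (s := Set.Ioi (-w)) isOpen_Ioi
      (fun x hx => (hc x hx).continuousWithinAt) t ht
  have h2 := (h1.const_sub (∫ τ in Set.Ioi a, (τ + w) ^ (-α - 1) * v τ))
  refine h2.congr_of_eventuallyEq ?_
  filter_upwards [Ioi_mem_nhds ht] with x hx
  rw [tailInt, ← integral_Ioi_sub_Ioi' (integrableOn_rpow_mul hα hv hM ha)
    (integrableOn_rpow_mul hα hv hM hx)]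
  ring

lemma hasDerivAt_headInt (hw : 0 < w) (hv : Continuous v) (ht : -w < t) :
    HasDerivAt (headInt w α v) ((t + w) ^ (α - 1) * v t) t := by
  have hc : ∀ x, -w < x → ContinuousAt (fun τ => (τ + w) ^ (α - 1) * v τ) x := fun x hx =>
    (continuousAt_rpow_add _ hx).mul hv.continuousAt
  have hcon : ContinuousOn (fun τ => (τ + w) ^ (α - 1) * v τ) (Set.uIcc 0 t) := fun x hx => by
    refine (hc x (lt_of_lt_of_le ?_ hx.1)).continuousWithinAt
    exact lt_min (by linarith) ht
  refine integral_hasDerivAt_right hcon.intervalIntegrable ?_ (hc t ht)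
  exact ContinuousOn.stronglyMeasurableAtFilter (s := Set.Ioi (-w)) isOpen_Ioi
      (fun x hx => (hc x hx).continuousWithinAt) t ht

lemma hasDerivAt_tailAvg (hα : 0 < α) (hv : Continuous v) (hM : ∀ t, |v t| ≤ M) (ht : -w < t) :
    HasDerivAt (tailAvg w α v) ((α * tailAvg w α v t - v t) / (t + w)) t := by
  have ht' : 0 < t + w := by linarith
  refine ((hasDerivAt_rpow_add α ht).mul (hasDerivAt_tailInt hα hv hM ht)).congr_deriv ?_
  have e1 : (t + w) ^ (-α - 1) = ((t + w) ^ α)⁻¹ / (t + w) := by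
    rw [rpow_sub_one ht'.ne', rpow_neg ht'.le]
  have : 0 < (t + w) ^ α := by positivity
  rw [rpow_sub_one ht'.ne', e1, tailAvg]
  field_simp
  ring

lemma hasDerivAt_headAvg (hw : 0 < w) (hv : Continuous v) (ht : -w < t) :
    HasDerivAt (headAvg w α v) ((-α * headAvg w α v t + v t) / (t + w)) t := by
  have ht' : 0 < t + w := by linarith
  refine ((hasDerivAt_rpow_add (-α) ht).mul (hasDerivAt_headInt hw hv ht)).congr_deriv ?_
  have : 0 < (t + w) ^ α := by positivity
  rw [rpow_sub_one ht'.ne', rpow_sub_one ht'.ne', headAvg, rpow_neg ht'.le]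
  field_simp

lemma abs_headAvg_le (hw : 0 < w) (hα : 0 < α) (hM : ∀ t, |v t| ≤ M)
    (ht : 0 ≤ t) : |headAvg w α v t| ≤ M / α := by
  have ht' : 0 < t + w := by linarith
  have hM0 : 0 ≤ M := (abs_nonneg _).trans (hM 0)
  have hI : ∫ τ in (0 : ℝ)..t, (τ + w) ^ (α - 1) = ((t + w) ^ α - w ^ α) / α := by
    rw [integral_eq_sub_of_hasDerivAt (f := fun t => (t + w) ^ α / α)]
    · simp; ring
    · intro x hx
      rw [Set.uIcc_of_le ht] at hx
      refine ((hasDerivAt_rpow_add α (by linarith [hx.1])).div_const α).congr_deriv ?_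
      field_simp
    · refine ContinuousOn.intervalIntegrable fun x hx => ?_
      rw [Set.uIcc_of_le ht] at hx
      exact (continuousAt_rpow_add _ (by linarith [hx.1])).continuousWithinAt
  have hb : |headInt w α v t| ≤ M * (((t + w) ^ α - w ^ α) / α) := by
    rw [← hI, mul_comm, ← intervalIntegral.integral_mul_const, headInt, ← Real.norm_eq_abs]
    refine intervalIntegral.norm_integral_le_of_norm_le ht ?_ ?_
    · refine Eventually.of_forall fun x hx => ?_
      have hx' : 0 < x + w := by linarith [hx.1]
      rw [norm_mul, Real.norm_eq_abs, Real.norm_eq_abs, abs_of_nonneg (by positivity)]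
      gcongr
      exact hM x
    · refine ContinuousOn.intervalIntegrable fun x hx => ?_
      rw [Set.uIcc_of_le ht] at hx
      exact ((continuousAt_rpow_add _ (by linarith [hx.1])).mul
        continuousAt_const).continuousWithinAt
  rw [headAvg, abs_mul, abs_of_nonneg (by positivity)]
  calc (t + w) ^ (-α) * |headInt w α v t|
      ≤ (t + w) ^ (-α) * (M * (((t + w) ^ α - 0) / α)) := by
        gcongr
        refine hb.trans ?_
        gcongr
        positivity
    _ = M / α := by rw [rpow_neg ht'.le]; field_simp; ring

lemma intervalIntegrable_rpow_mul {w t γ : ℝ} (hw : 0 < w) (ht : 0 ≤ t) {v : ℝ → ℝ}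
    (hv : Continuous v) :
    IntervalIntegrable (fun τ => (τ + w) ^ γ * v τ) volume 0 t := by
  refine ContinuousOn.intervalIntegrable fun x hx => ?_
  rw [Set.uIcc_of_le ht] at hx
  exact ((continuousAt_rpow_add _ (by linarith [hx.1])).mul hv.continuousAt).continuousWithinAt

lemma tailAvg_add (hα : 0 < α) (ht : -w < t) (v u : ℝ →ᵇ ℝ) :
    tailAvg w α (v + u) t = tailAvg w α v t + tailAvg w α u t := by
  have hb : ∀ (f : ℝ →ᵇ ℝ) (s : ℝ), |f s| ≤ ‖f‖ := fun f s => f.norm_coe_le_norm s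
  simp only [tailAvg, tailInt]
  rw [← mul_add, ← MeasureTheory.integral_add (integrableOn_rpow_mul hα v.continuous (hb v) ht)
    (integrableOn_rpow_mul hα u.continuous (hb u) ht)]
  simp only [mul_add, Pi.add_apply]

lemma tailAvg_const_mul (c : ℝ) (v : ℝ → ℝ) :
    tailAvg w α (fun s => c * v s) t = c * tailAvg w α v t := by
  simp only [tailAvg, tailInt]
  rw [mul_left_comm, ← MeasureTheory.integral_const_mul c]
  congr 2
  funext s
  ring

lemma headAvg_add (hw : 0 < w) (ht : 0 ≤ t) (v u : ℝ →ᵇ ℝ) :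
    headAvg w α (v + u) t = headAvg w α v t + headAvg w α u t := by
  simp only [headAvg, headInt]
  rw [← mul_add, ← intervalIntegral.integral_add
    (intervalIntegrable_rpow_mul hw ht v.continuous)
    (intervalIntegrable_rpow_mul hw ht u.continuous)]
  simp only [mul_add, Pi.add_apply]

lemma headAvg_const_mul (c : ℝ) (v : ℝ → ℝ) :
    headAvg w α (fun s => c * v s) t = c * headAvg w α v t := by
  simp only [headAvg, headInt]
  rw [mul_left_comm, ← intervalIntegral.integral_const_mul c]
  congr 2
  funext s
  ring

end Averages

section Operators

/-- A bounded continuous function obtained by clamping the time variable to `[0, ∞)`. -/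
noncomputable def clampBdd (f : ℝ → ℝ) (C : ℝ) (hf : ContinuousOn f (Set.Ici 0))
    (hC : ∀ t, 0 ≤ t → |f t| ≤ C) : ℝ →ᵇ ℝ :=
  BoundedContinuousFunction.ofNormedAddCommGroup (fun t => f (max t 0))
    (hf.comp_continuous (by fun_prop) fun t => le_max_right t 0) C fun t => hC _ (le_max_right t 0)

@[simp] lemma clampBdd_apply (f : ℝ → ℝ) (C : ℝ) (hf : ContinuousOn f (Set.Ici 0))
    (hC : ∀ t, 0 ≤ t → |f t| ≤ C) (t : ℝ) : clampBdd f C hf hC t = f (max t 0) := rfl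

lemma abs_apply_le (v : ℝ →ᵇ ℝ) (t : ℝ) : |v t| ≤ ‖v‖ := v.norm_coe_le_norm t

/-- The tail average with `w = 1` as a bounded operator. -/
noncomputable def tailCLM (α : ℝ) (hα : 0 < α) : (ℝ →ᵇ ℝ) →L[ℝ] (ℝ →ᵇ ℝ) :=
  LinearMap.mkContinuous
    { toFun := fun v => clampBdd (tailAvg 1 α v) (‖v‖ / α)
        (fun t ht => (hasDerivAt_tailAvg hα v.continuous (abs_apply_le v)
          (by linarith [Set.mem_Ici.1 ht])).continuousAt.continuousWithinAt)
        (fun t ht => abs_tailAvg_le hα (abs_apply_le v) (by linarith))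
      map_add' := fun v u => by
        ext t
        exact tailAvg_add hα (by linarith [le_max_right t 0]) v u
      map_smul' := fun c v => by
        ext t
        exact tailAvg_const_mul c v }
    (1 / α) fun v => by
      have : 0 ≤ ‖v‖ := norm_nonneg v
      rw [BoundedContinuousFunction.norm_le (by positivity), one_div_mul_eq_div]
      exact fun t => abs_tailAvg_le hα (abs_apply_le v) (by linarith [le_max_right t 0])

/-- The head average with `w = 1` as a bounded operator. -/
noncomputable def headCLM (α : ℝ) (hα : 0 < α) : (ℝ →ᵇ ℝ) →L[ℝ] (ℝ →ᵇ ℝ) :=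
  LinearMap.mkContinuous
    { toFun := fun v => clampBdd (headAvg 1 α v) (‖v‖ / α)
        (fun t ht => (hasDerivAt_headAvg one_pos v.continuous
          (by linarith [Set.mem_Ici.1 ht])).continuousAt.continuousWithinAt)
        (fun t ht => abs_headAvg_le one_pos hα (abs_apply_le v) ht)
      map_add' := fun v u => by
        ext t
        exact headAvg_add one_pos (le_max_right t 0) v u
      map_smul' := fun c v => by
        ext t
        exact headAvg_const_mul c v }
    (1 / α) fun v => by
      have : 0 ≤ ‖v‖ := norm_nonneg v
      rw [BoundedContinuousFunction.norm_le (by positivity), one_div_mul_eq_div]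
      exact fun t => abs_headAvg_le one_pos hα (abs_apply_le v) (le_max_right t 0)

lemma tailCLM_apply {α : ℝ} (hα : 0 < α) (v : ℝ →ᵇ ℝ) (t : ℝ) :
    tailCLM α hα v t = tailAvg 1 α v (max t 0) := rfl

lemma headCLM_apply {α : ℝ} (hα : 0 < α) (v : ℝ →ᵇ ℝ) (t : ℝ) :
    headCLM α hα v t = headAvg 1 α v (max t 0) := rfl

/-- The function `t ↦ (1 + t)⁻¹`, clamped. -/
noncomputable def invTime : ℝ →ᵇ ℝ :=
  clampBdd (fun t => (1 + t)⁻¹) 1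
    (ContinuousOn.inv₀ (by fun_prop) fun t ht => by have := Set.mem_Ici.1 ht; positivity)
    (fun t ht => by
      rw [abs_of_nonneg (by positivity)]; exact inv_le_one_of_one_le₀ (by linarith))

/-- The family of bounded functions `w ↦ ((t + w) / (t + 1)) ^ γ` (for `w > 0`). -/
theorem exists_weight_family (γ : ℝ) : ∃ m : ℝ → (ℝ →ᵇ ℝ),
    ∀ w, 0 < w → ContDiffAt ℝ ∞ m w ∧ ∀ t, m w t = ((max t 0 + w) / (max t 0 + 1)) ^ γ := by
  have hbase : ∀ w t : ℝ, (max t 0 + w) / (max t 0 + 1) = 1 + (w - 1) * invTime t := by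
    intro w t
    have : 0 < max t 0 + 1 := by linarith [le_max_right t 0]
    simp only [invTime, clampBdd_apply]
    rw [add_comm 1 (max t 0)]
    field_simp
    ring
  have hinv : ∀ t, invTime t ∈ Set.Icc (0 : ℝ) 1 := fun t => by
    have : 0 ≤ max t 0 := le_max_right t 0
    simp only [invTime, clampBdd_apply]
    exact ⟨by positivity, inv_le_one_of_one_le₀ (by linarith)⟩
  have hpos : ∀ w t : ℝ, 0 < w → 0 < 1 + (w - 1) * invTime t := fun w t hw => by
    rw [← hbase]
    have : 0 ≤ max t 0 := le_max_right t 0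
    positivity
  have hloc : ∀ w₀ : ℝ, 0 < w₀ → ∃ m : ℝ → (ℝ →ᵇ ℝ), ContDiff ℝ ∞ m ∧
      ∀ w ∈ Set.Icc (w₀ / 2) (2 * w₀), ∀ t, m w t = (1 + (w - 1) * invTime t) ^ γ := by
    intro w₀ hw₀
    set K : Set (Fin 2 → ℝ) := Set.Icc ![0, w₀ / 2] ![1, 2 * w₀]
    set Ω : Set (Fin 2 → ℝ) := {x | 0 < 1 + (x 1 - 1) * x 0}
    have hΩ : IsOpen Ω := isOpen_lt (by fun_prop) (by fun_prop)
    have hKΩ : K ⊆ Ω := by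
      intro x hx
      have h0 := hx.1 0; have h1 := hx.1 1; have h2 := hx.2 0
      simp at h0 h1 h2
      change 0 < 1 + (x 1 - 1) * x 0
      rcases h0.eq_or_lt with h | h
      · simp [← h]
      · nlinarith [mul_pos (show 0 < x 1 by linarith) h]
    obtain ⟨g, hg, -, V, -, hKV, -, hgV⟩ := exists_contDiff_hasCompactSupport_eq
      (f := fun x : Fin 2 → ℝ => (1 + (x 1 - 1) * x 0) ^ γ) (isCompact_Icc : IsCompact K) hΩ hKΩ
      (ContDiffOn.rpow_const_of_ne (by fun_prop) fun x hx => (ne_of_gt hx))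
    refine ⟨fun w => superpose g hg.continuous ![invTime, BoundedContinuousFunction.const ℝ w],
      (contDiff_superpose hg).comp ?_, fun w hw t => ?_⟩
    · rw [contDiff_pi]
      intro i
      fin_cases i
      · exact contDiff_const
      · have : (fun w : ℝ => BoundedContinuousFunction.const ℝ w)
            = fun w : ℝ => w • (1 : ℝ →ᵇ ℝ) := by
          ext w t; simp
        simp only [Fin.mk_one, Matrix.cons_val_one, Matrix.cons_val_fin_one]
        rw [this]
        exact contDiff_id.smul contDiff_const
    · rw [superpose_apply, hgV]
      · simp
      · refine hKV ⟨fun i => ?_, fun i => ?_⟩ <;> fin_cases i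
        · simpa using (hinv t).1
        · simpa using hw.1
        · simpa using (hinv t).2
        · simpa using hw.2
  choose! m hm hm' using hloc
  refine ⟨fun w => m w w, fun w hw => ⟨?_, fun t => ?_⟩⟩
  · refine (hm w hw).contDiffAt.congr_of_eventuallyEq ?_
    filter_upwards [Icc_mem_nhds (show w / 2 < w by linarith) (show w < 2 * w by linarith),
      lt_mem_nhds hw] with u hu hu0
    ext t
    rw [hm' u hu0 u ⟨by linarith, by linarith⟩, hm' w hw u hu]
  · rw [hm' w hw w ⟨by linarith, by linarith⟩, hbase]

/-- The clamped weight `((t + w) / (t + 1)) ^ γ`. -/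
noncomputable def wt (γ w : ℝ) : ℝ →ᵇ ℝ := (exists_weight_family γ).choose w

lemma contDiffAt_wt (γ : ℝ) {w : ℝ} (hw : 0 < w) : ContDiffAt ℝ ∞ (wt γ) w :=
  ((exists_weight_family γ).choose_spec w hw).1

lemma wt_apply (γ : ℝ) {w : ℝ} (hw : 0 < w) (t : ℝ) :
    wt γ w t = ((max t 0 + w) / (max t 0 + 1)) ^ γ :=
  ((exists_weight_family γ).choose_spec w hw).2 t

/-- The tail average as an operator on bounded functions. -/
noncomputable def tailOp (α : ℝ) (hα : 0 < α) (w : ℝ) (v : ℝ →ᵇ ℝ) : ℝ →ᵇ ℝ :=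
  wt α w * tailCLM α hα (wt (-α - 1) w * v)

/-- The head average as an operator on bounded functions. -/
noncomputable def headOp (α : ℝ) (hα : 0 < α) (w : ℝ) (v : ℝ →ᵇ ℝ) : ℝ →ᵇ ℝ :=
  wt (-α) w * headCLM α hα (wt (α - 1) w * v)

lemma tailOp_apply {α w : ℝ} (hα : 0 < α) (hw : 0 < w) (v : ℝ →ᵇ ℝ) (t : ℝ) :
    tailOp α hα w v t = tailAvg w α v (max t 0) := by
  have h0 := le_max_right t 0
  rw [tailOp, BoundedContinuousFunction.mul_apply, tailCLM_apply, wt_apply α hw, tailAvg, tailAvg,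
    ← mul_assoc, div_rpow (by positivity) (by positivity),
    div_mul_cancel₀ _ (by positivity), tailInt, tailInt]
  congr 1
  refine setIntegral_congr_fun measurableSet_Ioi fun τ hτ => ?_
  have hτ0 : 0 < τ := h0.trans_lt hτ
  simp only [BoundedContinuousFunction.coe_mul, Pi.mul_apply]
  rw [wt_apply _ hw, max_eq_left hτ0.le, div_rpow (by positivity) (by positivity), ← mul_assoc,
    mul_div_cancel₀ _ (by positivity)]

lemma headOp_apply {α w : ℝ} (hα : 0 < α) (hw : 0 < w) (v : ℝ →ᵇ ℝ) (t : ℝ) :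
    headOp α hα w v t = headAvg w α v (max t 0) := by
  have h0 := le_max_right t 0
  rw [headOp, BoundedContinuousFunction.mul_apply, headCLM_apply, wt_apply _ hw, headAvg, headAvg,
    ← mul_assoc, div_rpow (by positivity) (by positivity),
    div_mul_cancel₀ _ (by positivity), headInt, headInt]
  congr 1
  refine intervalIntegral.integral_congr fun τ hτ => ?_
  rw [Set.uIcc_of_le h0] at hτ
  have hτ0 : 0 ≤ τ := hτ.1
  simp only [BoundedContinuousFunction.coe_mul, Pi.mul_apply]
  rw [wt_apply _ hw, max_eq_left hτ0, div_rpow (by positivity) (by positivity), ← mul_assoc,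
    mul_div_cancel₀ _ (by positivity)]

lemma norm_tailOp_le {α w : ℝ} (hα : 0 < α) (hw : 0 < w) (v : ℝ →ᵇ ℝ) :
    ‖tailOp α hα w v‖ ≤ ‖v‖ / α := by
  have : 0 ≤ ‖v‖ := norm_nonneg v
  rw [BoundedContinuousFunction.norm_le (by positivity)]
  intro t
  rw [tailOp_apply hα hw]
  exact abs_tailAvg_le hα (abs_apply_le v) (by linarith [le_max_right t 0])

lemma norm_headOp_le {α w : ℝ} (hα : 0 < α) (hw : 0 < w) (v : ℝ →ᵇ ℝ) :
    ‖headOp α hα w v‖ ≤ ‖v‖ / α := by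
  have : 0 ≤ ‖v‖ := norm_nonneg v
  rw [BoundedContinuousFunction.norm_le (by positivity)]
  intro t
  rw [headOp_apply hα hw]
  exact abs_headAvg_le hw hα (abs_apply_le v) (le_max_right t 0)

lemma tailOp_sub {α : ℝ} (hα : 0 < α) (w : ℝ) (v u : ℝ →ᵇ ℝ) :
    tailOp α hα w (v - u) = tailOp α hα w v - tailOp α hα w u := by
  simp only [tailOp, mul_sub, map_sub]

lemma headOp_sub {α : ℝ} (hα : 0 < α) (w : ℝ) (v u : ℝ →ᵇ ℝ) :
    headOp α hα w (v - u) = headOp α hα w v - headOp α hα w u := by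
  simp only [headOp, mul_sub, map_sub]

variable {P : Type*} [NormedAddCommGroup P] [NormedSpace ℝ P]

lemma ContDiffAt.bddMul {f g : P → ℝ →ᵇ ℝ} {p : P} (hf : ContDiffAt ℝ ∞ f p)
    (hg : ContDiffAt ℝ ∞ g p) : ContDiffAt ℝ ∞ (fun p => f p * g p) p := hf.mul hg

lemma ContDiffAt.tailOp {α : ℝ} (hα : 0 < α) {f : P → ℝ} {g : P → ℝ →ᵇ ℝ} {p : P}
    (hf : ContDiffAt ℝ ∞ f p) (hg : ContDiffAt ℝ ∞ g p) (hp : 0 < f p) :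
    ContDiffAt ℝ ∞ (fun p => tailOp α hα (f p) (g p)) p :=
  ((contDiffAt_wt α hp).comp p hf).bddMul <|
    (tailCLM α hα).contDiff.contDiffAt.comp p (((contDiffAt_wt _ hp).comp p hf).bddMul hg)

lemma ContDiffAt.headOp {α : ℝ} (hα : 0 < α) {f : P → ℝ} {g : P → ℝ →ᵇ ℝ} {p : P}
    (hf : ContDiffAt ℝ ∞ f p) (hg : ContDiffAt ℝ ∞ g p) (hp : 0 < f p) :
    ContDiffAt ℝ ∞ (fun p => headOp α hα (f p) (g p)) p :=
  ((contDiffAt_wt (-α) hp).comp p hf).bddMul <|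
    (headCLM α hα).contDiff.contDiffAt.comp p (((contDiffAt_wt _ hp).comp p hf).bddMul hg)

end Operators

section Nonlinearity

lemma kap_pos : 0 < kap := by unfold kap; positivity

lemma kap_cube : kap ^ 3 = 9 / 2 := by
  have h3 : ((3 : ℝ) ^ ((2 : ℝ) / 3)) ^ 3 = 9 := by
    rw [← rpow_natCast, ← rpow_mul (by norm_num)]; norm_num
  have h2 : ((2 : ℝ) ^ ((1 : ℝ) / 3)) ^ 3 = 2 := by
    rw [← rpow_natCast, ← rpow_mul (by norm_num)]; norm_num
  rw [kap, div_pow, h3, h2]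

/-- Ratio of the unperturbed radius to the perturbed one. The coordinates of the argument `y` are
`b = s^{-1/3}`, the cosine and sine of the unperturbed angle, the mass ratio, the scaled radial
deviation, the angular deviation, and the square-root scaled radial deviation and momentum. -/
noncomputable def nlX (y : Fin 8 → ℝ) : ℝ := (1 + y 0 ^ 2 * y 4 / kap)⁻¹

/-- Inverse barycentric radius. -/
noncomputable def nlNu (y : Fin 8 → ℝ) : ℝ := y 0 ^ 2 / kap * nlX y

/-- Cosine of the perturbed angle. -/
noncomputable def nlCos (y : Fin 8 → ℝ) : ℝ := y 1 * cos (y 5) - y 2 * sin (y 5)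

/-- Sine of the perturbed angle. -/
noncomputable def nlSin (y : Fin 8 → ℝ) : ℝ := y 2 * cos (y 5) + y 1 * sin (y 5)

/-- Relative squared distance to the first primary, minus one. -/
noncomputable def nlY1 (y : Fin 8 → ℝ) : ℝ := y 3 * nlNu y * (2 * nlCos y + y 3 * nlNu y)

/-- Relative squared distance to the second primary, minus one. -/
noncomputable def nlY2 (y : Fin 8 → ℝ) : ℝ :=
  (1 - y 3) * nlNu y * (-2 * nlCos y + (1 - y 3) * nlNu y)

/-- The function with `(1 + x)^{-3/2} = 1 + x * invCubeSlope (√(1 + x))`. -/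
noncomputable def invCubeSlope (q : ℝ) : ℝ := -(1 + q + q ^ 2) / (q ^ 3 * (1 + q))

lemma inv_cube_eq {q x : ℝ} (hq : 0 < q) (hx : q ^ 2 = 1 + x) :
    (q ^ 3)⁻¹ = 1 + x * invCubeSlope q := by
  obtain rfl : x = q ^ 2 - 1 := by linarith
  rw [invCubeSlope]
  field_simp
  ring

/-- The rescaled perturbing force: radial, angular and momentum components. -/
noncomputable def nl (i : Fin 3) (y : Fin 8 → ℝ) : ℝ :=
  ![-(kap ^ 4)⁻¹ * y 0 ^ 2 * y 6 ^ 2 * (3 + 2 * (y 0 ^ 2 * y 4 / kap)) * nlX y ^ 2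
      + y 7 ^ 2 * (kap ^ 3)⁻¹ * nlX y ^ 3
      - (1 - y 3) * (kap ^ 3)⁻¹ * nlX y ^ 3 *
        ((1 + y 3 * nlNu y * nlCos y) * (2 * nlCos y + y 3 * nlNu y)
            * invCubeSlope √(1 + nlY1 y)
          + (1 - (1 - y 3) * nlNu y * nlCos y) * (-2 * nlCos y + (1 - y 3) * nlNu y)
            * invCubeSlope √(1 + nlY2 y)),
    y 7 * (kap ^ 2)⁻¹ * nlX y ^ 2,
    (1 - y 3) * (kap ^ 2)⁻¹ * nlX y ^ 2 * nlSin y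
      * ((√(1 + nlY1 y) ^ 3)⁻¹ - (√(1 + nlY2 y) ^ 3)⁻¹)] i

/-- The domain without collisions. -/
def nlDom : Set (Fin 8 → ℝ) :=
  {y | 0 < 1 + y 0 ^ 2 * y 4 / kap ∧ 0 < 1 + nlY1 y ∧ 0 < 1 + nlY2 y}

lemma contDiffOn_nlX : ContDiffOn ℝ ∞ nlX {y | 0 < 1 + y 0 ^ 2 * y 4 / kap} := by
  refine ContDiffOn.inv (ContDiff.contDiffOn (by fun_prop)) fun y hy => ne_of_gt hy

lemma contDiffOn_nlNu : ContDiffOn ℝ ∞ nlNu {y | 0 < 1 + y 0 ^ 2 * y 4 / kap} :=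
  (ContDiff.contDiffOn (by fun_prop)).mul contDiffOn_nlX

lemma contDiff_nlCos : ContDiff ℝ ∞ nlCos := by unfold nlCos; fun_prop

lemma contDiff_nlSin : ContDiff ℝ ∞ nlSin := by unfold nlSin; fun_prop

lemma contDiffOn_nlY1 : ContDiffOn ℝ ∞ nlY1 {y | 0 < 1 + y 0 ^ 2 * y 4 / kap} := by
  have h := contDiffOn_nlNu
  have h2 := contDiff_nlCos
  unfold nlY1
  fun_prop

lemma contDiffOn_nlY2 : ContDiffOn ℝ ∞ nlY2 {y | 0 < 1 + y 0 ^ 2 * y 4 / kap} := by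
  have h := contDiffOn_nlNu
  have h2 := contDiff_nlCos
  unfold nlY2
  fun_prop

lemma isOpen_nlDom : IsOpen nlDom := by
  have h0 : IsOpen {y : Fin 8 → ℝ | 0 < 1 + y 0 ^ 2 * y 4 / kap} :=
    isOpen_lt (by fun_prop) (by fun_prop)
  have h1 := ((continuousOn_const (c := (1 : ℝ))).add
    contDiffOn_nlY1.continuousOn).isOpen_inter_preimage h0
    (isOpen_Ioi (a := (0 : ℝ)))
  have h2 := ((continuousOn_const (c := (1 : ℝ))).add
    contDiffOn_nlY2.continuousOn).isOpen_inter_preimage h0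
    (isOpen_Ioi (a := (0 : ℝ)))
  refine Eq.subst (motive := IsOpen) (Set.ext fun y => ?_) (h1.inter h2)
  exact ⟨fun ⟨⟨a, b⟩, _, c⟩ => ⟨a, b, c⟩, fun ⟨a, b, c⟩ => ⟨⟨a, b⟩, a, c⟩⟩

lemma contDiffOn_nl (i : Fin 3) : ContDiffOn ℝ ∞ (nl i) nlDom := by
  have hsub : nlDom ⊆ {y | 0 < 1 + y 0 ^ 2 * y 4 / kap} := fun y hy => hy.1
  have hX := contDiffOn_nlX.mono hsub
  have hN := contDiffOn_nlNu.mono hsub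
  have hC := contDiff_nlCos.contDiffOn (s := nlDom)
  have hS := contDiff_nlSin.contDiffOn (s := nlDom)
  have hq1 : ContDiffOn ℝ ∞ (fun y => √(1 + nlY1 y)) nlDom :=
    (contDiffOn_const.add (contDiffOn_nlY1.mono hsub)).sqrt fun y hy => hy.2.1.ne'
  have hq2 : ContDiffOn ℝ ∞ (fun y => √(1 + nlY2 y)) nlDom :=
    (contDiffOn_const.add (contDiffOn_nlY2.mono hsub)).sqrt fun y hy => hy.2.2.ne'
  have hp1 : ∀ y ∈ nlDom, 0 < √(1 + nlY1 y) := fun y hy => sqrt_pos.2 hy.2.1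
  have hp2 : ∀ y ∈ nlDom, 0 < √(1 + nlY2 y) := fun y hy => sqrt_pos.2 hy.2.2
  have hh1 : ContDiffOn ℝ ∞ (fun y => invCubeSlope √(1 + nlY1 y)) nlDom := by
    unfold invCubeSlope
    exact ContDiffOn.div (by fun_prop) (by fun_prop) fun y hy => by
      have := hp1 y hy; positivity
  have hh2 : ContDiffOn ℝ ∞ (fun y => invCubeSlope √(1 + nlY2 y)) nlDom := by
    unfold invCubeSlope
    exact ContDiffOn.div (by fun_prop) (by fun_prop) fun y hy => by
      have := hp2 y hy; positivity
  have hi1 : ContDiffOn ℝ ∞ (fun y => (√(1 + nlY1 y) ^ 3)⁻¹) nlDom :=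
    ContDiffOn.inv (by fun_prop) fun y hy => by have := hp1 y hy; positivity
  have hi2 : ContDiffOn ℝ ∞ (fun y => (√(1 + nlY2 y) ^ 3)⁻¹) nlDom :=
    ContDiffOn.inv (by fun_prop) fun y hy => by have := hp2 y hy; positivity
  clear hq1 hq2 hp1 hp2
  unfold nl
  fin_cases i
  · simp only [Fin.zero_eta, Matrix.cons_val_zero]; fun_prop
  · simp only [Fin.mk_one, Matrix.cons_val_one, Matrix.cons_val_zero]; fun_prop
  · simp only [Fin.reduceFinMk, Matrix.cons_val]; fun_prop

/-- The compact set of unperturbed data `(b, cos, sin)` away from collision. -/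
def baseSet (B d : ℝ) : Set (Fin 8 → ℝ) :=
  {y | 0 ≤ y 0 ∧ y 0 ≤ B ∧ |y 1| ≤ 1 ∧ |y 2| ≤ 1 ∧
    d ≤ 1 - 2 * (y 0 ^ 2 / kap) * y 1 + (y 0 ^ 2 / kap) ^ 2}

/-- Setting the perturbation coordinates to zero. -/
def baseProj (y : Fin 8 → ℝ) : Fin 8 → ℝ := ![y 0, y 1, y 2, 0, 0, 0, 0, 0]

lemma baseProj_mem_nlDom {B d : ℝ} (hd : 0 < d) {y : Fin 8 → ℝ} (hy : y ∈ baseSet B d) :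
    baseProj y ∈ nlDom := by
  have := hy.2.2.2.2
  simp only [nlDom, nlY1, nlY2, nlNu, nlX, nlCos, baseProj, Set.mem_ofPred_eq]
  simp
  linarith

theorem exists_extension_nl (B : ℝ) {d : ℝ} (hd : 0 < d) :
    ∃ φ : Fin 3 → (Fin 8 → ℝ) → ℝ, (∀ i, ContDiff ℝ ∞ (φ i)) ∧
      ∃ M, 0 < M ∧ (∀ i x, |φ i x| ≤ M) ∧ (∀ i x y, |φ i x - φ i y| ≤ M * ‖x - y‖) ∧
      ∃ ε, 0 < ε ∧ ∀ y ∈ baseSet B d, ‖y - baseProj y‖ ≤ ε →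
        y ∈ nlDom ∧ ∀ i, φ i y = nl i y := by
  set K : Set (Fin 8 → ℝ) := baseProj '' (baseSet B d) with hK
  have hKc : IsCompact K := by
    refine Metric.isCompact_of_isClosed_isBounded ?_ ?_
    · have : K = baseSet B d ∩ {y | baseProj y = y} := by
        ext y
        constructor
        · rintro ⟨x, hx, rfl⟩
          exact ⟨hx, rfl⟩
        · rintro ⟨hy, hy'⟩
          exact ⟨y, hy, hy'⟩
      rw [this]
      have hc : Continuous baseProj := by
        refine continuous_pi fun i => ?_
        fin_cases i <;> simp [baseProj] <;> fun_prop
      refine IsClosed.inter ?_ (isClosed_eq hc continuous_id)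
      simp only [baseSet, Set.ofPred_and]
      have h0 := isClosed_le (f := fun y : Fin 8 → ℝ => (0 : ℝ)) (g := fun y => y 0)
        (by fun_prop) (by fun_prop)
      have h1 := isClosed_le (f := fun y : Fin 8 → ℝ => y 0) (g := fun y => B)
        (by fun_prop) (by fun_prop)
      have h2 := isClosed_le (f := fun y : Fin 8 → ℝ => |y 1|) (g := fun y => 1)
        (by fun_prop) (by fun_prop)
      have h3 := isClosed_le (f := fun y : Fin 8 → ℝ => |y 2|) (g := fun y => 1)
        (by fun_prop) (by fun_prop)
      have h4 := isClosed_le (f := fun y : Fin 8 → ℝ => d)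
        (g := fun y => 1 - 2 * (y 0 ^ 2 / kap) * y 1 + (y 0 ^ 2 / kap) ^ 2)
        (by fun_prop) (by fun_prop)
      exact h0.inter (h1.inter (h2.inter (h3.inter h4)))
    · refine (Metric.isBounded_closedBall (x := (0 : Fin 8 → ℝ)) (r := max B 1)).subset ?_
      rintro _ ⟨x, ⟨h0, h1, h2, h3, -⟩, rfl⟩
      rw [mem_closedBall_zero_iff, pi_norm_le_iff_of_nonneg (by positivity)]
      intro i
      fin_cases i <;> simp [baseProj, abs_of_nonneg, *]
  have hKΩ : K ⊆ nlDom := by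
    rintro _ ⟨x, hx, rfl⟩
    exact baseProj_mem_nlDom hd hx
  have hext := fun i => exists_contDiff_hasCompactSupport_eq hKc isOpen_nlDom hKΩ (contDiffOn_nl i)
  choose φ hφ hφc V hVo hKV hVΩ hφV using hext
  have hM : ∀ i, ∃ M : ℝ, 0 < M ∧ (∀ x, |φ i x| ≤ M) ∧ (∀ x y, |φ i x - φ i y| ≤ M * ‖x - y‖) := by
    intro i
    obtain ⟨M₁, h₁⟩ := (hφc i).exists_bound_of_continuous (hφ i).continuous
    obtain ⟨M₂, h₂⟩ := (hφ i).lipschitzWith_of_hasCompactSupport (hφc i) (by simp)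
    refine ⟨max (max M₁ M₂) 1, by positivity, fun x => (h₁ x).trans (by simp), fun x y => ?_⟩
    refine ((h₂.dist_le_mul x y).trans_eq (by rw [dist_eq_norm])).trans ?_
    gcongr
    simp
  choose M hM0 hM1 hM2 using hM
  have hMle : ∀ i, M i ≤ ∑ j, M j := fun i =>
    Finset.single_le_sum (fun j _ => (hM0 j).le) (Finset.mem_univ i)
  obtain ⟨ε, hε, hεV⟩ := hKc.exists_cthickening_subset_open (isOpen_iInter_of_finite hVo)
    (Set.subset_iInter hKV)
  refine ⟨φ, hφ, ∑ j, M j, (hM0 0).trans_le (hMle 0), fun i x => (hM1 i x).trans (hMle i),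
    fun i x y => (hM2 i x y).trans (by gcongr; exact hMle i), ε, hε, fun y hy hyε => ?_⟩
  have hyV : ∀ i, y ∈ V i := Set.mem_iInter.1 <| hεV <|
    Metric.mem_cthickening_of_dist_le y (baseProj y) ε K ⟨y, hy, rfl⟩ (by rwa [dist_eq_norm])
  exact ⟨hVΩ 0 (hyV 0), fun i => hφV i y (hyV i)⟩

end Nonlinearity

section FixedPoint

/-- The clamped function `(t + 1)^{-1/3}`. -/
noncomputable def decayBdd : ℝ →ᵇ ℝ :=
  clampBdd (fun t => (t + 1) ^ (-(1 / 3) : ℝ)) 1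
    (continuousOn_of_forall_continuousAt fun t ht => continuousAt_rpow_add _
      (by linarith [Set.mem_Ici.1 ht]))
    (fun t ht => by
      rw [abs_of_nonneg (by positivity)]
      exact rpow_le_one_of_one_le_of_nonpos (by linarith) (by norm_num))

/-- The clamped function `(t + w)^{-1/3}`. -/
noncomputable def bBdd (w : ℝ) : ℝ →ᵇ ℝ := decayBdd * wt (-(1 / 3)) w

lemma bBdd_apply {w : ℝ} (hw : 0 < w) (t : ℝ) :
    bBdd w t = (max t 0 + w) ^ (-(1 / 3) : ℝ) := by
  have h0 := le_max_right t 0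
  rw [bBdd, BoundedContinuousFunction.mul_apply, wt_apply _ hw, decayBdd, clampBdd_apply,
    div_rpow (by positivity) (by positivity), mul_div_cancel₀ _ (by positivity)]

lemma bBdd_nonneg {w : ℝ} (hw : 0 < w) (t : ℝ) : 0 ≤ bBdd w t := by
  rw [bBdd_apply hw]
  have := le_max_right t 0
  positivity

lemma bBdd_le {W w : ℝ} (hW : 0 < W) (hw : W ≤ w) (t : ℝ) :
    bBdd w t ≤ W ^ (-(1 / 3) : ℝ) := by
  rw [bBdd_apply (hW.trans_le hw)]
  exact rpow_le_rpow_of_nonpos hW (by linarith [le_max_right t 0]) (by norm_num)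

lemma norm_bBdd_le {W w : ℝ} (hW : 0 < W) (hw : W ≤ w) : ‖bBdd w‖ ≤ W ^ (-(1 / 3) : ℝ) := by
  rw [BoundedContinuousFunction.norm_le (by positivity)]
  intro t
  rw [Real.norm_eq_abs, abs_of_nonneg (bBdd_nonneg (hW.trans_le hw) t)]
  exact bBdd_le hW hw t

lemma norm_rpow_smul_bBdd_le {w : ℝ} (hw : 0 < w) : ‖w ^ (1 / 3 : ℝ) • bBdd w‖ ≤ 1 := by
  rw [norm_smul, Real.norm_eq_abs, abs_of_nonneg (by positivity)]
  calc w ^ (1 / 3 : ℝ) * ‖bBdd w‖ ≤ w ^ (1 / 3 : ℝ) * w ^ (-(1 / 3) : ℝ) := by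
        gcongr; exact norm_bBdd_le hw le_rfl
    _ = 1 := by rw [← rpow_add hw]; simp

lemma contDiffAt_bBdd {w : ℝ} (hw : 0 < w) : ContDiffAt ℝ ∞ bBdd w :=
  contDiffAt_const.bddMul (contDiffAt_wt _ hw)

/-- The clamped cosine. -/
noncomputable def cosBdd : ℝ →ᵇ ℝ :=
  clampBdd cos 1 continuous_cos.continuousOn fun t _ => abs_cos_le_one t

/-- The clamped sine. -/
noncomputable def sinBdd : ℝ →ᵇ ℝ :=
  clampBdd sin 1 continuous_sin.continuousOn fun t _ => abs_sin_le_one t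

/-- The arguments of the nonlinearities along a candidate solution. -/
noncomputable def nlArgs (δ : ℝ) (p : ℝ × ℝ) (u : Fin 3 → ℝ →ᵇ ℝ) : Fin 8 → ℝ →ᵇ ℝ :=
  ![bBdd p.1, cos p.2 • cosBdd + sin p.2 • sinBdd, sin p.2 • cosBdd - cos p.2 • sinBdd,
    δ ^ 2 • 1, δ ^ 2 • u 0, δ • u 1, δ • u 0, δ • u 2]

lemma nlArgs_apply (δ : ℝ) {p : ℝ × ℝ} (hp : 0 < p.1) (u : Fin 3 → ℝ →ᵇ ℝ) (t : ℝ) :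
    (fun i => nlArgs δ p u i t) = ![(max t 0 + p.1) ^ (-(1 / 3) : ℝ), cos (p.2 - max t 0),
      sin (p.2 - max t 0), δ ^ 2, δ ^ 2 * u 0 t, δ * u 1 t, δ * u 0 t, δ * u 2 t] := by
  funext i
  fin_cases i <;>
    simp [nlArgs, bBdd_apply hp, cosBdd, sinBdd, cos_sub, sin_sub]

lemma contDiffAt_nlArgs (δ : ℝ) {q : (ℝ × ℝ) × (Fin 3 → ℝ →ᵇ ℝ)} (hq : 0 < q.1.1) :
    ContDiffAt ℝ ∞ (fun q : (ℝ × ℝ) × (Fin 3 → ℝ →ᵇ ℝ) => nlArgs δ q.1 q.2) q := by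
  have hb : ContDiffAt ℝ ∞ (fun q : (ℝ × ℝ) × (Fin 3 → ℝ →ᵇ ℝ) => bBdd q.1.1) q :=
    ContDiffAt.comp (g := bBdd) q (contDiffAt_bBdd hq) (by fun_prop)
  rw [contDiffAt_pi]
  intro i
  fin_cases i <;> simp only [nlArgs, Fin.zero_eta, Fin.mk_one, Fin.reduceFinMk, Matrix.cons_val]
  · exact hb
  all_goals fun_prop

variable (φ : Fin 3 → (Fin 8 → ℝ) → ℝ) (hφ : ∀ i, ContDiff ℝ ∞ (φ i))

/-- The force evaluated along a candidate solution. -/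
noncomputable def force (i : Fin 3) (δ : ℝ) (p : ℝ × ℝ) (u : Fin 3 → ℝ →ᵇ ℝ) : ℝ →ᵇ ℝ :=
  superpose (φ i) (hφ i).continuous (nlArgs δ p u)

/-- The integral `∫_t^∞ s^{-4/3} f` of a force component. -/
noncomputable def forceTail (i : Fin 3) (δ : ℝ) (p : ℝ × ℝ) (u : Fin 3 → ℝ →ᵇ ℝ) : ℝ →ᵇ ℝ :=
  bBdd p.1 * tailOp (1 / 3) (by norm_num) p.1 (force φ hφ i δ p u)

/-- The rescaled derivative variable of the radial component. -/
noncomputable def radialTail (δ : ℝ) (p : ℝ × ℝ) (u : Fin 3 → ℝ →ᵇ ℝ) : ℝ →ᵇ ℝ :=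
  tailOp (4 / 3) (by norm_num) p.1 (force φ hφ 0 δ p u)

/-- The fixed point map: its fixed points are the orbits with initial radial deviation `ξ₀ p`,
initial angular deviation `ψ₀ p` and asymptotic angular momentum `Θ`. -/
noncomputable def fixMap (δ Θ : ℝ) (ξ₀ ψ₀ : ℝ × ℝ → ℝ) (q : (ℝ × ℝ) × (Fin 3 → ℝ →ᵇ ℝ)) :
    Fin 3 → ℝ →ᵇ ℝ :=
  ![ξ₀ q.1 • q.1.1 ^ (1 / 3 : ℝ) • bBdd q.1.1
      - headOp (1 / 3) (by norm_num) q.1.1 (radialTail φ hφ δ q.1 q.2),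
    (ψ₀ q.1 + forceTail φ hφ 1 δ q.1 q.2 0) • 1 - forceTail φ hφ 1 δ q.1 q.2,
    Θ • 1 - forceTail φ hφ 2 δ q.1 q.2]

lemma contDiffAt_force (i : Fin 3) (δ : ℝ) {q : (ℝ × ℝ) × (Fin 3 → ℝ →ᵇ ℝ)} (hq : 0 < q.1.1) :
    ContDiffAt ℝ ∞ (fun q : (ℝ × ℝ) × (Fin 3 → ℝ →ᵇ ℝ) => force φ hφ i δ q.1 q.2) q :=
  (contDiff_superpose (hφ i)).contDiffAt.comp q (contDiffAt_nlArgs δ hq)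

lemma contDiffAt_forceTail (i : Fin 3) (δ : ℝ) {q : (ℝ × ℝ) × (Fin 3 → ℝ →ᵇ ℝ)}
    (hq : 0 < q.1.1) :
    ContDiffAt ℝ ∞ (fun q : (ℝ × ℝ) × (Fin 3 → ℝ →ᵇ ℝ) => forceTail φ hφ i δ q.1 q.2) q :=
  (ContDiffAt.comp (g := bBdd) q (contDiffAt_bBdd hq) (by fun_prop)).bddMul
    (ContDiffAt.tailOp _ (by fun_prop) (contDiffAt_force φ hφ i δ hq) hq)

lemma contDiffAt_radialTail (δ : ℝ) {q : (ℝ × ℝ) × (Fin 3 → ℝ →ᵇ ℝ)} (hq : 0 < q.1.1) :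
    ContDiffAt ℝ ∞ (fun q : (ℝ × ℝ) × (Fin 3 → ℝ →ᵇ ℝ) => radialTail φ hφ δ q.1 q.2) q :=
  ContDiffAt.tailOp _ (by fun_prop) (contDiffAt_force φ hφ 0 δ hq) hq

lemma contDiffAt_fixMap (δ Θ : ℝ) {ξ₀ ψ₀ : ℝ × ℝ → ℝ} {q : (ℝ × ℝ) × (Fin 3 → ℝ →ᵇ ℝ)}
    (hq : 0 < q.1.1) (hξ : ContDiffAt ℝ ∞ ξ₀ q.1) (hψ : ContDiffAt ℝ ∞ ψ₀ q.1) :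
    ContDiffAt ℝ ∞ (fixMap φ hφ δ Θ ξ₀ ψ₀) q := by
  have hb : ContDiffAt ℝ ∞ (fun q : (ℝ × ℝ) × (Fin 3 → ℝ →ᵇ ℝ) => bBdd q.1.1) q :=
    ContDiffAt.comp (g := bBdd) q (contDiffAt_bBdd hq) (by fun_prop)
  have hξ' : ContDiffAt ℝ ∞ (fun q : (ℝ × ℝ) × (Fin 3 → ℝ →ᵇ ℝ) => ξ₀ q.1) q :=
    hξ.comp q (by fun_prop)
  have hψ' : ContDiffAt ℝ ∞ (fun q : (ℝ × ℝ) × (Fin 3 → ℝ →ᵇ ℝ) => ψ₀ q.1) q :=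
    hψ.comp q (by fun_prop)
  have hw : ContDiffAt ℝ ∞ (fun q : (ℝ × ℝ) × (Fin 3 → ℝ →ᵇ ℝ) => q.1.1 ^ (1 / 3 : ℝ)) q :=
    ContDiffAt.rpow_const_of_ne (by fun_prop) hq.ne'
  have h1 := contDiffAt_forceTail φ hφ 1 δ hq
  have h2 := contDiffAt_forceTail φ hφ 2 δ hq
  have h3 : ContDiffAt ℝ ∞ (fun q : (ℝ × ℝ) × (Fin 3 → ℝ →ᵇ ℝ) =>
      forceTail φ hφ 1 δ q.1 q.2 0) q :=
    (BoundedContinuousFunction.evalCLM ℝ (0 : ℝ) : (ℝ →ᵇ ℝ) →L[ℝ] ℝ).contDiff.contDiffAt.comp q h1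
  rw [contDiffAt_pi]
  intro i
  fin_cases i <;> simp only [fixMap, Fin.zero_eta, Fin.mk_one, Fin.reduceFinMk, Matrix.cons_val]
  · exact (hξ'.smul (hw.smul hb)).sub
      (ContDiffAt.headOp _ (by fun_prop) (contDiffAt_radialTail φ hφ δ hq) hq)
  · exact ((hψ'.add h3).smul contDiffAt_const).sub h1
  · exact contDiffAt_const.sub h2

variable {φ} {M W δ : ℝ} {p : ℝ × ℝ}

lemma norm_force_le (hM0 : 0 ≤ M) (hM : ∀ i x, |φ i x| ≤ M) (i : Fin 3) (u : Fin 3 → ℝ →ᵇ ℝ) :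
    ‖force φ hφ i δ p u‖ ≤ M := by
  rw [BoundedContinuousFunction.norm_le hM0]
  exact fun t => hM i _

lemma norm_forceTail_le (hM0 : 0 ≤ M) (hM : ∀ i x, |φ i x| ≤ M) (i : Fin 3)
    (u : Fin 3 → ℝ →ᵇ ℝ) (hW : 0 < W) (hp : W ≤ p.1) :
    ‖forceTail φ hφ i δ p u‖ ≤ 3 * W ^ (-(1 / 3) : ℝ) * M := by
  refine (norm_mul_le _ _).trans ?_
  have h1 := norm_bBdd_le hW hp
  have h2 := norm_tailOp_le (α := 1 / 3) (by norm_num) (hW.trans_le hp) (force φ hφ i δ p u)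
  have h3 := norm_force_le hφ hM0 hM i u (δ := δ) (p := p)
  calc _ ≤ W ^ (-(1 / 3) : ℝ) * (3 * M) := by
        gcongr
        linarith
    _ = _ := by ring

lemma norm_radialTail_le (hM0 : 0 ≤ M) (hM : ∀ i x, |φ i x| ≤ M)
    (u : Fin 3 → ℝ →ᵇ ℝ) (hp : 0 < p.1) :
    ‖radialTail φ hφ δ p u‖ ≤ M := by
  have h2 := norm_tailOp_le (α := 4 / 3) (by norm_num) hp (force φ hφ 0 δ p u)
  have h3 := norm_force_le hφ hM0 hM 0 u (δ := δ) (p := p)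
  refine h2.trans ?_
  linarith

lemma norm_fixMap_le (hM0 : 0 ≤ M) (hM : ∀ i x, |φ i x| ≤ M) {Θ : ℝ} {ξ₀ ψ₀ : ℝ × ℝ → ℝ}
    (hW : 0 < W) (hp : W ≤ p.1) (u : Fin 3 → ℝ →ᵇ ℝ) :
    ‖fixMap φ hφ δ Θ ξ₀ ψ₀ (p, u)‖ ≤
      |ξ₀ p| + |ψ₀ p| + |Θ| + (3 + 6 * W ^ (-(1 / 3) : ℝ)) * M := by
  have hp0 := hW.trans_le hp
  have hB : 0 < W ^ (-(1 / 3) : ℝ) := by positivity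
  set B := W ^ (-(1 / 3) : ℝ)
  have hBM : 0 ≤ B * M := by positivity
  have := abs_nonneg (ξ₀ p)
  have := abs_nonneg (ψ₀ p)
  have := abs_nonneg Θ
  have h1 := norm_forceTail_le hφ hM0 hM 1 u hW hp (δ := δ)
  have h2 := norm_forceTail_le hφ hM0 hM 2 u hW hp (δ := δ)
  rw [pi_norm_le_iff_of_nonneg (by positivity)]
  intro i
  fin_cases i <;> simp only [fixMap, Fin.zero_eta, Fin.mk_one, Fin.reduceFinMk, Matrix.cons_val]
  · refine (norm_sub_le _ _).trans ?_
    have h3 := norm_headOp_le (α := 1 / 3) (by norm_num) hp0 (radialTail φ hφ δ p u)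
    have h4 := norm_radialTail_le hφ hM0 hM u hp0 (δ := δ)
    have h5 := norm_rpow_smul_bBdd_le hp0
    have h6 : ‖ξ₀ p • p.1 ^ (1 / 3 : ℝ) • bBdd p.1‖ ≤ |ξ₀ p| := by
      rw [norm_smul, Real.norm_eq_abs]
      exact mul_le_of_le_one_right (abs_nonneg _) h5
    linarith
  · refine (norm_sub_le _ _).trans ?_
    have h3 := abs_apply_le (forceTail φ hφ 1 δ p u) 0
    have h4 : ‖(ψ₀ p + forceTail φ hφ 1 δ p u 0) • (1 : ℝ →ᵇ ℝ)‖
        ≤ |ψ₀ p| + ‖forceTail φ hφ 1 δ p u‖ := by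
      rw [norm_smul, norm_one, mul_one, Real.norm_eq_abs]
      exact (abs_add_le _ _).trans (by linarith)
    linarith
  · refine (norm_sub_le _ _).trans ?_
    have h4 : ‖Θ • (1 : ℝ →ᵇ ℝ)‖ = |Θ| := by rw [norm_smul, norm_one, mul_one, Real.norm_eq_abs]
    linarith

lemma norm_force_sub_le (hM0 : 0 ≤ M) (hL : ∀ i x y, |φ i x - φ i y| ≤ M * ‖x - y‖)
    (hδ : 0 ≤ δ) (hδ1 : δ ≤ 1) (i : Fin 3) (u v : Fin 3 → ℝ →ᵇ ℝ) :
    ‖force φ hφ i δ p u - force φ hφ i δ p v‖ ≤ M * δ * ‖u - v‖ := by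
  have h0 := norm_nonneg (u - v)
  rw [BoundedContinuousFunction.norm_le (by positivity), mul_assoc]
  intro t
  refine (hL i _ _).trans ?_
  gcongr
  have hu : ∀ j, |u j t - v j t| ≤ ‖u - v‖ := fun j =>
    (abs_apply_le (u j - v j) t).trans (norm_le_pi_norm (u - v) j)
  rw [pi_norm_le_iff_of_nonneg (by positivity)]
  intro j
  have hδu : ∀ j, δ * |u j t - v j t| ≤ δ * ‖u - v‖ := fun j => by gcongr; exact hu j
  have hδ2 : ∀ j, δ ^ 2 * |u j t - v j t| ≤ δ * ‖u - v‖ := fun j => by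
    have : δ ^ 2 ≤ δ := by nlinarith
    gcongr
    exact hu j
  fin_cases j <;> simp [nlArgs, ← mul_sub, abs_of_nonneg hδ] <;>
    first | positivity | apply hδu | apply hδ2

lemma norm_forceTail_sub_le (hM0 : 0 ≤ M) (hL : ∀ i x y, |φ i x - φ i y| ≤ M * ‖x - y‖)
    (hδ : 0 ≤ δ) (hδ1 : δ ≤ 1) (i : Fin 3) (u v : Fin 3 → ℝ →ᵇ ℝ) (hW : 0 < W) (hp : W ≤ p.1) :
    ‖forceTail φ hφ i δ p u - forceTail φ hφ i δ p v‖
      ≤ 3 * W ^ (-(1 / 3) : ℝ) * (M * δ * ‖u - v‖) := by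
  rw [forceTail, forceTail, ← mul_sub, ← tailOp_sub]
  refine (norm_mul_le _ _).trans ?_
  have h1 := norm_bBdd_le hW hp
  have h2 := norm_tailOp_le (α := 1 / 3) (by norm_num) (hW.trans_le hp)
    (force φ hφ i δ p u - force φ hφ i δ p v)
  have h3 := norm_force_sub_le hφ hM0 hL hδ hδ1 i u v (p := p)
  calc _ ≤ W ^ (-(1 / 3) : ℝ) * (3 * (M * δ * ‖u - v‖)) := by
        gcongr
        linarith
    _ = _ := by ring

lemma norm_fixMap_sub_le (hM0 : 0 ≤ M) (hL : ∀ i x y, |φ i x - φ i y| ≤ M * ‖x - y‖)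
    (hδ : 0 ≤ δ) (hδ1 : δ ≤ 1) {Θ : ℝ} {ξ₀ ψ₀ : ℝ × ℝ → ℝ}
    (hW : 0 < W) (hp : W ≤ p.1) (u v : Fin 3 → ℝ →ᵇ ℝ) :
    ‖fixMap φ hφ δ Θ ξ₀ ψ₀ (p, u) - fixMap φ hφ δ Θ ξ₀ ψ₀ (p, v)‖ ≤
      (3 + 6 * W ^ (-(1 / 3) : ℝ)) * M * δ * ‖u - v‖ := by
  have hp0 := hW.trans_le hp
  have hB : 0 < W ^ (-(1 / 3) : ℝ) := by positivity
  have hN : 0 ≤ M * δ * ‖u - v‖ := by positivity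
  have h1 := norm_forceTail_sub_le hφ hM0 hL hδ hδ1 1 u v hW hp
  have h2 := norm_forceTail_sub_le hφ hM0 hL hδ hδ1 2 u v hW hp
  have h0 := norm_force_sub_le hφ hM0 hL hδ hδ1 0 u v (p := p)
  rw [mul_assoc, mul_assoc, ← mul_assoc M]
  generalize M * δ * ‖u - v‖ = N at *
  set B := W ^ (-(1 / 3) : ℝ)
  have hBM : 0 ≤ B * N := by positivity
  rw [pi_norm_le_iff_of_nonneg (by positivity)]
  intro i
  rw [Pi.sub_apply]
  fin_cases i <;> simp only [fixMap, Fin.zero_eta, Fin.mk_one, Fin.reduceFinMk, Matrix.cons_val]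
  · rw [sub_sub_sub_cancel_left, ← headOp_sub, radialTail, radialTail, ← tailOp_sub]
    have h3 := norm_headOp_le (α := 1 / 3) (by norm_num) hp0
      (tailOp (4 / 3) (by norm_num) p.1 (force φ hφ 0 δ p v - force φ hφ 0 δ p u))
    have h4 := norm_tailOp_le (α := 4 / 3) (by norm_num) hp0
      (force φ hφ 0 δ p v - force φ hφ 0 δ p u)
    rw [norm_sub_rev] at h0
    linarith
  · have e : (ψ₀ p + forceTail φ hφ 1 δ p u 0) • (1 : ℝ →ᵇ ℝ) - forceTail φ hφ 1 δ p u
        - ((ψ₀ p + forceTail φ hφ 1 δ p v 0) • 1 - forceTail φ hφ 1 δ p v)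
        = (forceTail φ hφ 1 δ p u - forceTail φ hφ 1 δ p v) 0 • (1 : ℝ →ᵇ ℝ)
          - (forceTail φ hφ 1 δ p u - forceTail φ hφ 1 δ p v) := by
      simp only [BoundedContinuousFunction.coe_sub, Pi.sub_apply]
      module
    rw [e]
    refine (norm_sub_le _ _).trans ?_
    have h3 := abs_apply_le (forceTail φ hφ 1 δ p u - forceTail φ hφ 1 δ p v) 0
    rw [norm_smul, norm_one, mul_one, Real.norm_eq_abs]
    linarith
  · rw [sub_sub_sub_cancel_left, norm_sub_rev]
    linarith

theorem exists_fixedPoint_fixMap (hM0 : 0 ≤ M) (hL : ∀ i x y, |φ i x - φ i y| ≤ M * ‖x - y‖)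
    (hδ : 0 ≤ δ) (hδ1 : δ ≤ 1) (Θ : ℝ) {ξ₀ ψ₀ : ℝ × ℝ → ℝ} (hW : 0 < W)
    (hsmall : (3 + 6 * W ^ (-(1 / 3) : ℝ)) * M * δ ≤ 1 / 2)
    (hξ : ∀ p : ℝ × ℝ, W ≤ p.1 → ContDiffAt ℝ ∞ ξ₀ p)
    (hψ : ∀ p : ℝ × ℝ, W ≤ p.1 → ContDiffAt ℝ ∞ ψ₀ p) :
    ∃ U : ℝ × ℝ → Fin 3 → ℝ →ᵇ ℝ, ContDiffOn ℝ ∞ U {p | W ≤ p.1} ∧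
      ∀ p : ℝ × ℝ, W ≤ p.1 → fixMap φ hφ δ Θ ξ₀ ψ₀ (p, U p) = U p := by
  have hlip : ∀ p : ℝ × ℝ, W ≤ p.1 →
      LipschitzWith (1 / 2) fun u => fixMap φ hφ δ Θ ξ₀ ψ₀ (p, u) := fun p hp => by
    refine LipschitzWith.of_dist_le_mul fun u v => ?_
    rw [dist_eq_norm, dist_eq_norm]
    refine (norm_fixMap_sub_le hφ hM0 hL hδ hδ1 hW hp u v).trans ?_
    gcongr
    simpa using hsmall
  have hcon : ∀ p : ℝ × ℝ, W ≤ p.1 →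
      ContractingWith (1 / 2) fun u => fixMap φ hφ δ Θ ξ₀ ψ₀ (p, u) := fun p hp =>
    ⟨by norm_num, hlip p hp⟩
  classical
  refine ⟨fun p => if hp : W ≤ p.1 then (hcon p hp).fixedPoint else 0, fun p hp => ?_,
    fun p hp => ?_⟩
  · have hp' : W ≤ p.1 := hp
    refine contDiffWithinAt_fixedPoint (K := 1 / 2) (B := Set.univ) (F := fixMap φ hφ δ Θ ξ₀ ψ₀)
      (by norm_num) (contDiffAt_fixMap φ hφ δ Θ (hW.trans_le hp) (hξ p hp) (hψ p hp)) ?_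
      univ_mem (hlip p hp).lipschitzOnWith ?_
    · simp only [dif_pos hp']
      exact (hcon p hp).fixedPoint_isFixedPt
    · intro p' hp' y _ hy
      have hp'' : W ≤ p'.1 := hp'
      simp only [dif_pos hp'']
      exact ((hcon p' hp').fixedPoint_unique hy).symm
  · simp only [dif_pos hp]
    exact (hcon p hp).fixedPoint_isFixedPt

end FixedPoint

section PolarConversion

/-- Component of the position relative to the first primary along the barycentric direction. -/
noncomputable def relY (μ ρ α : ℝ) : ℝ := ρ + μ * cos α

/-- Component of the position relative to the first primary across the barycentric direction. -/
noncomputable def relZ (μ α : ℝ) : ℝ := -(μ * sin α)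

/-- Distance to the first primary. -/
noncomputable def relR (μ ρ α : ℝ) : ℝ := √(relY μ ρ α ^ 2 + relZ μ α ^ 2)

/-- Rotating polar angle centred at the first primary. -/
noncomputable def relAngle (μ ρ α : ℝ) : ℝ := α + arctan (relZ μ α / relY μ ρ α)

/-- Radial momentum centred at the first primary. -/
noncomputable def relMomR (μ ρ α P G : ℝ) : ℝ :=
  (relY μ ρ α * P + relZ μ α * (G / ρ)) / relR μ ρ α

/-- Angular momentum centred at the first primary. -/
noncomputable def relMomG (μ ρ α P G : ℝ) : ℝ := relY μ ρ α * (G / ρ) - relZ μ α * P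

variable {μ ρ α : ℝ}

lemma relY_pos (hρ : |μ| < ρ) : 0 < relY μ ρ α := by
  have h := abs_mul μ (cos α)
  have := abs_cos_le_one α
  have := neg_abs_le (μ * cos α)
  unfold relY
  nlinarith [abs_nonneg μ]

lemma relR_pos (hρ : |μ| < ρ) : 0 < relR μ ρ α :=
  sqrt_pos.2 (by have := relY_pos (α := α) hρ; positivity)

lemma relR_sq (μ ρ α : ℝ) : relR μ ρ α ^ 2 = relY μ ρ α ^ 2 + relZ μ α ^ 2 :=
  sq_sqrt (by positivity)

lemma cos_relArctan (hρ : |μ| < ρ) :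
    cos (arctan (relZ μ α / relY μ ρ α)) = relY μ ρ α / relR μ ρ α := by
  have hy := relY_pos (α := α) hρ
  rw [cos_arctan, relR, show relY μ ρ α ^ 2 + relZ μ α ^ 2
    = relY μ ρ α ^ 2 * (1 + (relZ μ α / relY μ ρ α) ^ 2) by field_simp,
    sqrt_mul (by positivity), sqrt_sq hy.le]
  field_simp

lemma sin_relArctan (hρ : |μ| < ρ) :
    sin (arctan (relZ μ α / relY μ ρ α)) = relZ μ α / relR μ ρ α := by
  have hy := relY_pos (α := α) hρ
  have h := cos_relArctan (α := α) hρ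
  rw [cos_arctan, one_div] at h
  rw [sin_arctan, div_eq_mul_inv _ (√_), h]
  field_simp

lemma cos_relAngle (hρ : |μ| < ρ) : cos (relAngle μ ρ α)
    = (relY μ ρ α * cos α - relZ μ α * sin α) / relR μ ρ α := by
  rw [relAngle, cos_add, cos_relArctan hρ, sin_relArctan hρ]
  ring

lemma sin_relAngle (hρ : |μ| < ρ) : sin (relAngle μ ρ α)
    = (relY μ ρ α * sin α + relZ μ α * cos α) / relR μ ρ α := by
  rw [relAngle, sin_add, cos_relArctan hρ, sin_relArctan hρ]
  ring

lemma relDist_sq (hρ : |μ| < ρ) :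
    1 + relR μ ρ α ^ 2 - 2 * relR μ ρ α * cos (relAngle μ ρ α)
      = ρ ^ 2 - 2 * (1 - μ) * ρ * cos α + (1 - μ) ^ 2 := by
  have hr := relR_pos (α := α) hρ
  rw [cos_relAngle hρ, relR_sq, mul_assoc, mul_div_cancel₀ _ hr.ne', relY, relZ]
  linear_combination (μ ^ 2 - 2 * μ) * sin_sq_add_cos_sq α

/-- Barycentric inertial polar solutions, rewritten in rotating polar coordinates centred at the
first primary. -/
theorem isPolarSol_of_barycentric {I : Set ℝ} {μ : ℝ} (hμ : 0 ≤ μ) {ρ φ P G : ℝ → ℝ}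
    (hρ : ∀ t ∈ I, μ < ρ t)
    (hdρ : ∀ t ∈ I, HasDerivAt ρ (P t) t)
    (hdφ : ∀ t ∈ I, HasDerivAt φ (G t / ρ t ^ 2) t)
    (hdP : ∀ t ∈ I, HasDerivAt P (G t ^ 2 / ρ t ^ 3
      - (1 - μ) * (ρ t + μ * cos (φ t - t)) * (relR μ (ρ t) (φ t - t) ^ 3)⁻¹
      - μ * (ρ t - (1 - μ) * cos (φ t - t)) *
        (ρ t ^ 2 - 2 * (1 - μ) * ρ t * cos (φ t - t) + (1 - μ) ^ 2) ^ (-(3 / 2) : ℝ)) t)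
    (hdG : ∀ t ∈ I, HasDerivAt G (μ * (1 - μ) * ρ t * sin (φ t - t) *
      ((relR μ (ρ t) (φ t - t) ^ 3)⁻¹ -
        (ρ t ^ 2 - 2 * (1 - μ) * ρ t * cos (φ t - t) + (1 - μ) ^ 2) ^ (-(3 / 2) : ℝ))) t) :
    IsPolarSol μ I (fun t => relR μ (ρ t) (φ t - t)) (fun t => relAngle μ (ρ t) (φ t - t))
      (fun t => relMomR μ (ρ t) (φ t - t) (P t) (G t))
      (fun t => relMomG μ (ρ t) (φ t - t) (P t) (G t)) := by
  intro t ht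
  replace hρ := hρ t ht
  replace hdρ := hdρ t ht
  replace hdφ := hdφ t ht
  replace hdP := hdP t ht
  replace hdG := hdG t ht
  have hρ0 : 0 < ρ t := hμ.trans_lt hρ
  have hρμ : |μ| < ρ t := by rwa [abs_of_nonneg hμ]
  have hy0 := relY_pos (α := φ t - t) hρμ
  have hr0 := relR_pos (α := φ t - t) hρμ
  have hrsq := relR_sq μ (ρ t) (φ t - t)
  have hα : HasDerivAt (fun t => φ t - t) (G t / ρ t ^ 2 - 1) t := hdφ.sub (hasDerivAt_id t)
  have hVρ : G t / ρ t = G t / ρ t ^ 2 * ρ t := by field_simp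
  have hY₀ : HasDerivAt (fun t => relY μ (ρ t) (φ t - t))
      (P t + μ * (-sin (φ t - t) * (G t / ρ t ^ 2 - 1))) t := hdρ.add (hα.cos.const_mul μ)
  have hZ₀ : HasDerivAt (fun t => relZ μ (φ t - t))
      (-(μ * (cos (φ t - t) * (G t / ρ t ^ 2 - 1)))) t := (hα.sin.const_mul μ).neg
  have hV₀ : HasDerivAt (fun t => G t / ρ t) _ t := hdG.div hdρ hρ0.ne'
  have hcs := sin_sq_add_cos_sq (φ t - t)
  have hyc : relY μ (ρ t) (φ t - t) = ρ t + μ * cos (φ t - t) := rfl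
  have hzs : relZ μ (φ t - t) = -(μ * sin (φ t - t)) := rfl
  have hyρ : ρ t = relY μ (ρ t) (φ t - t) - μ * cos (φ t - t) := by rw [hyc]; ring
  have hcosθ := cos_relAngle (α := φ t - t) hρμ
  have hsinθ := sin_relAngle (α := φ t - t) hρμ
  have hdist := relDist_sq (α := φ t - t) hρμ
  beta_reduce
  rw [hdist, hcosθ, hsinθ]
  generalize hk : (ρ t ^ 2 - 2 * (1 - μ) * ρ t * cos (φ t - t) + (1 - μ) ^ 2) ^ (-(3 / 2) : ℝ) = k
    at *
  have hY : HasDerivAt (fun t => relY μ (ρ t) (φ t - t))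
      (G t / ρ t ^ 2 * relZ μ (φ t - t) + P t + μ * sin (φ t - t)) t :=
    hY₀.congr_deriv (by rw [hzs]; ring)
  have hZ : HasDerivAt (fun t => relZ μ (φ t - t))
      (-(G t / ρ t ^ 2 * relY μ (ρ t) (φ t - t)) + G t / ρ t + μ * cos (φ t - t)) t :=
    hZ₀.congr_deriv (by rw [hyc, hVρ]; ring)
  have hV : HasDerivAt (fun t => G t / ρ t) (μ * (1 - μ) * sin (φ t - t) *
      ((relR μ (ρ t) (φ t - t) ^ 3)⁻¹ - k) - G t / ρ t ^ 2 * P t) t :=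
    hV₀.congr_deriv (by field_simp)
  have hP : HasDerivAt P (G t / ρ t ^ 2 * (G t / ρ t)
      - (1 - μ) * relY μ (ρ t) (φ t - t) * (relR μ (ρ t) (φ t - t) ^ 3)⁻¹
      - μ * (ρ t - (1 - μ) * cos (φ t - t)) * k) t :=
    hdP.congr_deriv (by rw [hyc]; field_simp)
  have hR : HasDerivAt (fun t => relR μ (ρ t) (φ t - t))
      ((relY μ (ρ t) (φ t - t) * (P t + μ * sin (φ t - t)) + relZ μ (φ t - t) *
        (G t / ρ t + μ * cos (φ t - t))) / relR μ (ρ t) (φ t - t)) t := by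
    refine (((hY.pow 2).add (hZ.pow 2)).sqrt ?_).congr_deriv ?_
    · exact ne_of_gt (sqrt_pos.1 hr0)
    · change _ / (2 * relR μ (ρ t) (φ t - t)) = _
      field_simp
      ring
  have hΘ := (hY.mul hV).sub (hZ.mul hP)
  have hT := hα.add (hZ.div hY hy0.ne').arctan
  have hQ := ((hY.mul hP).add (hZ.mul hV)).div hR hr0.ne'
  refine ⟨hR.congr_deriv ?_, hT.congr_deriv ?_, hQ.congr_deriv ?_, hΘ.congr_deriv ?_⟩
  all_goals
    simp only [relMomR, relMomG, Pi.div_apply, Pi.mul_apply, Pi.add_apply]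
    clear hY hZ hV hP hR hΘ hT hQ hY₀ hZ₀ hV₀ hα hdρ hdφ hdP hdG hcosθ hsinθ hdist hk
    generalize relR μ (ρ t) (φ t - t) = r at *
    generalize relY μ (ρ t) (φ t - t) = y at *
    generalize relZ μ (φ t - t) = z at *
    generalize cos (φ t - t) = c at *
    generalize sin (φ t - t) = s at *
    generalize G t / ρ t ^ 2 = o at *
    generalize G t / ρ t = V at *
    generalize P t = p at *
    generalize ρ t = q at *
  · field_simp
    ring
  · have h1 : 1 + (z / y) ^ 2 = r ^ 2 / y ^ 2 := by rw [hrsq]; field_simp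
    rw [h1]
    field_simp
    linear_combination o * hrsq
  · generalize hK : (r ^ 3)⁻¹ = K at *
    have hKr : K * r ^ 3 = 1 := by rw [← hK]; field_simp
    subst hyρ hzs
    field_simp
    linear_combination (p ^ 2 + V ^ 2 + μ * (s * p + c * V) + μ * k * r ^ 2
      + (1 - μ) * K * r ^ 2) * hrsq - (1 - μ) * r * hKr
  · generalize (r ^ 3)⁻¹ = K at *
    subst hyρ hzs
    field_simp
    linear_combination μ * (s * V - c * p) * hrsq

end PolarConversion

section Orbit

variable {φ : Fin 3 → (Fin 8 → ℝ) → ℝ} (hφ : ∀ i, ContDiff ℝ ∞ (φ i)) {δ Θ x t : ℝ} {p : ℝ × ℝ}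
  {u : Fin 3 → ℝ →ᵇ ℝ} {ξ₀ ψ₀ : ℝ × ℝ → ℝ}

/-- Radial deviation along the orbit determined by the profile `u`. -/
noncomputable def orbXi (δ : ℝ) (p : ℝ × ℝ) (u : Fin 3 → ℝ →ᵇ ℝ) (x t : ℝ) : ℝ :=
  x * p.1 ^ (1 / 3 : ℝ) * (t + p.1) ^ (-(1 / 3) : ℝ)
    - headAvg p.1 (1 / 3) (radialTail φ hφ δ p u) t

/-- Radial momentum deviation along the orbit determined by the profile `u`. -/
noncomputable def orbZeta (δ : ℝ) (p : ℝ × ℝ) (u : Fin 3 → ℝ →ᵇ ℝ) (t : ℝ) : ℝ :=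
  -tailAvg p.1 (4 / 3) (force φ hφ 0 δ p u) t

/-- The quantity `∫_t^∞ s^{-4/3} f` along the orbit determined by the profile `u`. -/
noncomputable def orbTail (i : Fin 3) (δ : ℝ) (p : ℝ × ℝ) (u : Fin 3 → ℝ →ᵇ ℝ) (t : ℝ) : ℝ :=
  (t + p.1) ^ (-(1 / 3) : ℝ) * tailAvg p.1 (1 / 3) (force φ hφ i δ p u) t

lemma rpow_neg_third_pow_three {s : ℝ} (hs : 0 < s) : (s ^ (-(1 / 3) : ℝ)) ^ 3 = s⁻¹ := by
  rw [← rpow_natCast, ← rpow_mul hs.le, ← rpow_neg_one]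
  norm_num

lemma hasDerivAt_rpow_neg_third {w : ℝ} (ht : -w < t) :
    HasDerivAt (fun t => (t + w) ^ (-(1 / 3) : ℝ)) (-((t + w) ^ (-(1 / 3) : ℝ)) ^ 4 / 3) t := by
  refine (hasDerivAt_rpow_add _ ht).congr_deriv ?_
  have hs : 0 < t + w := by linarith
  rw [rpow_sub_one hs.ne', pow_succ, rpow_neg_third_pow_three hs]
  field_simp

lemma forceTail_apply (i : Fin 3) (hp : 0 < p.1) (ht : 0 ≤ t) :
    forceTail φ hφ i δ p u t = orbTail hφ i δ p u t := by
  rw [forceTail, BoundedContinuousFunction.mul_apply, bBdd_apply hp, tailOp_apply _ hp,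
    max_eq_left ht, orbTail]

lemma hasDerivAt_orbTail (i : Fin 3) (hp : 0 < p.1) (ht : 0 ≤ t) :
    HasDerivAt (orbTail hφ i δ p u)
      (-(((t + p.1) ^ (-(1 / 3) : ℝ)) ^ 4 * force φ hφ i δ p u t)) t := by
  have hs : -p.1 < t := by linarith
  have hs' : 0 < t + p.1 := by linarith
  refine ((hasDerivAt_rpow_neg_third hs).mul (hasDerivAt_tailAvg (α := 1 / 3) (by norm_num)
    (force φ hφ i δ p u).continuous (abs_apply_le _) hs)).congr_deriv ?_
  have h3 := rpow_neg_third_pow_three hs'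
  rw [div_eq_mul_inv _ (t + p.1), ← h3]
  ring

lemma hasDerivAt_orbZeta (hp : 0 < p.1) (ht : 0 ≤ t) :
    HasDerivAt (orbZeta hφ δ p u) (((t + p.1) ^ (-(1 / 3) : ℝ)) ^ 3 *
      (4 / 3 * orbZeta hφ δ p u t + force φ hφ 0 δ p u t)) t := by
  have hs : -p.1 < t := by linarith
  have hs' : 0 < t + p.1 := by linarith
  refine ((hasDerivAt_tailAvg (α := 4 / 3) (by norm_num)
    (force φ hφ 0 δ p u).continuous (abs_apply_le _) hs)).neg.congr_deriv ?_
  rw [rpow_neg_third_pow_three hs', orbZeta]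
  field_simp
  ring

lemma hasDerivAt_orbXi (hp : 0 < p.1) (ht : 0 ≤ t) :
    HasDerivAt (orbXi hφ δ p u x) (((t + p.1) ^ (-(1 / 3) : ℝ)) ^ 3 *
      (-(orbXi hφ δ p u x t) / 3 + orbZeta hφ δ p u t)) t := by
  have hs : -p.1 < t := by linarith
  have hs' : 0 < t + p.1 := by linarith
  refine (((hasDerivAt_rpow_neg_third hs).const_mul (x * p.1 ^ (1 / 3 : ℝ))).sub
    (hasDerivAt_headAvg (α := 1 / 3) hp
    (radialTail φ hφ δ p u).continuous hs)).congr_deriv ?_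
  rw [div_eq_mul_inv _ (t + p.1), ← rpow_neg_third_pow_three hs', orbZeta, orbXi, radialTail,
    tailOp_apply _ hp, max_eq_left ht]
  ring

lemma fixMap_fixed_zero (hu : fixMap φ hφ δ Θ ξ₀ ψ₀ (p, u) = u) (hp : 0 < p.1)
    (ht : 0 ≤ t) : u 0 t = orbXi hφ δ p u (ξ₀ p) t := by
  conv_lhs => rw [← hu]
  simp [fixMap, orbXi, bBdd_apply hp, headOp_apply _ hp, max_eq_left ht, mul_assoc]

lemma fixMap_fixed_one (hu : fixMap φ hφ δ Θ ξ₀ ψ₀ (p, u) = u) (hp : 0 < p.1)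
    (ht : 0 ≤ t) :
    u 1 t = ψ₀ p + orbTail hφ 1 δ p u 0 - orbTail hφ 1 δ p u t := by
  conv_lhs => rw [← hu]
  simp [fixMap, forceTail_apply hφ _ hp ht, forceTail_apply hφ _ hp le_rfl]

lemma fixMap_fixed_two (hu : fixMap φ hφ δ Θ ξ₀ ψ₀ (p, u) = u) (hp : 0 < p.1)
    (ht : 0 ≤ t) : u 2 t = Θ - orbTail hφ 2 δ p u t := by
  conv_lhs => rw [← hu]
  simp [fixMap, forceTail_apply hφ _ hp ht]

lemma orbXi_zero (hp : 0 < p.1) : orbXi hφ δ p u x 0 = x := by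
  have : 0 < p.1 ^ (1 / 3 : ℝ) := by positivity
  rw [orbXi, headAvg, headInt, intervalIntegral.integral_same, zero_add, rpow_neg hp.le]
  field_simp
  ring

end Orbit

section OrbitEquations

lemma relR_pow_three_inv {μ ν α Y : ℝ} (hν : 0 < ν)
    (hY : Y = μ * ν * (2 * cos α + μ * ν)) :
    (relR μ ν⁻¹ α ^ 3)⁻¹ = ν ^ 3 * (√(1 + Y) ^ 3)⁻¹ := by
  have h : relY μ ν⁻¹ α ^ 2 + relZ μ α ^ 2 = (ν⁻¹) ^ 2 * (1 + Y) := by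
    rw [hY, relY, relZ]
    field_simp
    linear_combination ν ^ 2 * μ ^ 2 * sin_sq_add_cos_sq α
  rw [relR, h, sqrt_mul (by positivity), sqrt_sq (by positivity), mul_pow, mul_inv,
    inv_pow, inv_inv]

lemma rpow_neg_three_halves {x : ℝ} (hx : 0 < x) : x ^ (-(3 / 2) : ℝ) = (√x ^ 3)⁻¹ := by
  rw [sqrt_eq_rpow, ← rpow_natCast, ← rpow_mul hx.le, ← rpow_neg hx.le]
  norm_num

lemma secondDist_rpow {m ν c Y : ℝ} (hν : 0 < ν) (hY : Y = m * ν * (-2 * c + m * ν))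
    (hY0 : 0 < 1 + Y) :
    ((ν⁻¹) ^ 2 - 2 * m * ν⁻¹ * c + m ^ 2) ^ (-(3 / 2) : ℝ) = ν ^ 3 * (√(1 + Y) ^ 3)⁻¹ := by
  have h : (ν⁻¹) ^ 2 - 2 * m * ν⁻¹ * c + m ^ 2 = (ν⁻¹) ^ 2 * (1 + Y) := by
    rw [hY]
    field_simp
    ring
  rw [h, rpow_neg_three_halves (by positivity), sqrt_mul (by positivity), sqrt_sq (by positivity),
    mul_pow, mul_inv, inv_pow, inv_inv]

lemma radial_force_eq {y : Fin 8 → ℝ} (hy : y ∈ nlDom) {g ξ : ℝ} {δ : ℝ} (h3 : y 3 = δ ^ 2)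
    (h4 : y 4 = δ ^ 2 * ξ) (h6 : y 6 = δ * ξ) (h7 : y 7 = δ * g) :
    -(2 / 9) * kap * y 0 ^ 4 + δ ^ 2 * y 0 ^ 6 * (4 / 9 * ξ + nl 0 y)
      = (δ ^ 2 * g) ^ 2 * nlNu y ^ 3
        - (1 - δ ^ 2) * (1 + δ ^ 2 * nlNu y * nlCos y) * nlNu y ^ 2 * (√(1 + nlY1 y) ^ 3)⁻¹
        - δ ^ 2 * (1 - (1 - δ ^ 2) * nlNu y * nlCos y) * nlNu y ^ 2
          * (√(1 + nlY2 y) ^ 3)⁻¹ := by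
  obtain ⟨hx, hY1, hY2⟩ := hy
  rw [inv_cube_eq (sqrt_pos.2 hY1) (sq_sqrt hY1.le), inv_cube_eq (sqrt_pos.2 hY2) (sq_sqrt hY2.le)]
  have hX : nlX y * (1 + y 0 ^ 2 * y 4 / kap) = 1 := inv_mul_cancel₀ hx.ne'
  have hk := kap_pos
  have hk3 := kap_cube
  simp only [nl, Matrix.cons_val_zero]
  generalize invCubeSlope √(1 + nlY1 y) = h₁
  generalize invCubeSlope √(1 + nlY2 y) = h₂
  rw [nlY1, nlY2, nlNu]
  generalize nlX y = X at *
  generalize nlCos y = c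
  rw [h3, h4, h6, h7] at *
  generalize y 0 = b at *
  have key : -X ^ 2 = -1 + 2 * (b ^ 2 * (δ ^ 2 * ξ) / kap)
      - (b ^ 2 * (δ ^ 2 * ξ) / kap) ^ 2 * (3 + 2 * (b ^ 2 * (δ ^ 2 * ξ) / kap)) * X ^ 2 := by
    generalize b ^ 2 * (δ ^ 2 * ξ) / kap = x at *
    linear_combination (2 * x - 1) * (X * (1 + x) + 1) * hX
  have e : -(2 / 9) * kap * b ^ 4 + δ ^ 2 * b ^ 6 * (4 / 9 * ξ)
      = b ^ 4 / kap ^ 2 * (-1 + 2 * (b ^ 2 * (δ ^ 2 * ξ) / kap)) := by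
    field_simp
    rw [hk3]
    ring
  have e2 : b ^ 4 / kap ^ 2 * (-1 + 2 * (b ^ 2 * (δ ^ 2 * ξ) / kap)) = b ^ 4 / kap ^ 2 * (-X ^ 2
      + (b ^ 2 * (δ ^ 2 * ξ) / kap) ^ 2 * (3 + 2 * (b ^ 2 * (δ ^ 2 * ξ) / kap)) * X ^ 2) := by
    rw [key]; ring
  rw [mul_add, ← add_assoc, e, e2]
  field_simp
  ring

variable {φ : Fin 3 → (Fin 8 → ℝ) → ℝ} (hφ : ∀ i, ContDiff ℝ ∞ (φ i)) {δ Θ x t : ℝ} {p : ℝ × ℝ}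
  {u : Fin 3 → ℝ →ᵇ ℝ} {ξ₀ ψ₀ : ℝ × ℝ → ℝ}

/-- Barycentric radius along an orbit. -/
noncomputable def orbRho (δ : ℝ) (p : ℝ × ℝ) (u : Fin 3 → ℝ →ᵇ ℝ) (x t : ℝ) : ℝ :=
  kap * (t + p.1) ^ (2 / 3 : ℝ) + δ ^ 2 * orbXi hφ δ p u x t

/-- Barycentric angle along an orbit. -/
noncomputable def orbPhi (δ : ℝ) (p : ℝ × ℝ) (u : Fin 3 → ℝ →ᵇ ℝ) (x t : ℝ) : ℝ :=
  p.2 + δ * (x + orbTail hφ 1 δ p u 0 - orbTail hφ 1 δ p u t)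

/-- Barycentric radial momentum along an orbit. -/
noncomputable def orbMomR (δ : ℝ) (p : ℝ × ℝ) (u : Fin 3 → ℝ →ᵇ ℝ) (x t : ℝ) : ℝ :=
  2 / 3 * kap * (t + p.1) ^ (-(1 / 3) : ℝ) + δ ^ 2 * (((t + p.1) ^ (-(1 / 3) : ℝ)) ^ 3 *
      (-(orbXi hφ δ p u x t) / 3 + orbZeta hφ δ p u t))

/-- Barycentric angular momentum along an orbit. -/
noncomputable def orbMomG (δ Θ : ℝ) (p : ℝ × ℝ) (u : Fin 3 → ℝ →ᵇ ℝ) (t : ℝ) : ℝ :=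
  δ ^ 2 * (Θ - orbTail hφ 2 δ p u t)

/-- The nonlinearity agrees with the force of the three-body problem along the profile `u`. -/
def IsAdmissible (φ : Fin 3 → (Fin 8 → ℝ) → ℝ) (δ : ℝ) (p : ℝ × ℝ) (u : Fin 3 → ℝ →ᵇ ℝ) : Prop :=
  ∀ t, (fun j => nlArgs δ p u j t) ∈ nlDom ∧
    ∀ i, φ i (fun j => nlArgs δ p u j t) = nl i (fun j => nlArgs δ p u j t)

lemma rpow_two_thirds_mul_sq {s : ℝ} (hs : 0 < s) :
    s ^ (2 / 3 : ℝ) * (s ^ (-(1 / 3) : ℝ)) ^ 2 = 1 := by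
  rw [← rpow_natCast, ← rpow_mul hs.le, ← rpow_add hs]
  norm_num

theorem isPolarSol_orbit (hp : 0 < p.1)
    (hu : fixMap φ hφ δ Θ ξ₀ ψ₀ (p, u) = u) (hadm : IsAdmissible φ δ p u)
    (hρ : ∀ t, 0 ≤ t → δ ^ 2 < orbRho hφ δ p u (ξ₀ p) t) :
    IsPolarSol (δ ^ 2) (Set.Ici 0)
      (fun t => relR (δ ^ 2) (orbRho hφ δ p u (ξ₀ p) t) (orbPhi hφ δ p u (ψ₀ p) t - t))
      (fun t => relAngle (δ ^ 2) (orbRho hφ δ p u (ξ₀ p) t) (orbPhi hφ δ p u (ψ₀ p) t - t))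
      (fun t => relMomR (δ ^ 2) (orbRho hφ δ p u (ξ₀ p) t) (orbPhi hφ δ p u (ψ₀ p) t - t)
        (orbMomR hφ δ p u (ξ₀ p) t) (orbMomG hφ δ Θ p u t))
      (fun t => relMomG (δ ^ 2) (orbRho hφ δ p u (ξ₀ p) t) (orbPhi hφ δ p u (ψ₀ p) t - t)
        (orbMomR hφ δ p u (ξ₀ p) t) (orbMomG hφ δ Θ p u t)) := by
  have hdom : ∀ t ∈ Set.Ici (0 : ℝ), ∃ y ∈ nlDom, 0 < nlNu y ∧
      y 0 = (t + p.1) ^ (-(1 / 3) : ℝ) ∧ y 3 = δ ^ 2 ∧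
      y 4 = δ ^ 2 * orbXi hφ δ p u (ξ₀ p) t ∧ y 6 = δ * orbXi hφ δ p u (ξ₀ p) t ∧
      y 7 = δ * (Θ - orbTail hφ 2 δ p u t) ∧ nlCos y = cos (orbPhi hφ δ p u (ψ₀ p) t - t) ∧
      nlSin y = sin (orbPhi hφ δ p u (ψ₀ p) t - t) ∧
      orbRho hφ δ p u (ξ₀ p) t = (nlNu y)⁻¹ ∧ ∀ i, force φ hφ i δ p u t = nl i y := by
    intro t ht
    have ht : 0 ≤ t := ht
    have hs : 0 < t + p.1 := by linarith
    obtain ⟨hd, hn⟩ := hadm t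
    have h0 := fixMap_fixed_zero hφ hu hp ht
    have h1 := fixMap_fixed_one hφ hu hp ht
    have h2 := fixMap_fixed_two hφ hu hp ht
    have hf : ∀ i, force φ hφ i δ p u t = φ i (fun j => nlArgs δ p u j t) := fun i => rfl
    rw [nlArgs_apply δ hp, max_eq_left ht, h0, h1, h2] at hd hn hf
    refine ⟨_, hd, ?_, rfl, rfl, rfl, rfl, rfl, ?_, ?_, ?_, fun i => (hf i).trans (hn i)⟩
    · have := kap_pos
      have := hd.1
      unfold nlNu nlX
      simp only [Matrix.cons_val_zero] at *
      positivity
    · simp only [nlCos, Matrix.cons_val]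
      rw [← cos_add, orbPhi]
      congr 1; ring
    · simp only [nlSin, Matrix.cons_val]
      rw [← sin_add, orbPhi]
      congr 1; ring
    · have hk := kap_pos
      have hb := rpow_two_thirds_mul_sq hs
      have hb0 : 0 < (t + p.1) ^ (-(1 / 3) : ℝ) := by positivity
      simp only [nlNu, nlX, Matrix.cons_val]
      rw [orbRho, eq_div_of_mul_eq (by positivity) hb, mul_inv, inv_inv]
      field_simp
  have hdX := fun t (ht : t ∈ Set.Ici (0 : ℝ)) =>
    hasDerivAt_orbXi hφ (δ := δ) (u := u) (x := ξ₀ p) hp ht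
  have hdZ := fun t (ht : t ∈ Set.Ici (0 : ℝ)) => hasDerivAt_orbZeta hφ (δ := δ) (u := u) hp ht
  have hdT := fun i t (ht : t ∈ Set.Ici (0 : ℝ)) =>
    hasDerivAt_orbTail hφ i (δ := δ) (u := u) hp ht
  have hdb : ∀ t ∈ Set.Ici (0 : ℝ), HasDerivAt (fun t => (t + p.1) ^ (-(1 / 3) : ℝ))
      (-((t + p.1) ^ (-(1 / 3) : ℝ)) ^ 4 / 3) t := fun t ht =>
    hasDerivAt_rpow_neg_third (by have : 0 ≤ t := ht; linarith)
  refine isPolarSol_of_barycentric (sq_nonneg δ) hρ (fun t ht => ?_) (fun t ht => ?_)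
    (fun t ht => ?_) (fun t ht => ?_)
  · refine (((hasDerivAt_rpow_add (w := p.1) (2 / 3)
      (by have : 0 ≤ t := ht; linarith)).const_mul kap).add
      ((hdX t ht).const_mul (δ ^ 2))).congr_deriv ?_
    rw [orbMomR]
    norm_num
    ring
  · obtain ⟨y, hy, hν, y0, y3, y4, y6, y7, hc, hs, hρν, hf⟩ := hdom t ht
    refine ((((hdT 1 t ht).const_sub _).const_mul δ).const_add p.2).congr_deriv ?_
    rw [hf, hρν, ← y0, orbMomG]
    simp only [nl, nlNu, Matrix.cons_val]
    rw [y7]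
    field_simp
  · obtain ⟨y, hy, hν, y0, y3, y4, y6, y7, hc, hs, hρν, hf⟩ := hdom t ht
    refine (((hdb t ht).const_mul (2 / 3 * kap)).add ((((hdb t ht).pow 3).mul
      (((hdX t ht).neg.div_const 3).add (hdZ t ht))).const_mul (δ ^ 2))).congr_deriv ?_
    have := radial_force_eq hy y3 y4 y6 y7
    rw [hf, hρν, relR_pow_three_inv (Y := nlY1 y) hν (by rw [← hc, ← y3]; rfl),
      secondDist_rpow (Y := nlY2 y) hν (by rw [← hc, ← y3]; rfl) hy.2.2, ← hc, orbMomG, ← y0]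
    simp only [Pi.neg_apply, Pi.add_apply, Pi.pow_apply, ← y0]
    calc _ = _ := ?_
      _ = _ := this
      _ = _ := ?_
    · push_cast; ring
    · field_simp
  · obtain ⟨y, hy, hν, y0, y3, y4, y6, y7, hc, hs, hρν, hf⟩ := hdom t ht
    refine (((hdT 2 t ht).const_sub Θ).const_mul (δ ^ 2)).congr_deriv ?_
    rw [hf, hρν, relR_pow_three_inv (Y := nlY1 y) hν (by rw [← hc, ← y3]; rfl),
      secondDist_rpow (Y := nlY2 y) hν (by rw [← hc, ← y3]; rfl) hy.2.2, ← hs, ← y0]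
    simp only [nl, Matrix.cons_val, y3]
    have e : nlNu y ^ 2 = y 0 ^ 4 * (kap ^ 2)⁻¹ * nlX y ^ 2 := by rw [nlNu]; ring
    field_simp
    rw [e]
    field_simp

end OrbitEquations

section CollisionAvoidance

lemma cos_le_cos_of_forall_int {x d : ℝ} (hd : 0 ≤ d)
    (h : ∀ k : ℤ, d ≤ |x - 2 * π * k|) : cos x ≤ cos d := by
  have hk := abs_sub_round (x / (2 * π))
  have hπ := pi_pos
  have e : x - 2 * π * round (x / (2 * π)) = 2 * π * (x / (2 * π) - round (x / (2 * π))) := by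
    field_simp
  have h1 := h (round (x / (2 * π)))
  have h2 : |x - 2 * π * round (x / (2 * π))| ≤ π := by
    rw [e, abs_mul, abs_of_pos (by positivity)]
    nlinarith
  have h3 : cos x = cos |x - 2 * π * round (x / (2 * π))| := by
    rw [cos_abs, mul_comm (2 * π), cos_sub_int_mul_two_pi]
  rw [h3]
  exact cos_le_cos_of_nonneg_of_le_pi hd h2 h1

/-- The inverse radius of the unperturbed parabolic orbit. -/
noncomputable def nuZero (s : ℝ) : ℝ := (s ^ (-(1 / 3) : ℝ)) ^ 2 / kap

lemma nuZero_pos {s : ℝ} (hs : 0 < s) : 0 < nuZero s := by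
  have := kap_pos
  unfold nuZero
  positivity

lemma nuZero_lt_nuZero {s s' : ℝ} (hs : 0 < s) (h : s < s') : nuZero s' < nuZero s := by
  have hk := kap_pos
  have h1 : s' ^ (-(1 / 3) : ℝ) < s ^ (-(1 / 3) : ℝ) := rpow_lt_rpow_of_neg hs h (by norm_num)
  have h2 : 0 < s' ^ (-(1 / 3) : ℝ) := rpow_pos_of_pos (hs.trans h) _
  unfold nuZero
  gcongr

lemma nuZero_sqrt_two_div_three : nuZero (√2 / 3) = 1 := by
  have hs : 0 < √2 / 3 := by positivity
  have h3 : nuZero (√2 / 3) ^ 3 = 1 := by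
    rw [nuZero, div_pow, kap_cube, ← pow_mul, mul_comm 2 3, pow_mul, rpow_neg_third_pow_three hs,
      inv_pow, div_pow, sq_sqrt (by norm_num)]
    norm_num
  exact (pow_eq_one_iff_of_nonneg (nuZero_pos hs).le (by norm_num)).1 h3

lemma exists_unperturbed_dist_bound {D : ℝ} (hD : D ∈ Set.Ioo (0 : ℝ) (1 / 2)) :
    ∃ d, 0 < d ∧ ∀ w θ t, 0 < w → 0 ≤ t → InIDplus D w θ →
      d ≤ 1 - 2 * nuZero (t + w) * cos (θ - t) + nuZero (t + w) ^ 2 := by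
  obtain ⟨hD0, hD1⟩ := hD
  have h2 : 1.4 < √2 := lt_sqrt_of_sq_lt (by norm_num)
  have hp : nuZero (√2 / 3 + D / 2) < 1 := by
    rw [← nuZero_sqrt_two_div_three]
    exact nuZero_lt_nuZero (by positivity) (by linarith)
  have hm : 1 < nuZero (√2 / 3 - D / 2) := by
    rw [← nuZero_sqrt_two_div_three]
    exact nuZero_lt_nuZero (by linarith) (by linarith)
  have hsin : 0 < sin (D / 2) := sin_pos_of_pos_of_lt_pi (by linarith) (by linarith [pi_gt_three])
  refine ⟨min (sin (D / 2) ^ 2) (min ((1 - nuZero (√2 / 3 + D / 2)) ^ 2)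
    ((nuZero (√2 / 3 - D / 2) - 1) ^ 2)), lt_min (by positivity) (lt_min (by
      have := sub_pos.2 hp; positivity) (by have := sub_pos.2 hm; positivity)), ?_⟩
  intro w θ t hw ht hdom
  have hs : 0 < t + w := by linarith
  have hν := nuZero_pos hs
  have hc := cos_le_one (θ - t)
  have hle : (1 - nuZero (t + w)) ^ 2
      ≤ 1 - 2 * nuZero (t + w) * cos (θ - t) + nuZero (t + w) ^ 2 := by nlinarith
  rcases le_or_gt (√2 / 3 + D / 2) (t + w) with h | h
  · refine (min_le_right _ _).trans ((min_le_left _ _).trans (le_trans ?_ hle))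
    have : nuZero (t + w) ≤ nuZero (√2 / 3 + D / 2) := by
      rcases h.eq_or_lt with h | h
      · rw [h]
      · exact (nuZero_lt_nuZero (by positivity) h).le
    nlinarith
  rcases le_or_gt (t + w) (√2 / 3 - D / 2) with h' | h'
  · refine (min_le_right _ _).trans ((min_le_right _ _).trans (le_trans ?_ hle))
    have : nuZero (√2 / 3 - D / 2) ≤ nuZero (t + w) := by
      rcases h'.eq_or_lt with h | h
      · rw [h]
      · exact (nuZero_lt_nuZero hs h).le
    nlinarith
  · refine (min_le_left _ _).trans ?_
    have hk : ∀ k : ℤ, D / 2 ≤ |θ - t - 2 * π * k| := by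
      intro k
      have h1 := (hdom.resolve_left (by linarith)) k
      have h2 : |t + w - √2 / 3| ≤ D / 2 := abs_le.2 ⟨by linarith, by linarith⟩
      have h3 := abs_add_le (θ - t - 2 * π * k) (t + w - √2 / 3)
      rw [show θ - t - 2 * π * k + (t + w - √2 / 3) = θ - (√2 / 3 - w) - 2 * π * k by ring] at h3
      linarith
    have hcos := cos_le_cos_of_forall_int (by linarith) hk
    nlinarith [sin_sq_add_cos_sq (D / 2), sq_nonneg (nuZero (t + w) - cos (D / 2))]

lemma nlArgs_mem_baseSet {D W d : ℝ} (hW : 0 < W)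
    (hd : ∀ w θ t, 0 < w → 0 ≤ t → InIDplus D w θ →
      d ≤ 1 - 2 * nuZero (t + w) * cos (θ - t) + nuZero (t + w) ^ 2)
    {p : ℝ × ℝ} (hp : p ∈ DomPlus D W) (δ : ℝ) (u : Fin 3 → ℝ →ᵇ ℝ) (t : ℝ) :
    (fun j => nlArgs δ p u j t) ∈ baseSet (W ^ (-(1 / 3) : ℝ)) d := by
  have hp0 : 0 < p.1 := hW.trans_le hp.1
  have ht := le_max_right t 0
  rw [nlArgs_apply δ hp0]
  refine ⟨?_, ?_, ?_, ?_, ?_⟩ <;> simp only [Matrix.cons_val]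
  · positivity
  · exact rpow_le_rpow_of_nonpos hW (by linarith [hp.1]) (by norm_num)
  · exact abs_cos_le_one _
  · exact abs_sin_le_one _
  · exact hd p.1 p.2 _ hp0 ht hp.2

lemma norm_nlArgs_sub_baseProj_le {δ : ℝ} (hδ : 0 ≤ δ) (hδ1 : δ ≤ 1) {p : ℝ × ℝ} (hp : 0 < p.1)
    (u : Fin 3 → ℝ →ᵇ ℝ) (t : ℝ) :
    ‖(fun j => nlArgs δ p u j t) - baseProj fun j => nlArgs δ p u j t‖ ≤ δ * (1 + ‖u‖) := by
  have hu : ∀ j, δ * |u j t| ≤ δ * (1 + ‖u‖) := fun j => by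
    have := (abs_apply_le (u j) t).trans (norm_le_pi_norm u j)
    gcongr
    linarith
  have h0 := norm_nonneg u
  have hδ2 : δ ^ 2 ≤ δ := by nlinarith
  rw [nlArgs_apply δ hp, pi_norm_le_iff_of_nonneg (by positivity)]
  intro i
  have h2 : ∀ j, δ ^ 2 * |u j t| ≤ δ * (1 + ‖u‖) := fun j =>
    (mul_le_mul_of_nonneg_right hδ2 (abs_nonneg _)).trans (hu j)
  fin_cases i <;> simp [baseProj, abs_of_nonneg hδ] <;>
    first | positivity | apply hu | apply h2 | nlinarith

lemma isAdmissible_of_small {φ : Fin 3 → (Fin 8 → ℝ) → ℝ} {D W d ε δ : ℝ} (hW : 0 < W)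
    (hd : ∀ w θ t, 0 < w → 0 ≤ t → InIDplus D w θ →
      d ≤ 1 - 2 * nuZero (t + w) * cos (θ - t) + nuZero (t + w) ^ 2)
    (hε : ∀ y ∈ baseSet (W ^ (-(1 / 3) : ℝ)) d, ‖y - baseProj y‖ ≤ ε →
      y ∈ nlDom ∧ ∀ i, φ i y = nl i y)
    {p : ℝ × ℝ} (hp : p ∈ DomPlus D W) (hδ : 0 ≤ δ) (hδ1 : δ ≤ 1) {u : Fin 3 → ℝ →ᵇ ℝ}
    (hsmall : δ * (1 + ‖u‖) ≤ ε) : IsAdmissible φ δ p u := fun t =>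
  hε _ (nlArgs_mem_baseSet hW hd hp δ u t)
    ((norm_nlArgs_sub_baseProj_le hδ hδ1 (hW.trans_le hp.1) u t).trans hsmall)

end CollisionAvoidance

section Melnikov

lemma tendsto_integral_shift {f g : ℝ → ℝ} {w : ℝ} (hg : IntegrableOn g (Set.Ioi 0))
    (h : ∀ τ, 0 < τ → f (τ + w) = g τ) :
    Tendsto (fun T => ∫ s in w..T, f s) atTop (𝓝 (∫ τ in Set.Ioi 0, g τ)) := by
  have h1 := intervalIntegral_tendsto_integral_Ioi 0 hg
    (tendsto_atTop_add_const_right atTop (-w) tendsto_id)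
  refine h1.congr' ?_
  filter_upwards [eventually_ge_atTop w] with T hT
  have h2 := intervalIntegral.integral_comp_add_right (a := 0) (b := T - w) f w
  rw [zero_add, sub_add_cancel] at h2
  rw [← h2]
  refine intervalIntegral.integral_congr_ae (Eventually.of_forall fun τ hτ => ?_)
  rw [id, ← sub_eq_add_neg, Set.uIoc_of_le (by linarith)] at hτ
  exact (h τ hτ.1).symm

/-- The squared distance to the second primary, in units of the radius, along the unperturbed
parabolic orbit. -/
noncomputable def distZero (w θ t : ℝ) : ℝ :=
  1 - 2 * nuZero (t + w) * cos (θ - t) + nuZero (t + w) ^ 2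

lemma sqrt_two_div_kap : √(2 / kap) = 2 / 3 * kap := by
  have hk := kap_pos
  rw [sqrt_eq_iff_mul_self_eq (by positivity) (by positivity)]
  have := kap_cube
  field_simp
  linarith

lemma kap_sq_inv : (kap ^ 2)⁻¹ = √(2 / kap) / 3 := by
  have hk := kap_pos
  rw [sqrt_two_div_kap]
  have := kap_cube
  field_simp
  linarith

lemma melInfA_add {θ w t : ℝ} (hs : 0 < t + w) (hd : 0 < distZero w θ t) :
    kap * melInfA θ w (t + w) =
      (t + w) ^ (-(1 / 3) - 1 : ℝ) *
        ((kap ^ 2)⁻¹ * sin (θ - t) * (√(distZero w θ t) ^ 3)⁻¹) := by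
  have hk := kap_pos
  have hb : 0 < (t + w) ^ (-(1 / 3) : ℝ) := rpow_pos_of_pos hs _
  have e1 := rpow_two_thirds_mul_sq hs
  have e2 : (t + w) ^ (4 / 3 : ℝ) = ((t + w) ^ (2 / 3 : ℝ)) ^ 2 := by
    rw [← rpow_mul_natCast hs.le]; norm_num
  have e3 : (t + w) ^ (-(1 / 3) - 1 : ℝ) = ((t + w) ^ (-(1 / 3) : ℝ)) ^ 4 := by
    rw [← rpow_mul_natCast hs.le]; norm_num
  have e4 : θ + w - (t + w) = θ - t := by ring
  rw [melInfA, e2, e3, e4]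
  have hD : distZero w θ t = 1 - 2 * nuZero (t + w) * cos (θ - t) + nuZero (t + w) ^ 2 := rfl
  rw [nuZero] at hD
  set b := (t + w) ^ (-(1 / 3) : ℝ)
  have ea : (t + w) ^ (2 / 3 : ℝ) = (b ^ 2)⁻¹ := eq_inv_of_mul_eq_one_left e1
  rw [ea]
  have e5 : 1 + kap ^ 2 * ((b ^ 2)⁻¹) ^ 2 - 2 * kap * (b ^ 2)⁻¹ * cos (θ - t)
      = (kap / b ^ 2) ^ 2 * distZero w θ t := by
    rw [hD]
    field_simp
    ring
  rw [e5, rpow_neg_three_halves (by positivity), sqrt_mul (by positivity),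
    sqrt_sq (by positivity)]
  have h3 : 0 < √(distZero w θ t) := sqrt_pos.2 hd
  field_simp

lemma continuous_distZero_max {w : ℝ} (hw : 0 < w) (θ : ℝ) :
    Continuous fun t => distZero w θ (max t 0) := by
  have h : Continuous fun t : ℝ => (max t 0 + w) ^ (-(1 / 3) : ℝ) :=
    Continuous.rpow_const (by fun_prop) fun t => Or.inl (by linarith [le_max_right t 0])
  unfold distZero nuZero
  fun_prop

lemma integrableOn_melnikov {w θ d : ℝ} (hw : 0 < w) (hd0 : 0 < d)
    (hd : ∀ t, 0 ≤ t → d ≤ distZero w θ t) :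
    IntegrableOn (fun τ => (τ + w) ^ (-(1 / 3) - 1 : ℝ) *
        ((kap ^ 2)⁻¹ * sin (θ - τ) * (√(distZero w θ τ) ^ 3)⁻¹)) (Set.Ioi 0) := by
  have hpos : ∀ t, 0 < √(distZero w θ (max t 0)) := fun t =>
    sqrt_pos.2 (hd0.trans_le (hd _ (le_max_right _ _)))
  have hcont : Continuous fun t =>
      (kap ^ 2)⁻¹ * sin (θ - t) * (√(distZero w θ (max t 0)) ^ 3)⁻¹ := by
    have h1 := (continuous_distZero_max hw θ).sqrt
    have h2 : Continuous fun t => (√(distZero w θ (max t 0)) ^ 3)⁻¹ :=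
      (h1.pow 3).inv₀ fun t => (pow_pos (hpos t) 3).ne'
    fun_prop
  refine (integrableOn_rpow_mul (α := 1 / 3) (M := (kap ^ 2)⁻¹ * (√d ^ 3)⁻¹) (by norm_num)
    hcont (fun t => ?_) (neg_lt_zero.2 hw)).congr_fun (fun τ hτ => ?_) measurableSet_Ioi
  · rw [abs_mul, abs_mul, abs_of_nonneg (inv_nonneg.2 (sq_nonneg kap)),
      abs_of_pos (inv_pos.2 (pow_pos (hpos t) 3))]
    have h1 : (√(distZero w θ (max t 0)) ^ 3)⁻¹ ≤ (√d ^ 3)⁻¹ := by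
      have h2 := sqrt_pos.2 hd0
      have := sqrt_le_sqrt (hd _ (le_max_right t 0))
      gcongr
    have h3 := abs_sin_le_one (θ - t)
    have h4 : 0 ≤ (kap ^ 2)⁻¹ := by positivity
    gcongr
    exact mul_le_of_le_one_right h4 h3
  · simp only [max_eq_left (Set.mem_Ioi.1 hτ).le]

lemma integrableOn_rpow_mul_sin {w : ℝ} (hw : 0 < w) (θ : ℝ) :
    IntegrableOn (fun τ => (τ + w) ^ (-(1 / 3) - 1 : ℝ) * sin (θ - τ)) (Set.Ioi 0) :=
  integrableOn_rpow_mul (α := 1 / 3) (M := 1) (by norm_num) (by fun_prop)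
    (fun _ => abs_sin_le_one _) (neg_lt_zero.2 hw)

lemma tendsto_integral_melInfA {w θ d : ℝ} (hw : 0 < w) (hd0 : 0 < d)
    (hd : ∀ t, 0 ≤ t → d ≤ distZero w θ t) :
    Tendsto (fun T => ∫ s in w..T, melInfA θ w s) atTop
      (𝓝 (kap⁻¹ * ∫ τ in Set.Ioi 0, (τ + w) ^ (-(1 / 3) - 1 : ℝ) *
        ((kap ^ 2)⁻¹ * sin (θ - τ) * (√(distZero w θ τ) ^ 3)⁻¹))) := by
  have hk := kap_pos
  have h := (tendsto_integral_shift (f := fun s => kap * melInfA θ w s)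
    (integrableOn_melnikov hw hd0 hd) fun τ hτ =>
      melInfA_add (by linarith) (hd0.trans_le (hd τ hτ.le))).const_mul kap⁻¹
  refine h.congr fun T => ?_
  rw [intervalIntegral.integral_const_mul, ← mul_assoc, inv_mul_cancel₀ hk.ne', one_mul]

lemma tendsto_integral_melInfB {w : ℝ} (hw : 0 < w) (θ : ℝ) :
    Tendsto (fun T => ∫ s in w..T, melInfB θ w s) atTop
      (𝓝 (sin θ * w ^ (-(1 / 3) : ℝ)
        - 1 / 3 * ∫ τ in Set.Ioi 0, (τ + w) ^ (-(1 / 3) - 1 : ℝ) * sin (θ - τ))) := by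
  have h1 := (tendsto_integral_shift
    (f := fun s => s ^ (-(1 / 3) - 1 : ℝ) * sin (θ + w - s)) (w := w)
    (integrableOn_rpow_mul_sin hw θ) fun τ _ => by
      rw [show θ + w - (τ + w) = θ - τ by ring]).const_mul (1 / 3)
  have h2 : Tendsto (fun T : ℝ => sin (θ + w - T) * T ^ (-(1 / 3) : ℝ)) atTop (𝓝 0) := by
    have h3 : Tendsto (fun T : ℝ => T ^ (-(1 / 3) : ℝ)) atTop (𝓝 0) :=
      tendsto_rpow_neg_atTop (by norm_num)
    refine squeeze_zero_norm' ?_ h3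
    filter_upwards [eventually_ge_atTop 0] with T hT
    rw [Real.norm_eq_abs, abs_mul, abs_of_nonneg (rpow_nonneg hT _)]
    exact mul_le_of_le_one_left (rpow_nonneg hT _) (abs_sin_le_one _)
  have h3 := ((tendsto_const_nhds (x := sin θ * w ^ (-(1 / 3) : ℝ))).sub h2).sub h1
  rw [sub_zero] at h3
  refine h3.congr' ?_
  filter_upwards [eventually_ge_atTop w] with T hT
  have hpos : ∀ s ∈ Set.uIcc w T, 0 < s := fun s hs =>
    hw.trans_le (by rw [Set.uIcc_of_le hT] at hs; exact hs.1)
  have hB : IntervalIntegrable (fun s => melInfB θ w s) volume w T := by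
    refine ContinuousOn.intervalIntegrable fun s hs => ?_
    have := hpos s hs
    refine ContinuousAt.continuousWithinAt ?_
    refine ContinuousAt.mul (by fun_prop) (continuousAt_rpow_const _ _ (Or.inl this.ne'))
  have hS : IntervalIntegrable (fun s => s ^ (-(1 / 3) - 1 : ℝ) * sin (θ + w - s))
      volume w T := by
    refine ContinuousOn.intervalIntegrable fun s hs => ?_
    have := hpos s hs
    refine ContinuousAt.continuousWithinAt ?_
    refine ContinuousAt.mul (continuousAt_rpow_const _ _ (Or.inl this.ne')) (by fun_prop)
  have hder : ∀ s ∈ Set.uIcc w T, HasDerivAt (fun s => -(sin (θ + w - s) * s ^ (-(1 / 3) : ℝ)))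
      (melInfB θ w s + 1 / 3 * (s ^ (-(1 / 3) - 1 : ℝ) * sin (θ + w - s))) s := fun s hs => by
    have h4 : HasDerivAt (fun s => sin (θ + w - s)) (-cos (θ + w - s)) s := by
      simpa using ((hasDerivAt_id s).const_sub (θ + w)).sin
    have h5 := hasDerivAt_rpow_const (p := -(1 / 3)) (Or.inl (hpos s hs).ne')
    refine (h4.mul h5).neg.congr_deriv ?_
    rw [melInfB]
    ring
  have h6 := integral_eq_sub_of_hasDerivAt hder (hB.add (hS.const_mul _))
  rw [intervalIntegral.integral_add hB (hS.const_mul _),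
    intervalIntegral.integral_const_mul] at h6
  rw [add_sub_cancel_right] at h6
  linarith

/-- The limits of the two Melnikov integrals, combined. -/
lemma exists_melnikov_limits {w θ d : ℝ} (hw : 0 < w) (hd0 : 0 < d)
    (hd : ∀ t, 0 ≤ t → d ≤ distZero w θ t) :
    ∃ LA LB : ℝ, Tendsto (fun T => ∫ s in w..T, melInfA θ w s) atTop (𝓝 LA) ∧
      Tendsto (fun T => ∫ s in w..T, melInfB θ w s) atTop (𝓝 LB) ∧
      kap * LA + √(2 / kap) * LB = √(2 / kap) * (sin θ * w ^ (-(1 / 3) : ℝ)) -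
        ∫ τ in Set.Ioi 0, (τ + w) ^ (-(1 / 3) - 1 : ℝ) *
          ((kap ^ 2)⁻¹ * sin (θ - τ) * (1 - (√(distZero w θ τ) ^ 3)⁻¹)) := by
  refine ⟨_, _, tendsto_integral_melInfA hw hd0 hd, tendsto_integral_melInfB hw θ, ?_⟩
  have hk := kap_pos
  have e : ∀ τ, (τ + w) ^ (-(1 / 3) - 1 : ℝ) *
        ((kap ^ 2)⁻¹ * sin (θ - τ) * (1 - (√(distZero w θ τ) ^ 3)⁻¹))
      = (kap ^ 2)⁻¹ * ((τ + w) ^ (-(1 / 3) - 1 : ℝ) * sin (θ - τ))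
        - (τ + w) ^ (-(1 / 3) - 1 : ℝ) *
        ((kap ^ 2)⁻¹ * sin (θ - τ) * (√(distZero w θ τ) ^ 3)⁻¹) := fun τ => by ring
  simp only [e]
  rw [MeasureTheory.integral_sub ((integrableOn_rpow_mul_sin hw θ).const_mul _)
    (integrableOn_melnikov hw hd0 hd), MeasureTheory.integral_const_mul]
  generalize (∫ τ in Set.Ioi 0, (τ + w) ^ (-(1 / 3) - 1 : ℝ) *
        ((kap ^ 2)⁻¹ * sin (θ - τ) * (√(distZero w θ τ) ^ 3)⁻¹)) = A
  rw [kap_sq_inv, ← mul_assoc, mul_inv_cancel₀ hk.ne']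
  ring

end Melnikov

section InitialData

variable {μ r θ ρ α : ℝ}

lemma abs_relY_sub_le (μ ρ α : ℝ) : |relY μ ρ α - ρ| ≤ |μ| := by
  rw [relY, add_sub_cancel_left, abs_mul]
  exact mul_le_of_le_one_right (abs_nonneg _) (abs_cos_le_one _)

lemma abs_relZ_le (μ α : ℝ) : |relZ μ α| ≤ |μ| := by
  rw [relZ, abs_neg, abs_mul]
  exact mul_le_of_le_one_right (abs_nonneg _) (abs_sin_le_one _)

lemma relR_sq' (μ ρ α : ℝ) : relR μ ρ α ^ 2 = ρ ^ 2 + 2 * μ * ρ * cos α + μ ^ 2 := by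
  rw [relR_sq, relY, relZ]
  linear_combination μ ^ 2 * sin_sq_add_cos_sq α

lemma relR_nonneg : 0 ≤ relR μ ρ α := sqrt_nonneg _

lemma abs_relR_sub_le (hρ : |μ| < ρ) : |relR μ ρ α - ρ| ≤ |μ| := by
  have h0 : 0 ≤ relR μ ρ α := relR_nonneg
  have hμ := abs_nonneg μ
  have h1 := relR_sq' μ ρ α
  have h2 : |μ * cos α| ≤ |μ| := by
    rw [abs_mul]
    exact mul_le_of_le_one_right hμ (abs_cos_le_one _)
  have h3 := abs_le.1 h2
  have h4 := sq_abs μ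
  rw [abs_le]
  constructor
  · have : ρ - |μ| ≤ relR μ ρ α := by
      refine le_of_sq_le_sq ?_ h0
      nlinarith
    linarith
  · have : relR μ ρ α ≤ ρ + |μ| := by
      refine le_of_sq_le_sq ?_ (by linarith)
      nlinarith
    linarith

lemma abs_arctan_le_abs (x : ℝ) : |arctan x| ≤ |x| := by
  have h : ∀ y, 0 ≤ y → arctan y ≤ y := fun y hy => by
    have h0 := arctan_nonneg.2 hy
    have h2 := le_tan h0 (arctan_lt_pi_div_two y)
    rwa [tan_arctan] at h2
  rcases le_total 0 x with hx | hx
  · rw [abs_of_nonneg hx, abs_of_nonneg (arctan_nonneg.2 hx)]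
    exact h x hx
  · rw [← abs_neg, ← arctan_neg, abs_of_nonpos hx, abs_of_nonneg (arctan_nonneg.2 (by linarith))]
    exact h _ (by linarith)

lemma abs_relAngle_sub_le (hρ : 2 * |μ| ≤ ρ) (hρ0 : 0 < ρ) :
    |relAngle μ ρ α - α| ≤ 2 * |μ| / ρ := by
  rw [relAngle, add_sub_cancel_left]
  refine (abs_arctan_le_abs _).trans ?_
  have h1 := abs_le.1 (abs_relY_sub_le μ ρ α)
  have h2 := abs_relZ_le μ α
  have h3 : 0 < relY μ ρ α := by linarith
  rw [abs_div, abs_of_pos h3, div_le_div_iff₀ h3 hρ0]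
  have := abs_nonneg μ
  nlinarith

lemma relR_mul_cos_relAngle (hρ : |μ| < ρ) :
    relR μ ρ α * cos (relAngle μ ρ α) = ρ * cos α + μ := by
  rw [cos_relAngle hρ, mul_div_cancel₀ _ (relR_pos hρ).ne', relY, relZ]
  linear_combination μ * sin_sq_add_cos_sq α

lemma relR_mul_sin_relAngle (hρ : |μ| < ρ) :
    relR μ ρ α * sin (relAngle μ ρ α) = ρ * sin α := by
  rw [sin_relAngle hρ, mul_div_cancel₀ _ (relR_pos hρ).ne', relY, relZ]
  ring

lemma relR_relR_neg (hr : |μ| < r) :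
    relR μ (relR (-μ) r θ) (relAngle (-μ) r θ) = r := by
  have hr' : |-μ| < r := by rwa [abs_neg]
  have h := relR_mul_cos_relAngle (α := θ) hr'
  have h0 : 0 < r := (abs_nonneg μ).trans_lt hr
  have h1 := relR_sq' μ (relR (-μ) r θ) (relAngle (-μ) r θ)
  have h2 := relR_sq' (-μ) r θ
  refine (pow_left_inj₀ relR_nonneg h0.le two_ne_zero).1 ?_
  linear_combination h1 + h2 + 2 * μ * h

lemma relAngle_relR_neg (hr : |μ| < r) :
    relAngle μ (relR (-μ) r θ) (relAngle (-μ) r θ) = θ := by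
  have hr' : |-μ| < r := by rwa [abs_neg]
  have h0 : 0 < r := (abs_nonneg μ).trans_lt hr
  have hc := relR_mul_cos_relAngle (α := θ) hr'
  have hs := relR_mul_sin_relAngle (α := θ) hr'
  have hR := relR_pos (α := θ) hr'
  have hY := relY_pos (α := θ) hr'
  have h2 := relR_sq' (-μ) r θ
  have hsR : sin (relAngle (-μ) r θ) = r * sin θ / relR (-μ) r θ := by
    rw [← hs]; field_simp
  have hcR : cos (relAngle (-μ) r θ) = (r * cos θ + -μ) / relR (-μ) r θ := by
    rw [← hc]; field_simp
  have hY2 : relY μ (relR (-μ) r θ) (relAngle (-μ) r θ) = r * relY (-μ) r θ / relR (-μ) r θ := by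
    rw [relY, hcR, relY]
    field_simp
    linear_combination h2
  have hZ2 : relZ μ (relAngle (-μ) r θ) = - (r * relZ (-μ) θ / relR (-μ) r θ) := by
    rw [relZ, hsR, relZ]
    field_simp
  have hq : relZ μ (relAngle (-μ) r θ) / relY μ (relR (-μ) r θ) (relAngle (-μ) r θ)
      = -(relZ (-μ) θ / relY (-μ) r θ) := by
    rw [hY2, hZ2]
    field_simp
  rw [relAngle, hq, arctan_neg, relAngle]
  ring

/-- The scaled initial radial deviation. -/
noncomputable def initXi (δ : ℝ) (p : ℝ × ℝ) : ℝ :=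
  (relR (-δ ^ 2) (kap * p.1 ^ (2 / 3 : ℝ)) p.2 - kap * p.1 ^ (2 / 3 : ℝ)) / δ ^ 2

/-- The scaled initial angular deviation. -/
noncomputable def initPsi (δ : ℝ) (p : ℝ × ℝ) : ℝ :=
  (relAngle (-δ ^ 2) (kap * p.1 ^ (2 / 3 : ℝ)) p.2 - p.2) / δ

lemma contDiffAt_relR {f g : ℝ × ℝ → ℝ} {p : ℝ × ℝ} (hf : ContDiffAt ℝ ∞ f p)
    (hg : ContDiffAt ℝ ∞ g p) (h : |μ| < f p) :
    ContDiffAt ℝ ∞ (fun p => relR μ (f p) (g p)) p := by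
  have hpos := relY_pos (α := g p) h
  refine ContDiffAt.sqrt ?_ (ne_of_gt (by positivity))
  unfold relY relZ
  fun_prop

lemma contDiffAt_relAngle {f g : ℝ × ℝ → ℝ} {p : ℝ × ℝ} (hf : ContDiffAt ℝ ∞ f p)
    (hg : ContDiffAt ℝ ∞ g p) (h : |μ| < f p) :
    ContDiffAt ℝ ∞ (fun p => relAngle μ (f p) (g p)) p := by
  have hpos := relY_pos (α := g p) h
  refine hg.add (ContDiffAt.arctan (ContDiffAt.div ?_ ?_ hpos.ne'))
  · unfold relZ
    fun_prop
  · unfold relY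
    fun_prop

variable {W δ : ℝ} {p : ℝ × ℝ}

lemma kap_mul_le (hW : 0 < W) (hp : W ≤ p.1) :
    kap * W ^ (2 / 3 : ℝ) ≤ kap * p.1 ^ (2 / 3 : ℝ) := by
  have := kap_pos
  gcongr

lemma abs_neg_sq (δ : ℝ) : |-δ ^ 2| = δ ^ 2 := by rw [abs_neg, abs_of_nonneg (sq_nonneg δ)]

lemma contDiffAt_radius (hp : 0 < p.1) :
    ContDiffAt ℝ ∞ (fun p : ℝ × ℝ => kap * p.1 ^ (2 / 3 : ℝ)) p :=
  contDiffAt_const.mul (ContDiffAt.rpow_const_of_ne (by fun_prop) hp.ne')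

lemma contDiffAt_initXi (hW : 0 < W) (hp : W ≤ p.1) (h : δ ^ 2 < kap * W ^ (2 / 3 : ℝ)) :
    ContDiffAt ℝ ∞ (initXi δ) p :=
  have hr := contDiffAt_radius (hW.trans_le hp)
  ((contDiffAt_relR hr (by fun_prop) (by
    rw [abs_neg_sq]; exact h.trans_le (kap_mul_le hW hp))).sub hr).div_const _

lemma contDiffAt_initPsi (hW : 0 < W) (hp : W ≤ p.1) (h : δ ^ 2 < kap * W ^ (2 / 3 : ℝ)) :
    ContDiffAt ℝ ∞ (initPsi δ) p :=
  have hr := contDiffAt_radius (hW.trans_le hp)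
  ((contDiffAt_relAngle hr (by fun_prop) (by
    rw [abs_neg_sq]; exact h.trans_le (kap_mul_le hW hp))).sub (by fun_prop)).div_const _

lemma abs_initXi_le (hW : 0 < W) (hp : W ≤ p.1) (hδ : 0 < δ)
    (h : δ ^ 2 < kap * W ^ (2 / 3 : ℝ)) : |initXi δ p| ≤ 1 := by
  have h1 : |-δ ^ 2| < kap * p.1 ^ (2 / 3 : ℝ) := by
    rw [abs_neg_sq]; exact h.trans_le (kap_mul_le hW hp)
  have h2 := abs_relR_sub_le (α := p.2) h1
  rw [abs_neg_sq] at h2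
  rwa [initXi, abs_div, abs_of_nonneg (sq_nonneg δ), div_le_one (by positivity)]

lemma abs_initPsi_le (hW : 0 < W) (hp : W ≤ p.1) (hδ : 0 < δ)
    (h : 2 * δ ^ 2 ≤ kap * W ^ (2 / 3 : ℝ)) :
    |initPsi δ p| ≤ 2 / (kap * W ^ (2 / 3 : ℝ)) * δ := by
  have hk := kap_pos
  have hp0 := hW.trans_le hp
  have hr0 := kap_mul_le hW hp
  have h2 := abs_relAngle_sub_le (μ := -δ ^ 2) (α := p.2) (ρ := kap * p.1 ^ (2 / 3 : ℝ))
    (by rw [abs_neg_sq]; exact h.trans hr0) (by positivity)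
  rw [abs_neg_sq] at h2
  rw [initPsi, abs_div, abs_of_pos hδ, div_le_iff₀ hδ]
  refine h2.trans ?_
  rw [mul_assoc, ← sq, mul_div_right_comm]
  gcongr

end InitialData

section Estimates

lemma abs_relMomR_sub_le {μ ρ α P G r r₀ c₁ c₂ c₃ P₀ : ℝ} (hμ : 0 ≤ μ) (hr₀ : 0 < r₀)
    (hμ1 : μ ≤ 1) (hμr : 4 * μ ≤ r₀) (hr : r₀ ≤ r) (hR : relR μ ρ α = r) (hρ : |ρ - r| ≤ μ)
    (hP : |P - P₀| ≤ c₁ * μ) (hP₀ : |P₀| ≤ c₂) (hG : |G| ≤ c₃ * μ) (hc₁ : 0 ≤ c₁)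
    (hc₃ : 0 ≤ c₃) :
    |relMomR μ ρ α P G - P₀| ≤ (c₁ + 2 * (c₂ + c₁) / r₀ + c₃ / r₀) * μ := by
  have hr0 : 0 < r := by linarith
  have h := abs_le.1 hρ
  have hρ0 : r / 2 ≤ ρ := by linarith
  have hρp : 0 < ρ := by linarith
  have hY := abs_relY_sub_le μ ρ α
  have hZ := abs_relZ_le μ α
  rw [abs_of_nonneg hμ] at hY hZ
  have hYr : |relY μ ρ α - r| ≤ 2 * μ := by
    have := abs_add_le (relY μ ρ α - ρ) (ρ - r)
    rw [sub_add_sub_cancel] at this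
    linarith
  have hPa : |P| ≤ c₂ + c₁ := by
    have := abs_add_le (P - P₀) P₀
    rw [sub_add_cancel] at this
    nlinarith
  have hc : 0 ≤ c₂ + c₁ := (abs_nonneg _).trans hPa
  have e : relMomR μ ρ α P G - P₀
      = (P - P₀) + (relY μ ρ α - r) * P / r + relZ μ α * G / (ρ * r) := by
    rw [relMomR, hR]
    field_simp
    ring
  have t2 : |(relY μ ρ α - r) * P / r| ≤ 2 * μ * (c₂ + c₁) / r₀ := by
    rw [abs_div, abs_mul, abs_of_pos hr0]
    gcongr
  have t3 : |relZ μ α * G / (ρ * r)| ≤ c₃ * μ / r₀ := by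
    rw [abs_div, abs_mul, abs_of_pos (by positivity : 0 < ρ * r)]
    have : μ ≤ ρ := by linarith
    calc |relZ μ α| * |G| / (ρ * r) ≤ ρ * (c₃ * μ) / (ρ * r₀) := by
          gcongr
          linarith
      _ = c₃ * μ / r₀ := by field_simp
  rw [e]
  refine (abs_add_three _ _ _).trans ?_
  calc _ ≤ c₁ * μ + 2 * μ * (c₂ + c₁) / r₀ + c₃ * μ / r₀ := by gcongr
    _ = _ := by ring

lemma abs_relMomG_sub_le {μ ρ α P G θ r₀ c₁ c₂ c₃ c₄ P₀ : ℝ} (hμ : 0 ≤ μ) (hr₀ : 0 < r₀)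
    (hρ : r₀ ≤ ρ) (hα : |α - θ| ≤ c₄ * μ)
    (hP : |P - P₀| ≤ c₁ * μ) (hP₀ : |P₀| ≤ c₂) (hG : |G| ≤ c₃ * μ)
    (hc₃ : 0 ≤ c₃) (hc₄ : 0 ≤ c₄) :
    |relMomG μ ρ α P G - G - μ * (sin θ * P₀)| ≤ (c₃ / r₀ + c₁ + c₄ * c₂) * μ ^ 2 := by
  have hρp : 0 < ρ := by linarith
  have e : relMomG μ ρ α P G - G - μ * (sin θ * P₀)
      = μ * cos α * G / ρ + μ * sin α * (P - P₀) + μ * (sin α - sin θ) * P₀ := by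
    rw [relMomG, relY, relZ]
    field_simp
    ring
  have hs : |sin α - sin θ| ≤ c₄ * μ := by
    have : |sin α - sin θ| ≤ |α - θ| := by
      have := Real.lipschitzWith_sin.dist_le_mul α θ
      simpa [Real.dist_eq] using this
    linarith
  have hc := abs_cos_le_one α
  have hsn := abs_sin_le_one α
  have t1 : |μ * cos α * G / ρ| ≤ μ * 1 * (c₃ * μ) / r₀ := by
    rw [abs_div, abs_mul, abs_mul, abs_of_pos hρp, abs_of_nonneg hμ]
    gcongr
  have t2 : |μ * sin α * (P - P₀)| ≤ μ * 1 * (c₁ * μ) := by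
    rw [abs_mul, abs_mul, abs_of_nonneg hμ]
    gcongr
  have t3 : |μ * (sin α - sin θ) * P₀| ≤ μ * (c₄ * μ) * c₂ := by
    rw [abs_mul, abs_mul, abs_of_nonneg hμ]
    gcongr
  rw [e]
  refine (abs_add_three _ _ _).trans ?_
  calc _ ≤ μ * 1 * (c₃ * μ) / r₀ + μ * 1 * (c₁ * μ) + μ * (c₄ * μ) * c₂ := by gcongr
    _ = _ := by ring

variable {φ : Fin 3 → (Fin 8 → ℝ) → ℝ} (hφ : ∀ i, ContDiff ℝ ∞ (φ i)) {δ Θ M W N : ℝ}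
  {p : ℝ × ℝ} {u : Fin 3 → ℝ →ᵇ ℝ} {ξ₀ ψ₀ : ℝ × ℝ → ℝ}

lemma norm_bBdd_mul_tailOp_le (hW : 0 < W) (hp : W ≤ p.1) (v : ℝ →ᵇ ℝ) :
    ‖bBdd p.1 * tailOp (1 / 3) (by norm_num) p.1 v‖ ≤ 3 * W ^ (-(1 / 3) : ℝ) * ‖v‖ := by
  refine (norm_mul_le _ _).trans ?_
  have h1 := norm_bBdd_le hW hp
  have h2 := norm_tailOp_le (α := 1 / 3) (by norm_num) (hW.trans_le hp) v
  calc _ ≤ W ^ (-(1 / 3) : ℝ) * (3 * ‖v‖) := by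
        gcongr
        linarith
    _ = _ := by ring

lemma nlArgs_zero_zero (hp : 0 < p.1) (δ : ℝ) (u : Fin 3 → ℝ →ᵇ ℝ) (t : ℝ) :
    (fun j => nlArgs 0 p 0 j t) = baseProj fun j => nlArgs δ p u j t := by
  rw [nlArgs_apply _ hp, nlArgs_apply _ hp]
  funext j
  fin_cases j <;> simp [baseProj]

lemma norm_force_sub_base_le (hM : 0 ≤ M) (hL : ∀ i x y, |φ i x - φ i y| ≤ M * ‖x - y‖)
    (hδ : 0 ≤ δ) (hδ1 : δ ≤ 1) (hp : 0 < p.1) (i : Fin 3) (hu : ‖u‖ ≤ N) :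
    ‖force φ hφ i δ p u - force φ hφ i 0 p 0‖ ≤ M * (1 + N) * δ := by
  have hN : 0 ≤ N := (norm_nonneg u).trans hu
  rw [BoundedContinuousFunction.norm_le (by positivity)]
  intro t
  refine (hL i _ _).trans ?_
  rw [nlArgs_zero_zero hp δ u]
  calc _ ≤ M * (δ * (1 + ‖u‖)) := by
        gcongr
        exact norm_nlArgs_sub_baseProj_le hδ hδ1 hp u t
    _ ≤ M * (δ * (1 + N)) := by gcongr
    _ = _ := by ring

lemma force_one_zero (hp : 0 < p.1) (hadm : IsAdmissible φ 0 p 0) : force φ hφ 1 0 p 0 = 0 := by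
  ext t
  have h : force φ hφ 1 0 p 0 t = nl 1 fun j => nlArgs 0 p 0 j t := (hadm t).2 1
  rw [h, nlArgs_apply _ hp]
  simp [nl]

lemma norm_apply_one_le (hM : 0 ≤ M) (hL : ∀ i x y, |φ i x - φ i y| ≤ M * ‖x - y‖)
    (hδ : 0 ≤ δ) (hδ1 : δ ≤ 1) (hW : 0 < W) (hp : W ≤ p.1) (hu : ‖u‖ ≤ N)
    (hfix : fixMap φ hφ δ Θ ξ₀ ψ₀ (p, u) = u) (hadm : IsAdmissible φ 0 p 0) {c : ℝ}
    (hψ : |ψ₀ p| ≤ c * δ) :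
    ‖u 1‖ ≤ (c + 6 * W ^ (-(1 / 3) : ℝ) * (M * (1 + N))) * δ := by
  have h1 := norm_force_sub_base_le hφ hM hL hδ hδ1 (hW.trans_le hp) 1 hu
  rw [force_one_zero hφ (hW.trans_le hp) hadm, sub_zero] at h1
  have h2 : ‖forceTail φ hφ 1 δ p u‖ ≤ 3 * W ^ (-(1 / 3) : ℝ) * (M * (1 + N) * δ) :=
    (norm_bBdd_mul_tailOp_le hW hp _).trans (by gcongr)
  have h3 := abs_apply_le (forceTail φ hφ 1 δ p u) 0
  have h4 : ‖(ψ₀ p + forceTail φ hφ 1 δ p u 0) • (1 : ℝ →ᵇ ℝ)‖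
      ≤ |ψ₀ p| + ‖forceTail φ hφ 1 δ p u‖ := by
    rw [norm_smul, norm_one, mul_one, Real.norm_eq_abs]
    exact (abs_add_le _ _).trans (by linarith)
  have h5 : u 1 = (ψ₀ p + forceTail φ hφ 1 δ p u 0) • 1 - forceTail φ hφ 1 δ p u := by
    conv_lhs => rw [← hfix]
    rfl
  rw [h5]
  refine (norm_sub_le _ _).trans ?_
  linarith

/-- The angular momentum force is independent of the last two coordinates. -/
lemma nl_two_eq {y : Fin 8 → ℝ} {a b : ℝ} :
    nl 2 y = nl 2 ![y 0, y 1, y 2, y 3, y 4, y 5, a, b] := rfl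

lemma norm_force_two_sub_base_le {D d ε K : ℝ} (hM : 0 ≤ M)
    (hL : ∀ i x y, |φ i x - φ i y| ≤ M * ‖x - y‖) (hW : 0 < W)
    (hd : ∀ w θ t, 0 < w → 0 ≤ t → InIDplus D w θ →
      d ≤ 1 - 2 * nuZero (t + w) * cos (θ - t) + nuZero (t + w) ^ 2)
    (hε : ∀ y ∈ baseSet (W ^ (-(1 / 3) : ℝ)) d, ‖y - baseProj y‖ ≤ ε →
      y ∈ nlDom ∧ ∀ i, φ i y = nl i y)
    (hp : p ∈ DomPlus D W) (hδ : 0 ≤ δ) (hδ1 : δ ≤ 1) (hu : ‖u‖ ≤ N)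
    (hsmall : δ * (1 + N) ≤ ε) (hu1 : ‖u 1‖ ≤ K * δ) (hK : 0 ≤ K) :
    ‖force φ hφ 2 δ p u - force φ hφ 2 0 p 0‖ ≤ M * (1 + N + K) * δ ^ 2 := by
  have hp0 : 0 < p.1 := hW.trans_le hp.1
  have hN : 0 ≤ N := (norm_nonneg u).trans hu
  rw [BoundedContinuousFunction.norm_le (by positivity)]
  intro t
  have hbase := nlArgs_mem_baseSet hW hd hp δ u t
  have hproj := norm_nlArgs_sub_baseProj_le hδ hδ1 hp0 u t
  have hproj' : ‖(fun j => nlArgs δ p u j t) - baseProj fun j => nlArgs δ p u j t‖ ≤ ε :=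
    hproj.trans (le_trans (by gcongr) hsmall)
  have hf : force φ hφ 2 δ p u t = φ 2 fun j => nlArgs δ p u j t := rfl
  have hf0 : force φ hφ 2 0 p 0 t = φ 2 fun j => nlArgs 0 p 0 j t := rfl
  rw [BoundedContinuousFunction.coe_sub, Pi.sub_apply, hf, hf0, nlArgs_zero_zero hp0 δ u,
    (hε _ hbase hproj').2 2]
  set y := fun j => nlArgs δ p u j t with hy
  set z : Fin 8 → ℝ := ![y 0, y 1, y 2, y 3, y 4, y 5, 0, 0] with hz
  have hzproj : baseProj z = baseProj y := rfl
  have hcoord : ∀ j, |(y - baseProj y) j| ≤ ε := fun j =>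
    (norm_le_pi_norm (y - baseProj y) j).trans hproj'
  have hε0 : 0 ≤ ε := (norm_nonneg _).trans hproj'
  have hzle : ‖z - baseProj z‖ ≤ ε := by
    rw [pi_norm_le_iff_of_nonneg hε0]
    intro j
    have := hcoord j
    rw [hzproj]
    fin_cases j <;> simp [hz, baseProj] at this ⊢ <;> assumption
  have hzbase : z ∈ baseSet (W ^ (-(1 / 3) : ℝ)) d := hbase
  rw [nl_two_eq (y := y) (a := 0) (b := 0), ← hz, ← (hε z hzbase hzle).2 2, ← hzproj]
  refine (hL 2 _ _).trans ?_
  rw [mul_assoc]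
  gcongr
  have hu0 : |u 0 t| ≤ N := ((abs_apply_le (u 0) t).trans (norm_le_pi_norm u 0)).trans hu
  have hu1' : |u 1 t| ≤ K * δ := (abs_apply_le (u 1) t).trans hu1
  have hyy := nlArgs_apply δ hp0 u t
  rw [← hy] at hyy
  rw [pi_norm_le_iff_of_nonneg (by positivity)]
  have hNδ : 0 ≤ N * δ ^ 2 := by positivity
  have hKδ : 0 ≤ K * δ ^ 2 := by positivity
  have hδ2 := sq_nonneg δ
  intro j
  rw [hz, hyy]
  fin_cases j <;> simp [baseProj, abs_of_nonneg hδ] <;> nlinarith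

lemma forceTail_two_zero (hp : 0 < p.1) (hadm : IsAdmissible φ 0 p 0) :
    forceTail φ hφ 2 0 p 0 0 = ∫ τ in Set.Ioi 0, (τ + p.1) ^ (-(1 / 3) - 1 : ℝ) *
      ((kap ^ 2)⁻¹ * sin (p.2 - τ) * (1 - (√(distZero p.1 p.2 τ) ^ 3)⁻¹)) := by
  rw [forceTail_apply hφ _ hp le_rfl, orbTail, tailAvg, ← mul_assoc, ← rpow_add (by linarith)]
  norm_num
  rw [tailInt]
  refine setIntegral_congr_fun measurableSet_Ioi fun τ hτ => ?_
  have h : force φ hφ 2 0 p 0 τ = nl 2 fun j => nlArgs 0 p 0 j τ := (hadm τ).2 2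
  have e : (-(1 / 3) - 1 : ℝ) = -(4 / 3) := by norm_num
  simp only [h]
  rw [nlArgs_apply _ hp, max_eq_left (Set.mem_Ioi.1 hτ).le, e]
  simp [nl, nlX, nlSin, nlY1, nlY2, nlNu, nlCos, distZero, nuZero]
  left; left; ring_nf

lemma abs_forceTail_two_sub_le (hW : 0 < W) (hp : W ≤ p.1) {c : ℝ}
    (h : ‖force φ hφ 2 δ p u - force φ hφ 2 0 p 0‖ ≤ c) :
    |forceTail φ hφ 2 δ p u 0 - forceTail φ hφ 2 0 p 0 0| ≤ 3 * W ^ (-(1 / 3) : ℝ) * c := by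
  have h1 := norm_bBdd_mul_tailOp_le hW hp (force φ hφ 2 δ p u - force φ hφ 2 0 p 0)
  rw [tailOp_sub, mul_sub] at h1
  exact (abs_apply_le (forceTail φ hφ 2 δ p u - forceTail φ hφ 2 0 p 0) 0).trans
    (h1.trans (by gcongr))

end Estimates

section Limits

variable {μ : ℝ} {ρ α P G : ℝ → ℝ}

lemma tendsto_relR (hρ : Tendsto ρ atTop atTop) :
    Tendsto (fun t => relR μ (ρ t) (α t)) atTop atTop := by
  refine tendsto_atTop_mono' atTop ?_ (tendsto_atTop_add_const_right atTop (-|μ|) hρ)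
  filter_upwards [hρ.eventually_gt_atTop |μ|] with t ht
  linarith [(abs_le.1 (abs_relR_sub_le (α := α t) ht)).1]

lemma tendsto_relMomR (hρ : Tendsto ρ atTop atTop) (hP : Tendsto P atTop (𝓝 0)) {g : ℝ}
    (hG : Tendsto G atTop (𝓝 g)) :
    Tendsto (fun t => relMomR μ (ρ t) (α t) (P t) (G t)) atTop (𝓝 0) := by
  have h1 : Tendsto (fun t => |P t| + |G t / ρ t|) atTop (𝓝 0) := by
    simpa using hP.abs.add (hG.div_atTop hρ).abs
  refine squeeze_zero_norm' ?_ h1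
  filter_upwards [hρ.eventually_gt_atTop |μ|] with t ht
  have hR := relR_pos (α := α t) ht
  have hsq := relR_sq μ (ρ t) (α t)
  have hY : |relY μ (ρ t) (α t)| ≤ relR μ (ρ t) (α t) :=
    abs_le_of_sq_le_sq (by nlinarith [sq_nonneg (relZ μ (α t))]) hR.le
  have hZ : |relZ μ (α t)| ≤ relR μ (ρ t) (α t) :=
    abs_le_of_sq_le_sq (by nlinarith [sq_nonneg (relY μ (ρ t) (α t))]) hR.le
  rw [Real.norm_eq_abs, relMomR, abs_div, abs_of_pos hR, div_le_iff₀ hR]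
  refine (abs_add_le _ _).trans ?_
  rw [abs_mul, abs_mul]
  nlinarith [abs_nonneg (P t), abs_nonneg (G t / ρ t)]

lemma tendsto_relMomG (hρ : Tendsto ρ atTop atTop) (hP : Tendsto P atTop (𝓝 0)) {g : ℝ}
    (hG : Tendsto G atTop (𝓝 g)) :
    Tendsto (fun t => relMomG μ (ρ t) (α t) (P t) (G t)) atTop (𝓝 g) := by
  have h1 : Tendsto (fun t => |μ| * |G t / ρ t| + |μ| * |P t|) atTop (𝓝 0) := by
    simpa using ((hG.div_atTop hρ).abs.const_mul |μ|).add (hP.abs.const_mul |μ|)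
  have h2 : Tendsto (fun t => relMomG μ (ρ t) (α t) (P t) (G t) - G t) atTop (𝓝 0) := by
    refine squeeze_zero_norm' ?_ h1
    filter_upwards [hρ.eventually_gt_atTop 0] with t ht
    have e : relMomG μ (ρ t) (α t) (P t) (G t) - G t
        = (relY μ (ρ t) (α t) - ρ t) * (G t / ρ t) - relZ μ (α t) * P t := by
      rw [relMomG]
      field_simp
      ring
    rw [Real.norm_eq_abs, e]
    refine (abs_sub _ _).trans ?_
    rw [abs_mul, abs_mul]
    have := abs_relY_sub_le μ (ρ t) (α t)
    have := abs_relZ_le μ (α t)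
    gcongr
  simpa using h2.add hG

end Limits

section ParabolicOrbit

variable {φ : Fin 3 → (Fin 8 → ℝ) → ℝ} (hφ : ∀ i, ContDiff ℝ ∞ (φ i)) {δ Θ M W N : ℝ}
  {p : ℝ × ℝ} {u : Fin 3 → ℝ →ᵇ ℝ} {ξ₀ ψ₀ : ℝ × ℝ → ℝ}

lemma tendsto_rpow_add_neg_third (w : ℝ) :
    Tendsto (fun t : ℝ => (t + w) ^ (-(1 / 3) : ℝ)) atTop (𝓝 0) :=
  (tendsto_rpow_neg_atTop (by norm_num)).comp (tendsto_atTop_add_const_right atTop w tendsto_id)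

lemma tendsto_zero_mul_of_bounded {f g : ℝ → ℝ} {C : ℝ} (hf : Tendsto f atTop (𝓝 0))
    (hg : ∀ t, 0 ≤ t → |g t| ≤ C) : Tendsto (fun t => f t * g t) atTop (𝓝 0) := by
  have h : Tendsto (fun t => |f t| * C) atTop (𝓝 0) := by simpa using hf.abs.mul_const C
  refine squeeze_zero_norm' ?_ h
  filter_upwards [eventually_ge_atTop 0] with t ht
  rw [Real.norm_eq_abs, abs_mul]
  gcongr
  exact hg t ht

lemma tendsto_orbTail (hp : 0 < p.1) (i : Fin 3) :
    Tendsto (orbTail hφ i δ p u) atTop (𝓝 0) :=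
  tendsto_zero_mul_of_bounded (tendsto_rpow_add_neg_third p.1) fun _ ht =>
    abs_tailAvg_le (by norm_num) (abs_apply_le (force φ hφ i δ p u)) (by linarith)

lemma abs_orbZeta_le {t : ℝ} (hp : 0 < p.1) (ht : 0 ≤ t) :
    |orbZeta hφ δ p u t| ≤ ‖force φ hφ 0 δ p u‖ := by
  rw [orbZeta, abs_neg]
  refine (abs_tailAvg_le (by norm_num) (abs_apply_le (force φ hφ 0 δ p u))
    (by linarith)).trans ?_
  linarith [norm_nonneg (force φ hφ 0 δ p u)]

lemma abs_orbXi_le {t : ℝ} (hp : 0 < p.1) (ht : 0 ≤ t)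
    (hfix : fixMap φ hφ δ Θ ξ₀ ψ₀ (p, u) = u) : |orbXi hφ δ p u (ξ₀ p) t| ≤ ‖u‖ := by
  rw [← fixMap_fixed_zero hφ hfix hp ht]
  exact (abs_apply_le (u 0) t).trans (norm_le_pi_norm u 0)

lemma tendsto_orbRho (hp : 0 < p.1) (hfix : fixMap φ hφ δ Θ ξ₀ ψ₀ (p, u) = u) :
    Tendsto (orbRho hφ δ p u (ξ₀ p)) atTop atTop := by
  have h1 : Tendsto (fun t : ℝ => (t + p.1) ^ (2 / 3 : ℝ)) atTop atTop :=
    (tendsto_rpow_atTop (by norm_num)).comp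
      (tendsto_atTop_add_const_right atTop p.1 tendsto_id)
  have h2 := tendsto_atTop_add_const_right atTop (-(δ ^ 2 * ‖u‖)) (h1.const_mul_atTop kap_pos)
  refine tendsto_atTop_mono' atTop ?_ h2
  filter_upwards [eventually_ge_atTop 0] with t ht
  have h3 := (abs_le.1 (abs_orbXi_le hφ hp ht hfix)).1
  rw [orbRho]
  nlinarith [sq_nonneg δ]

lemma tendsto_orbMomR (hp : 0 < p.1) (hfix : fixMap φ hφ δ Θ ξ₀ ψ₀ (p, u) = u) :
    Tendsto (orbMomR hφ δ p u (ξ₀ p)) atTop (𝓝 0) := by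
  have hb := tendsto_rpow_add_neg_third p.1
  have hb3 := hb.pow 3
  rw [zero_pow (by norm_num)] at hb3
  have h := tendsto_zero_mul_of_bounded (C := ‖u‖ + ‖force φ hφ 0 δ p u‖) hb3
    (g := fun t => -(orbXi hφ δ p u (ξ₀ p) t) / 3 + orbZeta hφ δ p u t) fun t ht => by
      refine (abs_add_le _ _).trans (add_le_add ?_ (abs_orbZeta_le hφ hp ht))
      rw [abs_div, abs_neg, abs_of_pos (by norm_num : (0 : ℝ) < 3)]
      linarith [abs_orbXi_le hφ hp ht hfix, norm_nonneg u]
  have h' := (hb.const_mul (2 / 3 * kap)).add (h.const_mul (δ ^ 2))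
  rw [mul_zero, mul_zero, add_zero] at h'
  exact h'

lemma tendsto_orbMomG (hp : 0 < p.1) : Tendsto (orbMomG hφ δ Θ p u) atTop (𝓝 (δ ^ 2 * Θ)) := by
  have h := ((tendsto_orbTail hφ (δ := δ) (u := u) hp 2).const_sub Θ).const_mul (δ ^ 2)
  rw [sub_zero] at h
  exact h

lemma lt_orbRho {t : ℝ} (hW : 0 < W) (hp : W ≤ p.1)
    (hfix : fixMap φ hφ δ Θ ξ₀ ψ₀ (p, u) = u) (hu : ‖u‖ ≤ N)
    (hsmall : δ ^ 2 * (1 + N) < kap * W ^ (2 / 3 : ℝ)) (ht : 0 ≤ t) :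
    δ ^ 2 < orbRho hφ δ p u (ξ₀ p) t := by
  have h3 := (abs_le.1 (abs_orbXi_le hφ (hW.trans_le hp) ht hfix)).1
  have h4 : kap * W ^ (2 / 3 : ℝ) ≤ kap * (t + p.1) ^ (2 / 3 : ℝ) := by
    have := kap_pos
    gcongr
    linarith
  rw [orbRho]
  nlinarith [sq_nonneg δ]

lemma orbRho_zero (hδ : 0 < δ) (hp : 0 < p.1) :
    orbRho hφ δ p u (initXi δ p) 0 = relR (-δ ^ 2) (kap * p.1 ^ (2 / 3 : ℝ)) p.2 := by
  rw [orbRho, orbXi_zero hφ hp, initXi, zero_add]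
  field_simp
  ring

lemma orbPhi_zero (hδ : 0 < δ) :
    orbPhi hφ δ p u (initPsi δ p) 0 - 0
      = relAngle (-δ ^ 2) (kap * p.1 ^ (2 / 3 : ℝ)) p.2 := by
  rw [orbPhi, add_sub_cancel_right, initPsi]
  field_simp
  ring

/-- Radial component of the parametrization. -/
noncomputable def paramR (δ Θ : ℝ) (p : ℝ × ℝ) (u : Fin 3 → ℝ →ᵇ ℝ) : ℝ :=
  relMomR (δ ^ 2) (relR (-δ ^ 2) (kap * p.1 ^ (2 / 3 : ℝ)) p.2)
    (relAngle (-δ ^ 2) (kap * p.1 ^ (2 / 3 : ℝ)) p.2)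
    (orbMomR hφ δ p u (initXi δ p) 0) (orbMomG hφ δ Θ p u 0)

/-- Angular momentum component of the parametrization. -/
noncomputable def paramG (δ Θ : ℝ) (p : ℝ × ℝ) (u : Fin 3 → ℝ →ᵇ ℝ) : ℝ :=
  relMomG (δ ^ 2) (relR (-δ ^ 2) (kap * p.1 ^ (2 / 3 : ℝ)) p.2)
    (relAngle (-δ ^ 2) (kap * p.1 ^ (2 / 3 : ℝ)) p.2)
    (orbMomR hφ δ p u (initXi δ p) 0) (orbMomG hφ δ Θ p u 0)

theorem exists_parabolic_orbit (hW : 0 < W) (hp : W ≤ p.1) (hδ : 0 < δ)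
    (hfix : fixMap φ hφ δ Θ (initXi δ) (initPsi δ) (p, u) = u) (hadm : IsAdmissible φ δ p u)
    (hu : ‖u‖ ≤ N) (hsmall : δ ^ 2 * (1 + N) < kap * W ^ (2 / 3 : ℝ)) :
    ∃ r θ R G : ℝ → ℝ, IsPolarSol (δ ^ 2) (Set.Ici 0) r θ R G ∧
      r 0 = kap * p.1 ^ (2 / 3 : ℝ) ∧ θ 0 = p.2 ∧ R 0 = paramR hφ δ Θ p u ∧
      G 0 = paramG hφ δ Θ p u ∧ Tendsto r atTop atTop ∧ Tendsto R atTop (𝓝 0) ∧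
      Tendsto G atTop (𝓝 (δ ^ 2 * Θ)) := by
  have hp0 := hW.trans_le hp
  have hN := (norm_nonneg u).trans hu
  have hr : |δ ^ 2| < kap * p.1 ^ (2 / 3 : ℝ) := by
    rw [abs_of_nonneg (sq_nonneg δ)]
    nlinarith [kap_mul_le hW hp, sq_nonneg δ]
  have hρ := tendsto_orbRho hφ hp0 hfix
  have hP := tendsto_orbMomR hφ hp0 hfix
  have hG := tendsto_orbMomG hφ (δ := δ) (Θ := Θ) (u := u) hp0
  refine ⟨_, _, _, _, isPolarSol_orbit hφ hp0 hfix hadm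
    (fun t ht => lt_orbRho hφ hW hp hfix hu hsmall ht), ?_, ?_, ?_, ?_,
    tendsto_relR hρ, tendsto_relMomR hρ hP hG, tendsto_relMomG hρ hP hG⟩
  all_goals rw [orbRho_zero hφ hδ hp0, orbPhi_zero hφ hδ]
  · exact relR_relR_neg hr
  · exact relAngle_relR_neg hr
  · rfl
  · rfl

end ParabolicOrbit

section Smoothness

variable {φ : Fin 3 → (Fin 8 → ℝ) → ℝ} (hφ : ∀ i, ContDiff ℝ ∞ (φ i)) {δ Θ M W : ℝ}
  {p : ℝ × ℝ} {u : Fin 3 → ℝ →ᵇ ℝ}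

lemma orbMomR_zero {x : ℝ} (hp : 0 < p.1) :
    orbMomR hφ δ p u x 0 = 2 / 3 * kap * p.1 ^ (-(1 / 3) : ℝ)
      + δ ^ 2 * ((p.1 ^ (-(1 / 3) : ℝ)) ^ 3 * (-x / 3 - radialTail φ hφ δ p u 0)) := by
  rw [orbMomR, orbXi_zero hφ hp, orbZeta, radialTail, tailOp_apply _ hp, max_self, zero_add,
    ← sub_eq_add_neg]

lemma orbMomG_zero (hp : 0 < p.1) :
    orbMomG hφ δ Θ p u 0 = δ ^ 2 * (Θ - forceTail φ hφ 2 δ p u 0) := by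
  rw [orbMomG, forceTail_apply hφ _ hp le_rfl]

variable {U : ℝ × ℝ → Fin 3 → ℝ →ᵇ ℝ}

lemma ContDiffWithinAt.eval_zero {s : Set (ℝ × ℝ)} {f : ℝ × ℝ → ℝ →ᵇ ℝ}
    (hf : ContDiffWithinAt ℝ ∞ f s p) : ContDiffWithinAt ℝ ∞ (fun p => f p 0) s p :=
  (BoundedContinuousFunction.evalCLM (β := ℝ) ℝ (0 : ℝ)).contDiff.comp_contDiffWithinAt hf

lemma contDiffWithinAt_orbMom {s : Set (ℝ × ℝ)} (hs : ∀ q ∈ s, 0 < q.1) (hp : p ∈ s)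
    (hU : ContDiffWithinAt ℝ ∞ U s p) (hx : ContDiffAt ℝ ∞ (initXi δ) p) :
    ContDiffWithinAt ℝ ∞ (fun p => orbMomR hφ δ p (U p) (initXi δ p) 0) s p ∧
      ContDiffWithinAt ℝ ∞ (fun p => orbMomG hφ δ Θ p (U p) 0) s p := by
  have hpair : ContDiffWithinAt ℝ ∞ (fun p => (p, U p)) s p := contDiffWithinAt_id.prodMk hU
  have h1 := ((contDiffAt_radialTail φ hφ δ (q := (p, U p)) (hs p hp)).comp_contDiffWithinAt p
    hpair).eval_zero
  have h2 := ((contDiffAt_forceTail φ hφ 2 δ (q := (p, U p)) (hs p hp)).comp_contDiffWithinAt p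
    hpair).eval_zero
  have hb : ContDiffWithinAt ℝ ∞ (fun p : ℝ × ℝ => p.1 ^ (-(1 / 3) : ℝ)) s p :=
    contDiffWithinAt_fst.rpow_const_of_ne (hs p hp).ne'
  have hx' := hx.contDiffWithinAt (s := s)
  constructor
  · refine ContDiffWithinAt.congr ?_ (fun q hq => orbMomR_zero hφ (hs q hq))
      (orbMomR_zero hφ (hs p hp))
    exact (contDiffWithinAt_const.mul hb).add (contDiffWithinAt_const.mul
      ((hb.pow 3).mul ((hx'.neg.div_const 3).sub h1)))
  · refine ContDiffWithinAt.congr ?_ (fun q hq => orbMomG_zero hφ (hs q hq))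
      (orbMomG_zero hφ (hs p hp))
    exact contDiffWithinAt_const.mul (contDiffWithinAt_const.sub h2)

theorem contDiffOn_param (hW : 0 < W) (hδ : 2 * δ ^ 2 < kap * W ^ (2 / 3 : ℝ))
    (hU : ContDiffOn ℝ ∞ U {p | W ≤ p.1}) :
    ContDiffOn ℝ ∞ (fun p => paramR hφ δ Θ p (U p)) {p | W ≤ p.1} ∧
      ContDiffOn ℝ ∞ (fun p => paramG hφ δ Θ p (U p)) {p | W ≤ p.1} := by
  have hs : ∀ q ∈ {p : ℝ × ℝ | W ≤ p.1}, 0 < q.1 := fun q hq => hW.trans_le hq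
  have hδ' : δ ^ 2 < kap * W ^ (2 / 3 : ℝ) := by nlinarith [sq_nonneg δ]
  have key : ∀ p ∈ {p : ℝ × ℝ | W ≤ p.1},
      ContDiffWithinAt ℝ ∞ (fun p => paramR hφ δ Θ p (U p)) {p | W ≤ p.1} p ∧
      ContDiffWithinAt ℝ ∞ (fun p => paramG hφ δ Θ p (U p)) {p | W ≤ p.1} p := by
    intro p hp
    obtain ⟨hP, hG⟩ := contDiffWithinAt_orbMom hφ (Θ := Θ) hs hp (hU p hp)
      (contDiffAt_initXi hW hp hδ')
    have hr := kap_mul_le hW hp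
    have hr' : |-δ ^ 2| < kap * p.1 ^ (2 / 3 : ℝ) := by rw [abs_neg_sq]; linarith
    have hρ := (contDiffAt_relR (μ := -δ ^ 2) (contDiffAt_radius (hs p hp)) contDiffAt_snd
      hr').contDiffWithinAt (s := {p : ℝ × ℝ | W ≤ p.1})
    have hα := (contDiffAt_relAngle (μ := -δ ^ 2) (contDiffAt_radius (hs p hp)) contDiffAt_snd
      hr').contDiffWithinAt (s := {p : ℝ × ℝ | W ≤ p.1})
    have hdist := (abs_le.1 (abs_relR_sub_le (α := p.2) hr')).1
    rw [abs_neg_sq] at hdist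
    have hρ0 : 0 < relR (-δ ^ 2) (kap * p.1 ^ (2 / 3 : ℝ)) p.2 := by nlinarith [sq_nonneg δ]
    have hback : relR (δ ^ 2) (relR (-δ ^ 2) (kap * p.1 ^ (2 / 3 : ℝ)) p.2)
        (relAngle (-δ ^ 2) (kap * p.1 ^ (2 / 3 : ℝ)) p.2) ≠ 0 := by
      refine (relR_pos ?_).ne'
      rw [abs_of_nonneg (sq_nonneg δ)]
      linarith
    have hrel := ContDiffAt.comp_contDiffWithinAt p (contDiffAt_relR (μ := δ ^ 2)
      (f := Prod.fst) (g := Prod.snd) (p := (_, _)) contDiffAt_fst contDiffAt_snd (by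
        rw [abs_of_nonneg (sq_nonneg δ)]
        change δ ^ 2 < relR (-δ ^ 2) (kap * p.1 ^ (2 / 3 : ℝ)) p.2
        linarith)) (hρ.prodMk hα)
    have hsin := contDiff_sin.comp_contDiffWithinAt hα
    have hcos := contDiff_cos.comp_contDiffWithinAt hα
    have hY : ContDiffWithinAt ℝ ∞ (fun p : ℝ × ℝ => relY (δ ^ 2)
        (relR (-δ ^ 2) (kap * p.1 ^ (2 / 3 : ℝ)) p.2)
        (relAngle (-δ ^ 2) (kap * p.1 ^ (2 / 3 : ℝ)) p.2)) {p | W ≤ p.1} p :=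
      hρ.add (contDiffWithinAt_const.mul hcos)
    have hZ : ContDiffWithinAt ℝ ∞ (fun p : ℝ × ℝ => relZ (δ ^ 2)
        (relAngle (-δ ^ 2) (kap * p.1 ^ (2 / 3 : ℝ)) p.2)) {p | W ≤ p.1} p := by
      unfold relZ
      exact (contDiffWithinAt_const.mul hsin).neg
    constructor
    · exact ((hY.mul hP).add (hZ.mul (hG.div hρ hρ0.ne'))).div hrel hback
    · exact (hY.mul (hG.div hρ hρ0.ne')).sub (hZ.mul hP)
  exact ⟨fun p hp => (key p hp).1, fun p hp => (key p hp).2⟩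

end Smoothness

section Asymptotics

variable {φ : Fin 3 → (Fin 8 → ℝ) → ℝ} (hφ : ∀ i, ContDiff ℝ ∞ (φ i)) {δ Θ M W N : ℝ}
  {p : ℝ × ℝ} {u : Fin 3 → ℝ →ᵇ ℝ}

lemma abs_orbMomR_zero_sub_le (hM : 0 ≤ M) (hb : ∀ i x, |φ i x| ≤ M) (hW : 0 < W) (hp : W ≤ p.1)
    {x : ℝ} (hx : |x| ≤ 1) :
    |orbMomR hφ δ p u x 0 - 2 / 3 * kap * p.1 ^ (-(1 / 3) : ℝ)|
      ≤ (W ^ (-(1 / 3) : ℝ)) ^ 3 * (1 / 3 + M) * δ ^ 2 := by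
  have hp0 := hW.trans_le hp
  have hB : p.1 ^ (-(1 / 3) : ℝ) ≤ W ^ (-(1 / 3) : ℝ) :=
    rpow_le_rpow_of_nonpos hW hp (by norm_num)
  have hr := (abs_apply_le (radialTail φ hφ δ p u) 0).trans (norm_radialTail_le hφ hM hb u hp0)
  rw [orbMomR_zero hφ hp0, add_sub_cancel_left, abs_mul, abs_mul, abs_of_nonneg (sq_nonneg δ),
    abs_of_pos (by positivity : 0 < (p.1 ^ (-(1 / 3) : ℝ)) ^ 3)]
  have h1 : |-x / 3 - radialTail φ hφ δ p u 0| ≤ 1 / 3 + M := by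
    refine (abs_sub _ _).trans (add_le_add ?_ hr)
    rw [abs_div, abs_neg, abs_of_pos (by norm_num : (0 : ℝ) < 3)]
    gcongr
  calc _ ≤ δ ^ 2 * ((W ^ (-(1 / 3) : ℝ)) ^ 3 * (1 / 3 + M)) := by gcongr
    _ = _ := by ring

lemma abs_orbMomG_zero_le (hM : 0 ≤ M) (hb : ∀ i x, |φ i x| ≤ M) (hW : 0 < W) (hp : W ≤ p.1) :
    |orbMomG hφ δ Θ p u 0| ≤ (|Θ| + 3 * W ^ (-(1 / 3) : ℝ) * M) * δ ^ 2 := by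
  rw [orbMomG_zero hφ (hW.trans_le hp), abs_mul, abs_of_nonneg (sq_nonneg δ), mul_comm]
  have := (abs_apply_le (forceTail φ hφ 2 δ p u) 0).trans
    (norm_forceTail_le hφ hM hb 2 u hW hp)
  have := abs_sub Θ (forceTail φ hφ 2 δ p u 0)
  gcongr
  linarith

lemma abs_base_momentum_le (hW : 0 < W) (hp : W ≤ p.1) :
    |2 / 3 * kap * p.1 ^ (-(1 / 3) : ℝ)| ≤ 2 / 3 * kap * W ^ (-(1 / 3) : ℝ) := by
  have hp0 := hW.trans_le hp
  have hk := kap_pos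
  rw [abs_of_pos (by positivity : 0 < 2 / 3 * kap * p.1 ^ (-(1 / 3) : ℝ))]
  exact mul_le_mul_of_nonneg_left (rpow_le_rpow_of_nonpos hW hp (by norm_num)) (by positivity)

theorem exists_abs_paramR_sub_le (hM : 0 ≤ M) (hb : ∀ i x, |φ i x| ≤ M) (hW : 0 < W) (Θ : ℝ) :
    ∃ C, ∀ δ, 0 < δ → δ ≤ 1 → 4 * δ ^ 2 ≤ kap * W ^ (2 / 3 : ℝ) → ∀ p u, W ≤ p.1 →
      |paramR hφ δ Θ p u - √(2 / kap) * p.1 ^ (-(1 / 3) : ℝ)| ≤ C * δ ^ 2 := by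
  have hk := kap_pos
  refine ⟨(W ^ (-(1 / 3) : ℝ)) ^ 3 * (1 / 3 + M)
      + 2 * (2 / 3 * kap * W ^ (-(1 / 3) : ℝ) + (W ^ (-(1 / 3) : ℝ)) ^ 3 * (1 / 3 + M))
        / (kap * W ^ (2 / 3 : ℝ))
      + (|Θ| + 3 * W ^ (-(1 / 3) : ℝ) * M) / (kap * W ^ (2 / 3 : ℝ)),
    fun δ hδ hδ1 hδr p u hp => ?_⟩
  have hp0 := hW.trans_le hp
  have hr := kap_mul_le hW hp
  have hd : 0 < δ ^ 2 := by positivity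
  have hr' : |δ ^ 2| < kap * p.1 ^ (2 / 3 : ℝ) := by rw [abs_of_pos hd]; linarith
  rw [sqrt_two_div_kap, paramR]
  refine abs_relMomR_sub_le hd.le (by positivity : 0 < kap * W ^ (2 / 3 : ℝ)) (by nlinarith) hδr hr
    (relR_relR_neg hr') ?_ (abs_orbMomR_zero_sub_le hφ hM hb hW hp
      (abs_initXi_le hW hp hδ (by linarith))) (abs_base_momentum_le hW hp)
    (abs_orbMomG_zero_le hφ hM hb hW hp) (by positivity) (by positivity)
  have := abs_relR_sub_le (μ := -δ ^ 2) (α := p.2) (ρ := kap * p.1 ^ (2 / 3 : ℝ))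
    (by rwa [abs_neg])
  rwa [abs_neg_sq] at this

theorem exists_abs_paramG_sub_le (hM : 0 ≤ M) (hb : ∀ i x, |φ i x| ≤ M)
    (hL : ∀ i x y, |φ i x - φ i y| ≤ M * ‖x - y‖) {D d ε : ℝ} (hW : 0 < W) (hd0 : 0 < d)
    (hd : ∀ w θ t, 0 < w → 0 ≤ t → InIDplus D w θ →
      d ≤ 1 - 2 * nuZero (t + w) * cos (θ - t) + nuZero (t + w) ^ 2)
    (hε : ∀ y ∈ baseSet (W ^ (-(1 / 3) : ℝ)) d, ‖y - baseProj y‖ ≤ ε →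
      y ∈ nlDom ∧ ∀ i, φ i y = nl i y) (Θ N : ℝ) (hN : 0 ≤ N) :
    ∃ C, ∀ δ, 0 < δ → δ ≤ 1 → 4 * δ ^ 2 ≤ kap * W ^ (2 / 3 : ℝ) → δ * (1 + N) ≤ ε →
      ∀ p ∈ DomPlus D W, ∀ u, ‖u‖ ≤ N →
        fixMap φ hφ δ Θ (initXi δ) (initPsi δ) (p, u) = u →
        ∃ LA LB : ℝ, Tendsto (fun T => ∫ s in p.1..T, melInfA p.2 p.1 s) atTop (𝓝 LA) ∧
          Tendsto (fun T => ∫ s in p.1..T, melInfB p.2 p.1 s) atTop (𝓝 LB) ∧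
          |paramG hφ δ Θ p u - δ ^ 2 * Θ - δ ^ 2 * kap * LA - δ ^ 2 * √(2 / kap) * LB|
            ≤ C * (δ ^ 2) ^ 2 := by
  have hk := kap_pos
  refine ⟨(|Θ| + 3 * W ^ (-(1 / 3) : ℝ) * M) / (kap * W ^ (2 / 3 : ℝ) / 2)
      + (W ^ (-(1 / 3) : ℝ)) ^ 3 * (1 / 3 + M)
      + 2 / (kap * W ^ (2 / 3 : ℝ)) * (2 / 3 * kap * W ^ (-(1 / 3) : ℝ))
      + 3 * W ^ (-(1 / 3) : ℝ) * (M * (1 + N + (2 / (kap * W ^ (2 / 3 : ℝ))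
        + 6 * W ^ (-(1 / 3) : ℝ) * (M * (1 + N))))),
    fun δ hδ hδ1 hδr hδε p hp u hu hfix => ?_⟩
  have hpW : W ≤ p.1 := hp.1
  have hp0 := hW.trans_le hpW
  have hr := kap_mul_le hW hpW
  have hr0 : 0 < kap * W ^ (2 / 3 : ℝ) := by positivity
  have hd2 : 0 < δ ^ 2 := by positivity
  have hr' : |-δ ^ 2| < kap * p.1 ^ (2 / 3 : ℝ) := by rw [abs_neg_sq]; linarith
  have hε0 : 0 ≤ ε := by nlinarith
  have hadm : IsAdmissible φ 0 p 0 :=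
    isAdmissible_of_small hW hd hε hp le_rfl zero_le_one (by simpa using hε0)
  obtain ⟨LA, LB, hA, hB, hAB⟩ := exists_melnikov_limits hp0 hd0
    (fun t ht => hd p.1 p.2 t hp0 ht hp.2)
  refine ⟨LA, LB, hA, hB, ?_⟩
  have hu1 := norm_apply_one_le hφ hM hL hδ.le hδ1 hW hpW hu hfix hadm
    (abs_initPsi_le hW hpW hδ (by linarith))
  have hforce := abs_forceTail_two_sub_le hφ hW hpW
    (norm_force_two_sub_base_le hφ hM hL hW hd hε hp hδ.le hδ1 hu hδε hu1 (by positivity))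
  have hρ := abs_relR_sub_le (α := p.2) hr'
  rw [abs_neg_sq] at hρ
  have hα : |relAngle (-δ ^ 2) (kap * p.1 ^ (2 / 3 : ℝ)) p.2 - p.2|
      ≤ 2 / (kap * W ^ (2 / 3 : ℝ)) * δ ^ 2 := by
    refine (abs_relAngle_sub_le (by rw [abs_neg_sq]; linarith) (hr0.trans_le hr)).trans ?_
    rw [abs_neg_sq, div_mul_eq_mul_div]
    gcongr
  have hρ' : kap * W ^ (2 / 3 : ℝ) / 2 ≤ relR (-δ ^ 2) (kap * p.1 ^ (2 / 3 : ℝ)) p.2 := by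
    linarith [(abs_le.1 hρ).1]
  have hmom := abs_relMomG_sub_le hd2.le (half_pos hr0) hρ' hα
    (abs_orbMomR_zero_sub_le hφ hM hb hW hpW (u := u) (abs_initXi_le hW hpW hδ (by linarith)))
    (abs_base_momentum_le hW hpW)
    (abs_orbMomG_zero_le hφ hM hb hW hpW (u := u) (Θ := Θ)) (by positivity) (by positivity)
  rw [← forceTail_two_zero hφ hp0 hadm, sqrt_two_div_kap] at hAB
  have e : paramG hφ δ Θ p u - δ ^ 2 * Θ - δ ^ 2 * kap * LA - δ ^ 2 * √(2 / kap) * LB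
      = (paramG hφ δ Θ p u - orbMomG hφ δ Θ p u 0
          - δ ^ 2 * (sin p.2 * (2 / 3 * kap * p.1 ^ (-(1 / 3) : ℝ))))
        - δ ^ 2 * (forceTail φ hφ 2 δ p u 0 - forceTail φ hφ 2 0 p 0 0) := by
    rw [orbMomG_zero hφ hp0, sqrt_two_div_kap]
    linear_combination -δ ^ 2 * hAB
  rw [e]
  refine (abs_sub _ _).trans ?_
  rw [abs_mul, abs_of_pos hd2]
  refine (add_le_add hmom (mul_le_mul_of_nonneg_left hforce hd2.le)).trans_eq ?_
  ring

end Asymptotics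

/-- Graph parameterization `(R^s_∞, Θ^s_∞)`, over `(w,θ) ∈ D⁺_{W,D}` (with `r = κ w^{2/3}`),
of (a subset of) the stable manifold of the parabolic infinity with angular momentum
`Θ̂₀ = μ Θ̄₀`: the corresponding orbits are forward-parabolic with asymptotic angular
momentum `Θ̂₀`, and the parameterization admits explicit first-order asymptotics in `μ`. -/
theorem infinity_stable_manifold_parametrization
    (a b D W Θbar : ℝ) (hab : a < b) (hD : D ∈ Set.Ioo (0 : ℝ) (1 / 2)) (hW : 0 < W)
    (hΘbar : Θbar ∈ Set.Icc a b) :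
    ∃ μ₀ : ℝ, 0 < μ₀ ∧ ∃ C : ℝ, 0 < C ∧
      ∀ μ ∈ Set.Ioo (0 : ℝ) μ₀,
        ∃ Rs Θs : ℝ → ℝ → ℝ,
          ContDiffOn ℝ (⊤ : ℕ∞) (fun p : ℝ × ℝ => Rs p.1 p.2) (DomPlus D W) ∧
          ContDiffOn ℝ (⊤ : ℕ∞) (fun p : ℝ × ℝ => Θs p.1 p.2) (DomPlus D W) ∧
          ∀ w θ0 : ℝ, (w, θ0) ∈ DomPlus D W →
            (∃ r θ R Θ : ℝ → ℝ,
              IsPolarSol μ (Set.Ici 0) r θ R Θ ∧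
              r 0 = kap * w ^ ((2 : ℝ) / 3) ∧ θ 0 = θ0 ∧
              R 0 = Rs w θ0 ∧ Θ 0 = Θs w θ0 ∧
              Tendsto r atTop atTop ∧
              Tendsto R atTop (𝓝 0) ∧
              Tendsto Θ atTop (𝓝 (μ * Θbar))) ∧
            |Rs w θ0 - Real.sqrt (2 / kap) * w ^ (-(1 / 3) : ℝ)| ≤ C * μ ∧
            ∃ LA LB : ℝ,
              Tendsto (fun T => ∫ s in w..T, melInfA θ0 w s) atTop (𝓝 LA) ∧
              Tendsto (fun T => ∫ s in w..T, melInfB θ0 w s) atTop (𝓝 LB) ∧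
              |Θs w θ0 - μ * Θbar - μ * kap * LA - μ * Real.sqrt (2 / kap) * LB|
                ≤ C * μ ^ 2 := by
  obtain ⟨d, hd0, hd⟩ := exists_unperturbed_dist_bound hD
  obtain ⟨φ, hφ, M, hM, hb, hL, ε, hε0, hε⟩ :=
    exists_extension_nl (W ^ (-(1 / 3) : ℝ)) hd0
  have hr0 : 0 < kap * W ^ (2 / 3 : ℝ) := mul_pos kap_pos (rpow_pos_of_pos hW _)
  obtain ⟨N, hN⟩ : ∃ N, N = 2 + |Θbar| + (3 + 6 * W ^ (-(1 / 3) : ℝ)) * M := ⟨_, rfl⟩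
  have hN0 : 0 ≤ N := hN ▸ by positivity
  obtain ⟨C₁, hC₁⟩ := exists_abs_paramR_sub_le hφ hM.le hb hW Θbar
  obtain ⟨C₂, hC₂⟩ := exists_abs_paramG_sub_le hφ hM.le hb hL hW hd0 hd hε Θbar N hN0
  have hsmall (c : ℝ) {e : ℝ} (he : 0 < e) : ∀ᶠ δ : ℝ in 𝓝 0, c * δ < e :=
    (continuous_const_mul c).tendsto' 0 0 (mul_zero c) |>.eventually_lt_const he
  obtain ⟨δ₀, hδ₀, hδ₀'⟩ := Metric.eventually_nhds_iff.1
    ((hsmall 1 one_pos).and ((hsmall 4 hr0).and ((hsmall ((3 + 6 * W ^ (-(1 / 3) : ℝ)) * M)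
      one_half_pos).and ((hsmall (1 + N) hε0).and (hsmall (1 + N) hr0)))))
  refine ⟨δ₀ ^ 2, by positivity, max 1 (max C₁ C₂), by positivity, fun μ hμ => ?_⟩
  obtain ⟨δ, hδ, rfl⟩ : ∃ δ, 0 < δ ∧ δ ^ 2 = μ := ⟨√μ, sqrt_pos.2 hμ.1, sq_sqrt hμ.1.le⟩
  have hδδ₀ : δ < δ₀ := lt_of_pow_lt_pow_left₀ 2 hδ₀.le hμ.2
  obtain ⟨h1, h2, h3, h4, h5⟩ := @hδ₀' δ (by rwa [dist_zero_right, norm_of_nonneg hδ.le])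
  rw [one_mul] at h1
  rw [mul_comm (1 + N)] at h4
  have h2' : 4 * δ ^ 2 ≤ kap * W ^ (2 / 3 : ℝ) := by nlinarith
  have h5' : δ ^ 2 * (1 + N) < kap * W ^ (2 / 3 : ℝ) := by nlinarith
  obtain ⟨U, hU, hfix⟩ := exists_fixedPoint_fixMap hφ hM.le hL hδ.le h1.le Θbar hW h3.le
    (fun p hp => contDiffAt_initXi (δ := δ) hW hp (by linarith [sq_nonneg δ]))
    (fun p hp => contDiffAt_initPsi (δ := δ) hW hp (by linarith [sq_nonneg δ]))
  have hUN (p : ℝ × ℝ) (hp : W ≤ p.1) : ‖U p‖ ≤ N := by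
    have hξ := abs_initXi_le hW hp hδ (by linarith [sq_nonneg δ])
    have hψ := abs_initPsi_le hW hp hδ (by linarith [sq_nonneg δ])
    have hψ' : 2 / (kap * W ^ (2 / 3 : ℝ)) * δ ≤ 1 := by
      rw [div_mul_eq_mul_div, div_le_one hr0]
      linarith
    have := norm_fixMap_le hφ hM.le hb (δ := δ) (Θ := Θbar) (ξ₀ := initXi δ) (ψ₀ := initPsi δ)
      hW hp (U p)
    rw [hfix p hp] at this
    linarith
  obtain ⟨hR, hG⟩ := contDiffOn_param hφ (Θ := Θbar) hW (by linarith [pow_pos hδ 2]) hU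
  refine ⟨fun w θ => paramR hφ δ Θbar (w, θ) (U (w, θ)),
    fun w θ => paramG hφ δ Θbar (w, θ) (U (w, θ)), hR.mono fun p hp => hp.1,
    hG.mono fun p hp => hp.1, fun w θ hp => ?_⟩
  have hN' := hUN _ hp.1
  refine ⟨?_, ?_, ?_⟩
  · exact exists_parabolic_orbit hφ hW hp.1 hδ (hfix _ hp.1)
      (isAdmissible_of_small hW hd hε hp hδ.le h1.le
        ((mul_le_mul_of_nonneg_left (by gcongr) hδ.le).trans h4.le)) hN' h5'
  · refine (hC₁ δ hδ h1.le h2' (w, θ) _ hp.1).trans ?_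
    gcongr
    exact (le_max_left _ _).trans (le_max_right _ _)
  · obtain ⟨LA, LB, hA, hB, h⟩ := hC₂ δ hδ h1.le h2' h4.le (w, θ) hp _ hN' (hfix _ hp.1)
    refine ⟨LA, LB, hA, hB, h.trans ?_⟩
    gcongr
    exact (le_max_right _ _).trans (le_max_right _ _)
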